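/- There exist k₀ > 0 and K₀ ≥ 1 such that for all k, K with 0 < k < k₀ and K ≥ K₀, the metric measure space (X₀, d_∞, m₀) satisfies the CD(0,∞) condition: for every pair of probability measures μ₀, μ₁ on X₀ absolutely continuous with respect to m₀, there exists a constant-speed W₂-geodesic (μ_t)_{t∈[0,1]} from μ₀ to μ₁ such that Ent(μ_t) ≤ (1−t)·Ent(μ₀) + t·Ent(μ₁) for every t ∈ [0,1]. -/

import Mathlib

open MeasureTheory

-- relative entropy with values in `EReal` (`+∞` if not absolutely continuous or not integrable)
open Classical in
noncomputable def Ent {α : Type*} [MeasurableSpace α] (m μ : Measure α) : EReal :=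
  if μ ≪ m ∧ Integrable (llr μ m) μ then ((∫ z, llr μ m z ∂μ : ℝ) : EReal) else ⊤

-- squared 2-Wasserstein distance w.r.t. cost `d`, as an infimum over couplings
noncomputable def W2sq {α : Type*} [MeasurableSpace α] (d : α → α → ℝ)
    (μ ν : Measure α) : ENNReal :=
  ⨅ (π : Measure (α × α)) (_ : Measure.map Prod.fst π = μ ∧ Measure.map Prod.snd π = ν),
    ∫⁻ p, ENNReal.ofReal (d p.1 p.2 ^ 2) ∂π

open MeasureTheory

lemma diam_lem {Z : Type*} (T : Set Z) (a b c : Z → ℝ) (P0 P1 : ℝ) (hP0 : 0 < P0) (hP1 : 0 < P1)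
    (h : ∀ γ ∈ T, ∀ γ' ∈ T, c γ ≤ c γ' → a γ ≤ a γ' ∧ b γ ≤ b γ' ∧
      P0 * (a γ' - a γ) + P1 * (b γ' - b γ) ≤ c γ' - c γ) (hb : Bornology.IsBounded (c '' T)) :
    ENNReal.ofReal P0 * Metric.ediam (a '' T) + ENNReal.ofReal P1 * Metric.ediam (b '' T)
      ≤ Metric.ediam (c '' T) := by
  have key : ∀ γ1 ∈ T, ∀ γ2 ∈ T, ∀ γ3 ∈ T, ∀ γ4 ∈ T,
      P0 * |a γ1 - a γ2| + P1 * |b γ3 - b γ4| ≤ Metric.diam (c '' T) := by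
    intro γ1 h1 γ2 h2 γ3 h3 γ4 h4
    -- pick extremes
    have hex : ∃ m ∈ T, ∃ M ∈ T, c m ≤ c γ1 ∧ c m ≤ c γ2 ∧ c m ≤ c γ3 ∧ c m ≤ c γ4 ∧
        c γ1 ≤ c M ∧ c γ2 ≤ c M ∧ c γ3 ≤ c M ∧ c γ4 ≤ c M := by
      have hS : ({γ1, γ2, γ3, γ4} : Set Z).Finite := by simp
      obtain ⟨m, hm, hm'⟩ := Set.exists_min_image _ c hS ⟨γ1, by simp⟩
      obtain ⟨M, hM, hM'⟩ := Set.exists_max_image _ c hS ⟨γ1, by simp⟩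
      have hsub : ({γ1, γ2, γ3, γ4} : Set Z) ⊆ T := by
        intro x hx
        simp only [Set.mem_insert_iff, Set.mem_singleton_iff] at hx
        rcases hx with rfl | rfl | rfl | rfl <;> assumption
      exact ⟨m, hsub hm, M, hsub hM, hm' _ (by simp), hm' _ (by simp), hm' _ (by simp),
        hm' _ (by simp), hM' _ (by simp), hM' _ (by simp), hM' _ (by simp), hM' _ (by simp)⟩
    obtain ⟨m, hm, M, hM, l1, l2, l3, l4, u1, u2, u3, u4⟩ := hex
    have A1 : |a γ1 - a γ2| ≤ a M - a m := by
      rw [abs_le]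
      have := (h m hm γ1 h1 l1).1
      have := (h m hm γ2 h2 l2).1
      have := (h γ1 h1 M hM u1).1
      have := (h γ2 h2 M hM u2).1
      constructor <;> linarith
    have B1 : |b γ3 - b γ4| ≤ b M - b m := by
      rw [abs_le]
      have := (h m hm γ3 h3 l3).2.1
      have := (h m hm γ4 h4 l4).2.1
      have := (h γ3 h3 M hM u3).2.1
      have := (h γ4 h4 M hM u4).2.1
      constructor <;> linarith
    have := (h m hm M hM (l1.trans u1)).2.2
    have hd : dist (c M) (c m) ≤ Metric.diam (c '' T) :=
      Metric.dist_le_diam_of_mem hb ⟨M, hM, rfl⟩ ⟨m, hm, rfl⟩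
    rw [Real.dist_eq] at hd
    have := le_abs_self (c M - c m)
    nlinarith
  rcases T.eq_empty_or_nonempty with rfl | ⟨γ0, hγ0⟩
  · simp
  have e1 : ∀ γ1 ∈ T, ∀ γ2 ∈ T, P1 * Metric.diam (b '' T) ≤ Metric.diam (c '' T) - P0 * |a γ1 - a γ2| := by
    intro γ1 h1 γ2 h2
    rw [← le_div_iff₀' hP1]
    apply Metric.diam_le_of_forall_dist_le
    · have := key γ1 h1 γ2 h2 γ1 h1 γ1 h1
      simp at this
      apply div_nonneg _ hP1.le; linarith
    · rintro _ ⟨γ3, h3, rfl⟩ _ ⟨γ4, h4, rfl⟩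
      rw [le_div_iff₀' hP1, Real.dist_eq]
      have := key γ1 h1 γ2 h2 γ3 h3 γ4 h4
      linarith
  have e2 : P0 * Metric.diam (a '' T) ≤ Metric.diam (c '' T) - P1 * Metric.diam (b '' T) := by
    rw [← le_div_iff₀' hP0]
    apply Metric.diam_le_of_forall_dist_le
    · have := e1 γ0 hγ0 γ0 hγ0
      simp at this
      apply div_nonneg _ hP0.le; linarith
    · rintro _ ⟨γ3, h3, rfl⟩ _ ⟨γ4, h4, rfl⟩
      rw [le_div_iff₀' hP0, Real.dist_eq]
      have := e1 γ3 h3 γ4 h4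
      linarith
  have ba : Bornology.IsBounded (a '' T) := by
    rw [Metric.isBounded_iff]
    refine ⟨Metric.diam (c '' T) / P0, ?_⟩
    rintro _ ⟨γ3, h3, rfl⟩ _ ⟨γ4, h4, rfl⟩
    have := key γ3 h3 γ4 h4 γ3 h3 γ3 h3
    simp at this
    rw [le_div_iff₀' hP0, Real.dist_eq]; linarith
  have bb : Bornology.IsBounded (b '' T) := by
    rw [Metric.isBounded_iff]
    refine ⟨Metric.diam (c '' T) / P1, ?_⟩
    rintro _ ⟨γ3, h3, rfl⟩ _ ⟨γ4, h4, rfl⟩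
    have := key γ3 h3 γ3 h3 γ3 h3 γ4 h4
    simp at this
    rw [le_div_iff₀' hP1, Real.dist_eq]; linarith
  have hE : ∀ s : Set ℝ, Bornology.IsBounded s → Metric.ediam s = ENNReal.ofReal (Metric.diam s) := by
    intro s hs
    rw [Metric.diam, ENNReal.ofReal_toReal hs.ediam_ne_top]
  rw [hE _ ba, hE _ bb, hE _ hb, ← ENNReal.ofReal_mul hP0.le, ← ENNReal.ofReal_mul hP1.le,
    ← ENNReal.ofReal_add (mul_nonneg hP0.le Metric.diam_nonneg) (mul_nonneg hP1.le Metric.diam_nonneg)]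
  apply ENNReal.ofReal_le_ofReal
  linarith

lemma set1D {Z : Type*} (T : Set Z) (a b c : Z → ℝ) (P0 P1 : ℝ) (hP0 : 0 < P0) (hP1 : 0 < P1)
    (h : ∀ γ ∈ T, ∀ γ' ∈ T, c γ ≤ c γ' → a γ ≤ a γ' ∧ b γ ≤ b γ' ∧
      P0 * (a γ' - a γ) + P1 * (b γ' - b γ) ≤ c γ' - c γ) :
    ENNReal.ofReal P0 * volume (a '' T) + ENNReal.ofReal P1 * volume (b '' T)
      ≤ volume (c '' T) := by
  let ψ : OuterMeasure ℝ :=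
    ENNReal.ofReal P0 • OuterMeasure.map c (OuterMeasure.restrict T (OuterMeasure.comap a volume.toOuterMeasure)) +
    ENNReal.ofReal P1 • OuterMeasure.map c (OuterMeasure.restrict T (OuterMeasure.comap b volume.toOuterMeasure))
  have hψ : ∀ s, ψ s = ENNReal.ofReal P0 * volume (a '' (c ⁻¹' s ∩ T)) +
      ENNReal.ofReal P1 * volume (b '' (c ⁻¹' s ∩ T)) := by
    intro s
    simp [ψ]
  have hle : ψ ≤ OuterMeasure.mkMetric (fun r => r ^ (1 : ℝ)) := by
    apply OuterMeasure.le_mkMetric _ _ 1 one_pos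
    intro s hs
    rw [hψ, ENNReal.rpow_one]
    have hbs : Bornology.IsBounded s := by
      rw [Metric.isBounded_iff_ediam_ne_top]
      exact ne_top_of_le_ne_top ENNReal.one_ne_top hs
    have hsub : c '' (c ⁻¹' s ∩ T) ⊆ s := by
      rintro _ ⟨x, hx, rfl⟩; exact hx.1
    have := diam_lem (c ⁻¹' s ∩ T) a b c P0 P1 hP0 hP1
      (fun γ hγ γ' hγ' => h γ hγ.2 γ' hγ'.2) (hbs.subset hsub)
    refine le_trans ?_ (this.trans (Metric.ediam_mono hsub))
    gcongr <;> exact Real.volume_le_diam _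
  have h2 := hle (c '' T)
  rw [hψ] at h2
  have h3 : c ⁻¹' (c '' T) ∩ T = T := by
    apply Set.inter_eq_right.2; exact Set.subset_preimage_image c T
  rw [h3] at h2
  refine h2.trans (le_of_eq ?_)
  rw [← hausdorffMeasure_real, Measure.hausdorffMeasure, ← Measure.mkMetric_toOuterMeasure]
  rfl

open MeasureTheory

lemma ennamgm (t : ℝ) (h0 : 0 < t) (h1 : t < 1) (x y : ENNReal) :
    x ^ (1 - t) * y ^ t ≤ ENNReal.ofReal (1 - t) * x + ENNReal.ofReal t * y := by
  have h1' : 0 < 1 - t := by linarith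
  by_cases hx : x = ⊤
  · subst hx
    rw [ENNReal.mul_top (by simpa using h1)]; simp
  by_cases hy : y = ⊤
  · subst hy
    rw [ENNReal.mul_top (by simpa using h0)]; simp
  lift x to NNReal using hx
  lift y to NNReal using hy
  have := NNReal.geom_mean_le_arith_mean2_weighted (Real.toNNReal (1 - t)) (Real.toNNReal t) x y
    (by rw [← Real.toNNReal_add h1'.le h0.le]; simp)
  rw [Real.coe_toNNReal _ h1'.le, Real.coe_toNNReal _ h0.le] at this
  rw [← ENNReal.coe_rpow_of_nonneg _ h1'.le, ← ENNReal.coe_rpow_of_nonneg _ h0.le]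
  unfold ENNReal.ofReal
  exact_mod_cast this

lemma bad_set {Z : Type*} [MeasurableSpace Z] (π : Measure Z) (t : ℝ) (h0 : 0 < t) (h1 : t < 1)
    (u b0 b1 : Z → ENNReal)
    (E : NNReal) (hb0 : ∀ᵐ z ∂π, b0 z < ⊤) (hb1 : ∀ᵐ z ∂π, b1 z < ⊤)
    (H : ∀ r β0 β1 : NNReal, (E : ENNReal) * ((β0 : ENNReal) ^ (1 - t) * (β1 : ENNReal) ^ t) < r →
      π {z | (r : ENNReal) ≤ u z ∧ b0 z ≤ β0 ∧ b1 z ≤ β1} = 0) :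
    ∀ᵐ z ∂π, u z ≤ E * (b0 z ^ (1 - t) * b1 z ^ t) := by
  have h1' : 0 < 1 - t := by linarith
  have H' : ∀ r β0 β1 : ℚ, ∀ᵐ z ∂π, (E : ENNReal) * (((Real.toNNReal β0 : NNReal) : ENNReal) ^ (1 - t) *
      ((Real.toNNReal β1 : NNReal) : ENNReal) ^ t) < (Real.toNNReal r : NNReal) →
      ¬ (((Real.toNNReal r : NNReal) : ENNReal) ≤ u z ∧ b0 z ≤ (Real.toNNReal β0 : NNReal) ∧
        b1 z ≤ (Real.toNNReal β1 : NNReal)) := by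
    intro r β0 β1
    by_cases hlt : (E : ENNReal) * (((Real.toNNReal β0 : NNReal) : ENNReal) ^ (1 - t) *
      ((Real.toNNReal β1 : NNReal) : ENNReal) ^ t) < (Real.toNNReal r : NNReal)
    · have := H _ _ _ hlt
      rw [ae_iff]
      refine measure_mono_null ?_ this
      intro z hz
      simpa [hlt] using hz
    · filter_upwards with z hz
      exact absurd hz hlt
  have H2 := ae_all_iff.2 fun r => ae_all_iff.2 fun β0 => ae_all_iff.2 (H' r β0)
  filter_upwards [H2, hb0, hb1] with z hz hz0 hz1
  by_contra hcon
  push Not at hcon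
  obtain ⟨r, hr0, hr1, hr2⟩ := ENNReal.lt_iff_exists_rat_btwn.1 hcon
  generalize b0 z = B0 at *
  generalize b1 z = B1 at *
  lift B0 to NNReal using hz0.ne
  lift B1 to NNReal using hz1.ne
  have hc : Continuous fun δ : NNReal => E * ((B0 + δ) ^ (1 - t) * (B1 + δ) ^ t) := by
    have e1 : Continuous fun x : NNReal => x ^ (1 - t) := NNReal.continuous_rpow_const h1'.le
    have e2 : Continuous fun x : NNReal => x ^ t := NNReal.continuous_rpow_const h0.le
    exact continuous_const.mul ((e1.comp (by fun_prop)).mul (e2.comp (by fun_prop)))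
  rw [← ENNReal.coe_rpow_of_nonneg _ h1'.le, ← ENNReal.coe_rpow_of_nonneg _ h0.le, ← ENNReal.coe_mul,
    ← ENNReal.coe_mul, ENNReal.coe_lt_coe] at hr1
  have hev : ∀ᶠ δ in nhdsWithin (0 : NNReal) (Set.Ioi 0),
      E * ((B0 + δ) ^ (1 - t) * (B1 + δ) ^ t) < Real.toNNReal r := by
    apply nhdsWithin_le_nhds
    apply (hc.tendsto 0).eventually_lt_const
    simpa using hr1
  obtain ⟨δ, hδ, hδ0⟩ := (hev.and self_mem_nhdsWithin).exists
  have hδ0' : 0 < δ := hδ0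
  obtain ⟨q0, _, hq0, hq0'⟩ := ENNReal.lt_iff_exists_rat_btwn.1
    (show (B0 : ENNReal) < ((B0 + δ : NNReal) : ENNReal) by exact_mod_cast lt_add_of_pos_right _ hδ0')
  obtain ⟨q1, _, hq1, hq1'⟩ := ENNReal.lt_iff_exists_rat_btwn.1
    (show (B1 : ENNReal) < ((B1 + δ : NNReal) : ENNReal) by exact_mod_cast lt_add_of_pos_right _ hδ0')
  refine hz r q0 q1 ?_ ⟨hr2.le, hq0.le, hq1.le⟩
  refine lt_of_le_of_lt ?_ (ENNReal.coe_lt_coe.2 hδ)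
  rw [ENNReal.coe_mul, ENNReal.coe_mul, ENNReal.coe_rpow_of_nonneg _ h1'.le, ENNReal.coe_rpow_of_nonneg _ h0.le]
  gcongr

lemma Kprime {Z : Type*} [Nonempty Z] [TopologicalSpace Z] [MeasurableSpace Z] [BorelSpace Z]
    (π : Measure Z) [IsFiniteMeasure π] (A : Set Z) (hA : IsCompact A) (hAm : MeasurableSet A)
    (po p_i qo q_i zo z_i : Z → ℝ)
    (hpo : ContinuousOn po A) (hpi : ContinuousOn p_i A) (hqo : ContinuousOn qo A)
    (hqi : ContinuousOn q_i A) (hzo : ContinuousOn zo A) (hzi : ContinuousOn z_i A)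
    (hzom : Measurable zo)
    (t : ℝ) (ht0 : 0 < t) (ht1 : t < 1) (P0 P1 : ℝ) (hP0 : 0 < P0) (hP1 : 0 < P1)
    (hz : ∀ γ ∈ A, zo γ = (1 - t) * po γ + t * qo γ)
    (hmono : ∀ γ ∈ A, ∀ γ' ∈ A, 0 ≤ (po γ - po γ') * (qo γ - qo γ'))
    (hin : ∀ γ ∈ A, ∀ γ' ∈ A, po γ = po γ' → qo γ = qo γ' → z_i γ ≤ z_i γ' →
      p_i γ ≤ p_i γ' ∧ q_i γ ≤ q_i γ' ∧ P0 * (p_i γ' - p_i γ) + P1 * (q_i γ' - q_i γ) ≤ z_i γ' - z_i γ)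
    (c0 c1 : NNReal)
    (h0 : ∀ W : Set (ℝ × ℝ), MeasurableSet W → π (A ∩ {γ | (po γ, p_i γ) ∈ W}) ≤ c0 * volume W)
    (h1 : ∀ W : Set (ℝ × ℝ), MeasurableSet W → π (A ∩ {γ | (qo γ, q_i γ) ∈ W}) ≤ c1 * volume W) :
    π A ≤ (ENNReal.ofReal ((1 - t) / P0) ^ (1 - t) * ENNReal.ofReal (t / P1) ^ t) *
      ((c0 : ENNReal) ^ (1 - t) * (c1 : ENNReal) ^ t) * volume ((fun γ => (zo γ, z_i γ)) '' A) := by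
  have ht1' : 0 < 1 - t := by linarith
  -- order facts
  have hord : ∀ γ ∈ A, ∀ γ' ∈ A, zo γ ≤ zo γ' → po γ ≤ po γ' ∧ qo γ ≤ qo γ' := by
    intro γ hγ γ' hγ' hle
    rw [hz γ hγ, hz γ' hγ'] at hle
    have hm := hmono γ hγ γ' hγ'
    constructor
    · by_contra hc
      push Not at hc
      have : 0 ≤ qo γ - qo γ' := by
        by_contra hcc
        push Not at hcc
        nlinarith
      nlinarith
    · by_contra hc
      push Not at hc
      have : 0 ≤ po γ - po γ' := by
        by_contra hcc
        push Not at hcc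
        nlinarith
      nlinarith
  have heq : ∀ γ ∈ A, ∀ γ' ∈ A, zo γ = zo γ' → po γ = po γ' ∧ qo γ = qo γ' := by
    intro γ hγ γ' hγ' he
    have e1 := hord γ hγ γ' hγ' he.le
    have e2 := hord γ' hγ' γ hγ he.ge
    exact ⟨le_antisymm e1.1 e2.1, le_antisymm e1.2 e2.2⟩
  -- compact images
  have cz : IsCompact ((fun γ => (zo γ, z_i γ)) '' A) := hA.image_of_continuousOn (hzo.prodMk hzi)
  have cp : IsCompact ((fun γ => (zo γ, p_i γ)) '' A) := hA.image_of_continuousOn (hzo.prodMk hpi)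
  have cq : IsCompact ((fun γ => (zo γ, q_i γ)) '' A) := hA.image_of_continuousOn (hzo.prodMk hqi)
  have slice : ∀ g w : Z → ℝ, ∀ y : ℝ, Prod.mk y ⁻¹' ((fun γ => (g γ, w γ)) '' A) =
      w '' {γ ∈ A | g γ = y} := by
    intro g w y
    ext x
    constructor
    · rintro ⟨γ, hγ, he⟩
      simp only [Prod.mk.injEq] at he
      exact ⟨γ, ⟨hγ, he.1⟩, he.2⟩
    · rintro ⟨γ, ⟨hγ, he⟩, rfl⟩
      exact ⟨γ, hγ, by simp [he]⟩
  set a : ℝ → ENNReal := fun y => volume (Prod.mk y ⁻¹' ((fun γ => (zo γ, z_i γ)) '' A)) with ha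
  set b0 : ℝ → ENNReal := fun y => volume (Prod.mk y ⁻¹' ((fun γ => (zo γ, p_i γ)) '' A)) with hb0
  set b1 : ℝ → ENNReal := fun y => volume (Prod.mk y ⁻¹' ((fun γ => (zo γ, q_i γ)) '' A)) with hb1
  have mb0 : Measurable b0 := measurable_measure_prodMk_left cp.isClosed.measurableSet
  have mb1 : Measurable b1 := measurable_measure_prodMk_left cq.isClosed.measurableSet
  have va : volume ((fun γ => (zo γ, z_i γ)) '' A) = ∫⁻ y, a y := by
    rw [Measure.volume_eq_prod, Measure.prod_apply cz.isClosed.measurableSet]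
  have hab : ∀ y, ENNReal.ofReal P0 * b0 y + ENNReal.ofReal P1 * b1 y ≤ a y := by
    intro y
    simp only [ha, hb0, hb1, slice]
    apply set1D _ _ _ _ _ _ hP0 hP1
    rintro γ ⟨hγ, e⟩ γ' ⟨hγ', e'⟩ hle
    obtain ⟨e1, e2⟩ := heq γ hγ γ' hγ' (e.trans e'.symm)
    exact hin γ hγ γ' hγ' e1 e2 hle
  -- finiteness
  obtain ⟨M0, hM0⟩ : ∃ M0 : NNReal, ∀ y, b0 y ≤ M0 := by
    have hfin : volume (p_i '' A) < ⊤ := (hA.image_of_continuousOn hpi).measure_lt_top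
    refine ⟨(volume (p_i '' A)).toNNReal, fun y => ?_⟩
    rw [ENNReal.coe_toNNReal hfin.ne]
    simp only [hb0, slice]
    exact measure_mono (Set.image_mono (fun x hx => hx.1))
  obtain ⟨M1, hM1⟩ : ∃ M1 : NNReal, ∀ y, b1 y ≤ M1 := by
    have hfin : volume (q_i '' A) < ⊤ := (hA.image_of_continuousOn hqi).measure_lt_top
    refine ⟨(volume (q_i '' A)).toNNReal, fun y => ?_⟩
    rw [ENNReal.coe_toNNReal hfin.ne]
    simp only [hb1, slice]
    exact measure_mono (Set.image_mono (fun x hx => hx.1))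
  -- one-sided estimate
  have one : ∀ (g w : Z → ℝ) (hg : ContinuousOn g A) (hw : ContinuousOn w A)
      (hgo : ∀ γ ∈ A, ∀ γ' ∈ A, zo γ ≤ zo γ' → g γ ≤ g γ') (c : NNReal)
      (hc : ∀ W : Set (ℝ × ℝ), MeasurableSet W → π (A ∩ {γ | (g γ, w γ) ∈ W}) ≤ c * volume W)
      (β : NNReal) (B : Set ℝ) (hBβ : ∀ y ∈ B, volume (w '' {γ ∈ A | zo γ = y}) ≤ β),
      π (A ∩ zo ⁻¹' B) ≤ c * (β * volume (g '' (A ∩ zo ⁻¹' B))) := by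
    intro g w hg hw hgo c hc β B hBβ
    set H := toMeasurable volume (g '' (A ∩ zo ⁻¹' B)) with hH
    set Q := (fun γ => (g γ, w γ)) '' A with hQ
    have cQ : IsCompact Q := hA.image_of_continuousOn (hg.prodMk hw)
    set s := fun y : ℝ => volume (Prod.mk y ⁻¹' Q) with hs
    have ms : Measurable s := measurable_measure_prodMk_left cQ.isClosed.measurableSet
    -- double points
    set N : Set ℝ := {c | ∃ x y, x ∈ zo '' A ∧ y ∈ zo '' A ∧ x < y ∧
      (g ∘ Function.invFunOn zo A) x = c ∧ (g ∘ Function.invFunOn zo A) y = c} with hN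
    have hinv : ∀ γ ∈ A, Function.invFunOn zo A (zo γ) ∈ A ∧ zo (Function.invFunOn zo A (zo γ)) = zo γ := by
      intro γ hγ
      exact ⟨Function.invFunOn_mem ⟨γ, hγ, rfl⟩, Function.invFunOn_eq (f := zo) ⟨γ, hγ, rfl⟩⟩
    have hgeq : ∀ γ ∈ A, g (Function.invFunOn zo A (zo γ)) = g γ := by
      intro γ hγ
      exact le_antisymm (hgo _ (hinv γ hγ).1 _ hγ (hinv γ hγ).2.le)
        (hgo _ hγ _ (hinv γ hγ).1 (hinv γ hγ).2.ge)
    have hNc : N.Countable := by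
      apply MonotoneOn.countable_setOfPred_two_preimages
      rintro _ ⟨γ, hγ, rfl⟩ _ ⟨γ', hγ', rfl⟩ hle
      simp only [Function.comp]
      rw [hgeq γ hγ, hgeq γ' hγ']
      exact hgo _ hγ _ hγ' hle
    set W : Set (ℝ × ℝ) := (Q ∩ (Prod.fst ⁻¹' (H ∩ {y | s y ≤ β}))) ∪ (N ×ˢ Set.univ) with hW
    have mW : MeasurableSet W := by
      apply MeasurableSet.union
      · apply cQ.isClosed.measurableSet.inter
        apply measurable_fst
        exact (measurableSet_toMeasurable _ _).inter (measurableSet_le ms measurable_const)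
      · exact hNc.measurableSet.prod MeasurableSet.univ
    have hsub : A ∩ zo ⁻¹' B ⊆ A ∩ {γ | (g γ, w γ) ∈ W} := by
      rintro γ ⟨hγ, hγB⟩
      refine ⟨hγ, ?_⟩
      by_cases hn : g γ ∈ N
      · right; exact ⟨hn, trivial⟩
      · left
        refine ⟨⟨γ, hγ, rfl⟩, subset_toMeasurable _ _ ⟨γ, ⟨hγ, hγB⟩, rfl⟩, ?_⟩
        show s (g γ) ≤ β
        refine le_trans (measure_mono ?_) (hBβ (zo γ) hγB)
        rw [slice]
        rintro _ ⟨γ', ⟨hγ', he⟩, rfl⟩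
        refine ⟨γ', ⟨hγ', ?_⟩, rfl⟩
        by_contra hne
        apply hn
        rcases lt_or_gt_of_ne hne with h | h
        · exact ⟨zo γ', zo γ, ⟨_, hγ', rfl⟩, ⟨_, hγ, rfl⟩, h, by simp [hgeq γ' hγ', he], by simp [hgeq γ hγ]⟩
        · exact ⟨zo γ, zo γ', ⟨_, hγ, rfl⟩, ⟨_, hγ', rfl⟩, h, by simp [hgeq γ hγ], by simp [hgeq γ' hγ', he]⟩
    refine (measure_mono hsub).trans ((hc W mW).trans ?_)
    gcongr
    refine (measure_union_le _ _).trans ?_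
    have : volume (N ×ˢ (Set.univ : Set ℝ)) = 0 := by
      rw [Measure.volume_eq_prod, Measure.prod_prod, hNc.measure_zero, zero_mul]
    rw [this, add_zero, Measure.volume_eq_prod, Measure.prod_apply]
    · calc ∫⁻ y, volume (Prod.mk y ⁻¹' (Q ∩ (Prod.fst ⁻¹' (H ∩ {y | s y ≤ β}))))
          ≤ ∫⁻ y, H.indicator (fun _ => (β : ENNReal)) y := by
            apply lintegral_mono
            intro y
            by_cases hy : y ∈ H ∩ {y | s y ≤ β}
            · simp only [Set.indicator_of_mem hy.1]
              refine le_trans (measure_mono ?_) hy.2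
              intro x hx
              exact hx.1
            · have : Prod.mk y ⁻¹' (Q ∩ (Prod.fst ⁻¹' (H ∩ {y | s y ≤ β}))) = ∅ := by
                ext x
                simp only [Set.mem_preimage, Set.mem_inter_iff, Set.mem_empty_iff_false, iff_false]
                intro hx
                exact hy hx.2
              beta_reduce
              rw [this, measure_empty]; exact zero_le
        _ = β * volume (g '' (A ∩ zo ⁻¹' B)) := by
            rw [lintegral_indicator (measurableSet_toMeasurable _ _), setLIntegral_const,
              measure_toMeasurable]
    · apply cQ.isClosed.measurableSet.inter
      apply measurable_fst
      exact (measurableSet_toMeasurable _ _).inter (measurableSet_le ms measurable_const)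
  -- two sided
  set E : NNReal := c0 ^ (1 - t) * c1 ^ t with hE
  have hEe : (E : ENNReal) = (c0 : ENNReal) ^ (1 - t) * (c1 : ENNReal) ^ t := by
    rw [hE, ENNReal.coe_mul, ENNReal.coe_rpow_of_nonneg _ ht1'.le, ENNReal.coe_rpow_of_nonneg _ ht0.le]
  set ν := Measure.map zo (π.restrict A) with hν
  have νB : ∀ B, MeasurableSet B → ν B = π (A ∩ zo ⁻¹' B) := by
    intro B hB
    rw [hν, Measure.map_apply hzom hB, Measure.restrict_apply (hzom hB), Set.inter_comm]
  have two : ∀ (β0 β1 : NNReal) (B : Set ℝ), MeasurableSet B → (∀ y ∈ B, b0 y ≤ β0) → (∀ y ∈ B, b1 y ≤ β1) →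
      ν B ≤ (E * ((β0 : ENNReal) ^ (1 - t) * (β1 : ENNReal) ^ t)) * volume B := by
    intro β0 β1 B hB e0 e1
    have o0 := one po p_i hpo hpi (fun γ hγ γ' hγ' h => (hord γ hγ γ' hγ' h).1) c0 h0 β0 B
      (by intro y hy; rw [← slice]; exact e0 y hy)
    have o1 := one qo q_i hqo hqi (fun γ hγ γ' hγ' h => (hord γ hγ γ' hγ' h).2) c1 h1 β1 B
      (by intro y hy; rw [← slice]; exact e1 y hy)
    have s1 := set1D (A ∩ zo ⁻¹' B) po qo zo (1 - t) t ht1' ht0 (by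
      rintro γ ⟨hγ, _⟩ γ' ⟨hγ', _⟩ hle
      refine ⟨(hord γ hγ γ' hγ' hle).1, (hord γ hγ γ' hγ' hle).2, ?_⟩
      rw [hz γ hγ, hz γ' hγ']; linarith)
    have s2 : volume (zo '' (A ∩ zo ⁻¹' B)) ≤ volume B := by
      apply measure_mono; rintro _ ⟨x, hx, rfl⟩; exact hx.2
    rw [νB B hB]
    set X := π (A ∩ zo ⁻¹' B)
    set u := volume (po '' (A ∩ zo ⁻¹' B))
    set v := volume (qo '' (A ∩ zo ⁻¹' B))
    calc X = X ^ (1 - t) * X ^ t := by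
          rw [← ENNReal.rpow_add_of_nonneg _ _ ht1'.le ht0.le]; simp
      _ ≤ (c0 * (β0 * u)) ^ (1 - t) * (c1 * (β1 * v)) ^ t := by gcongr
      _ = (E * ((β0 : ENNReal) ^ (1 - t) * (β1 : ENNReal) ^ t)) * (u ^ (1 - t) * v ^ t) := by
          rw [hEe]
          simp only [ENNReal.mul_rpow_of_nonneg _ _ ht1'.le, ENNReal.mul_rpow_of_nonneg _ _ ht0.le]
          ring
      _ ≤ (E * ((β0 : ENNReal) ^ (1 - t) * (β1 : ENNReal) ^ t)) * volume B := by
          gcongr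
          exact (ennamgm t ht0 ht1 u v).trans (s1.trans s2)
  have hac : ν ≪ volume := by
    refine Measure.AbsolutelyContinuous.mk fun B hB hB0 => ?_
    have := two M0 M1 B hB (fun y _ => hM0 y) (fun y _ => hM1 y)
    rw [hB0, mul_zero] at this
    exact le_antisymm this zero_le
  set ρ := ν.rnDeriv volume with hρ
  have mρ : Measurable ρ := Measure.measurable_rnDeriv _ _
  have hρν : volume.withDensity ρ = ν := Measure.withDensity_rnDeriv_eq _ _ hac
  have ptw : ∀ᵐ y ∂(volume : Measure ℝ), ρ y ≤ E * (b0 y ^ (1 - t) * b1 y ^ t) := by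
    apply bad_set volume t ht0 ht1 ρ b0 b1 E
    · filter_upwards with y using (hM0 y).trans_lt ENNReal.coe_lt_top
    · filter_upwards with y using (hM1 y).trans_lt ENNReal.coe_lt_top
    intro r β0 β1 hr
    set B := {y | (r : ENNReal) ≤ ρ y ∧ b0 y ≤ β0 ∧ b1 y ≤ β1} with hB
    have mB : MeasurableSet B :=
      (measurableSet_le measurable_const mρ).inter
        ((measurableSet_le mb0 measurable_const).inter (measurableSet_le mb1 measurable_const))
    have l1 : r * volume B ≤ ν B := by
      rw [← hρν, withDensity_apply _ mB, ← setLIntegral_const]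
      exact setLIntegral_mono mρ fun y hy => hy.1
    have l2 := two β0 β1 B mB (fun y hy => hy.2.1) (fun y hy => hy.2.2)
    by_contra hne
    have hrpos : (r : ENNReal) ≠ 0 := by
      intro h; rw [h] at hr; simp at hr
    have hfin : volume B ≠ ⊤ := by
      intro h
      rw [h, ENNReal.mul_top hrpos] at l1
      exact absurd (top_le_iff.1 l1) (measure_ne_top _ _)
    have := (ENNReal.mul_lt_mul_iff_left hne hfin).2 hr
    exact absurd (l1.trans l2) (not_le.2 this)
  have hgm : ∀ y, b0 y ^ (1 - t) * b1 y ^ t ≤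
      (ENNReal.ofReal ((1 - t) / P0) ^ (1 - t) * ENNReal.ofReal (t / P1) ^ t) * a y := by
    intro y
    have e0 : b0 y = ENNReal.ofReal ((1 - t) / P0) * (ENNReal.ofReal (P0 / (1 - t)) * b0 y) := by
      rw [← mul_assoc, ← ENNReal.ofReal_mul (by positivity)]
      rw [show (1 - t) / P0 * (P0 / (1 - t)) = 1 by field_simp]; simp
    have e1 : b1 y = ENNReal.ofReal (t / P1) * (ENNReal.ofReal (P1 / t) * b1 y) := by
      rw [← mul_assoc, ← ENNReal.ofReal_mul (by positivity)]
      rw [show t / P1 * (P1 / t) = 1 by field_simp]; simp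
    have am := ennamgm t ht0 ht1 (ENNReal.ofReal (P0 / (1 - t)) * b0 y) (ENNReal.ofReal (P1 / t) * b1 y)
    rw [← mul_assoc, ← mul_assoc, ← ENNReal.ofReal_mul ht1'.le, ← ENNReal.ofReal_mul ht0.le,
      show (1 - t) * (P0 / (1 - t)) = P0 by field_simp, show t * (P1 / t) = P1 by field_simp] at am
    calc b0 y ^ (1 - t) * b1 y ^ t
        = (ENNReal.ofReal ((1 - t) / P0) ^ (1 - t) * ENNReal.ofReal (t / P1) ^ t) *
          ((ENNReal.ofReal (P0 / (1 - t)) * b0 y) ^ (1 - t) * (ENNReal.ofReal (P1 / t) * b1 y) ^ t) := by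
          conv_lhs => rw [e0, e1]
          rw [ENNReal.mul_rpow_of_nonneg _ _ ht1'.le, ENNReal.mul_rpow_of_nonneg _ _ ht0.le]
          ring
      _ ≤ _ := by
          gcongr
          exact am.trans (hab y)
  calc π A = ν Set.univ := by rw [νB _ MeasurableSet.univ]; simp
    _ = ∫⁻ y, ρ y := by rw [← hρν, withDensity_apply _ MeasurableSet.univ]; simp
    _ ≤ ∫⁻ y, (ENNReal.ofReal ((1 - t) / P0) ^ (1 - t) * ENNReal.ofReal (t / P1) ^ t) * E * a y := by
        apply lintegral_mono_ae
        filter_upwards [ptw] with y hy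
        refine hy.trans ?_
        calc (E : ENNReal) * (b0 y ^ (1 - t) * b1 y ^ t) ≤ E * ((ENNReal.ofReal ((1 - t) / P0) ^ (1 - t) * ENNReal.ofReal (t / P1) ^ t) * a y) := by
              exact mul_le_mul_right (hgm y) _
          _ = _ := by ring
    _ = _ := by
        rw [lintegral_const_mul' , hEe, va]
        refine ENNReal.mul_ne_top (ENNReal.mul_ne_top ?_ ?_) ENNReal.coe_ne_top
        · exact ENNReal.rpow_ne_top_of_nonneg ht1'.le ENNReal.ofReal_ne_top
        · exact ENNReal.rpow_ne_top_of_nonneg ht0.le ENNReal.ofReal_ne_top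

open MeasureTheory ProbabilityTheory

lemma swap_core {E : Type*} [MeasurableSpace E] (π : Measure (E × E)) [IsFiniteMeasure π]
    (σ : Measure ((E × E) × (E × E)))
    (h1 : σ.map Prod.fst ≤ π) (h2 : σ.map Prod.snd ≤ π) :
    ∃ π' : Measure (E × E), π'.map Prod.fst = π.map Prod.fst ∧ π'.map Prod.snd = π.map Prod.snd ∧
      ∀ u : E × E → ENNReal, Measurable u →
        ∫⁻ z, u z ∂π' + (2 : ENNReal)⁻¹ * ∫⁻ w, (u w.1 + u w.2) ∂σ =
        ∫⁻ z, u z ∂π + (2 : ENNReal)⁻¹ * ∫⁻ w, (u (w.1.1, w.2.2) + u (w.2.1, w.1.2)) ∂σ := by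
  set τ : Measure (E × E) := (2 : ENNReal)⁻¹ • (σ.map Prod.fst + σ.map Prod.snd) with hτ
  have hτle : τ ≤ π := by
    rw [hτ, Measure.le_iff]
    intro s hs
    simp only [Measure.smul_apply, Measure.add_apply, smul_eq_mul]
    have a1 := h1 s
    have a2 := h2 s
    calc (2 : ENNReal)⁻¹ * (σ.map Prod.fst s + σ.map Prod.snd s) ≤ 2⁻¹ * (π s + π s) := by gcongr
      _ = π s := by rw [← two_mul, ← mul_assoc, ENNReal.inv_mul_cancel (by simp) (by simp), one_mul]
  have hfin : IsFiniteMeasure τ := isFiniteMeasure_of_le π hτle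
  set m1 : (E × E) × (E × E) → E × E := fun w => (w.1.1, w.2.2) with hm1
  set m2 : (E × E) × (E × E) → E × E := fun w => (w.2.1, w.1.2) with hm2
  have mm1 : Measurable m1 := by fun_prop
  have mm2 : Measurable m2 := by fun_prop
  set τ' : Measure (E × E) := (2 : ENNReal)⁻¹ • (σ.map m1 + σ.map m2) with hτ'
  have hsub : (π - τ) + τ = π := Measure.sub_add_cancel_of_le hτle
  refine ⟨(π - τ) + τ', ?_, ?_, ?_⟩
  · conv_rhs => rw [← hsub]
    rw [Measure.map_add _ _ measurable_fst, Measure.map_add _ _ measurable_fst]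
    congr 1
    rw [hτ, hτ', Measure.map_smul, Measure.map_smul, Measure.map_add _ _ measurable_fst,
      Measure.map_add _ _ measurable_fst, Measure.map_map measurable_fst mm1, Measure.map_map measurable_fst mm2,
      Measure.map_map measurable_fst measurable_fst, Measure.map_map measurable_fst measurable_snd]
    rfl
  · conv_rhs => rw [← hsub]
    rw [Measure.map_add _ _ measurable_snd, Measure.map_add _ _ measurable_snd]
    congr 1
    rw [hτ, hτ', Measure.map_smul, Measure.map_smul, Measure.map_add _ _ measurable_snd,
      Measure.map_add _ _ measurable_snd, Measure.map_map measurable_snd mm1, Measure.map_map measurable_snd mm2,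
      Measure.map_map measurable_snd measurable_fst, Measure.map_map measurable_snd measurable_snd, add_comm]
    rfl
  · intro u hu
    have e1 : (2 : ENNReal)⁻¹ * ∫⁻ w, (u w.1 + u w.2) ∂σ = ∫⁻ z, u z ∂τ := by
      rw [hτ, lintegral_smul_measure, lintegral_add_measure, lintegral_map hu measurable_fst,
        lintegral_map hu measurable_snd, lintegral_add_left (f := fun w : (E × E) × (E × E) => u w.1) (by fun_prop)]
      rfl
    have e2 : (2 : ENNReal)⁻¹ * ∫⁻ w, (u (w.1.1, w.2.2) + u (w.2.1, w.1.2)) ∂σ = ∫⁻ z, u z ∂τ' := by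
      rw [hτ', lintegral_smul_measure, lintegral_add_measure, lintegral_map hu mm1,
        lintegral_map hu mm2, lintegral_add_left (f := fun w : (E × E) × (E × E) => u (w.1.1, w.2.2)) (by fun_prop)]
      rfl
    rw [e1, e2]
    conv_rhs => rw [← hsub]
    rw [lintegral_add_measure, lintegral_add_measure]
    ring

lemma lint_null {Z : Type*} [MeasurableSpace Z] (σ : Measure Z) (u v : Z → ENNReal) (hu : Measurable u)
    (hv : Measurable v) (N : Set Z) (hN : MeasurableSet N) (h : ∀ z ∈ N, v z < u z)
    (hle : ∫⁻ z in N, u z ∂σ ≤ ∫⁻ z in N, v z ∂σ) (hfin : ∫⁻ z in N, u z ∂σ ≠ ⊤) : σ N = 0 := by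
  by_contra hne
  have hvfin : ∫⁻ z in N, v z ∂σ ≠ ⊤ :=
    ne_top_of_le_ne_top hfin (setLIntegral_mono hu fun z hz => (h z hz).le)
  have := setLIntegral_strict_mono hN hne hu hvfin (by filter_upwards with z hz using h z hz)
  exact absurd hle (not_le.2 this)

lemma restrict_marg {Z Y : Type*} [MeasurableSpace Z] [MeasurableSpace Y] (σ : Measure Z) (g : Z → Y) (hg : Measurable g)
    (π : Measure Y) (h : σ.map g ≤ π) (N : Set Z) : (σ.restrict N).map g ≤ π :=
  (Measure.map_mono Measure.restrict_le_self hg).trans h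

/-- consequences of lexicographic minimality -/
lemma swap_prim {E : Type*} [MeasurableSpace E] (π : Measure (E × E)) [IsFiniteMeasure π]
    (c : E × E → ENNReal) (hc : Measurable c) (hcfin : ∫⁻ z, c z ∂π ≠ ⊤)
    (hmin : ∀ π' : Measure (E × E), π'.map Prod.fst = π.map Prod.fst → π'.map Prod.snd = π.map Prod.snd →
      ∫⁻ z, c z ∂π ≤ ∫⁻ z, c z ∂π')
    (σ : Measure ((E × E) × (E × E)))
    (h1 : σ.map Prod.fst ≤ π) (h2 : σ.map Prod.snd ≤ π) :
    σ {w | c (w.1.1, w.2.2) + c (w.2.1, w.1.2) < c w.1 + c w.2} = 0 := by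
  set N := {w : (E × E) × (E × E) | c (w.1.1, w.2.2) + c (w.2.1, w.1.2) < c w.1 + c w.2} with hN
  have mu : Measurable fun w : (E × E) × (E × E) => c w.1 + c w.2 := by fun_prop
  have mv : Measurable fun w : (E × E) × (E × E) => c (w.1.1, w.2.2) + c (w.2.1, w.1.2) := by fun_prop
  have mN : MeasurableSet N := measurableSet_lt mv mu
  have g1 := restrict_marg σ _ measurable_fst π h1 N
  have g2 := restrict_marg σ _ measurable_snd π h2 N
  obtain ⟨π', a1, a2, a3⟩ := swap_core π (σ.restrict N) g1 g2
  have hle := hmin π' a1 a2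
  have hfin : ∫⁻ w in N, (c w.1 + c w.2) ∂σ ≠ ⊤ := by
    rw [lintegral_add_left (f := fun w : (E × E) × (E × E) => c w.1) (by fun_prop)]
    have e1 : ∫⁻ w in N, c w.1 ∂σ ≤ ∫⁻ z, c z ∂π := by
      rw [← lintegral_map hc measurable_fst]; exact lintegral_mono' g1 le_rfl
    have e2 : ∫⁻ w in N, c w.2 ∂σ ≤ ∫⁻ z, c z ∂π := by
      rw [← lintegral_map hc measurable_snd]; exact lintegral_mono' g2 le_rfl
    exact ENNReal.add_ne_top.2 ⟨ne_top_of_le_ne_top hcfin e1, ne_top_of_le_ne_top hcfin e2⟩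
  apply lint_null σ _ _ mu mv N mN (fun z hz => hz) _ hfin
  have := a3 c hc
  have h4 : ∫⁻ z, c z ∂π + (2 : ENNReal)⁻¹ * ∫⁻ w in N, (c w.1 + c w.2) ∂σ ≤
    ∫⁻ z, c z ∂π + (2 : ENNReal)⁻¹ * ∫⁻ w in N, (c (w.1.1, w.2.2) + c (w.2.1, w.1.2)) ∂σ := by
    rw [← this]; gcongr
  have h5 := (ENNReal.add_le_add_iff_left hcfin).1 h4
  rwa [ENNReal.mul_le_mul_iff_right (by simp) (by simp)] at h5

lemma swap_sec {E : Type*} [MeasurableSpace E] (π : Measure (E × E)) [IsFiniteMeasure π]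
    (c s : E × E → ENNReal) (hc : Measurable c) (hcfin : ∫⁻ z, c z ∂π ≠ ⊤)
    (hs : Measurable s) (hsfin : ∫⁻ z, s z ∂π ≠ ⊤)
    (hmin : ∀ π' : Measure (E × E), π'.map Prod.fst = π.map Prod.fst → π'.map Prod.snd = π.map Prod.snd →
      ∫⁻ z, c z ∂π' = ∫⁻ z, c z ∂π → ∫⁻ z, s z ∂π ≤ ∫⁻ z, s z ∂π')
    (σ : Measure ((E × E) × (E × E)))
    (h1 : σ.map Prod.fst ≤ π) (h2 : σ.map Prod.snd ≤ π) :
    σ {w | c (w.1.1, w.2.2) + c (w.2.1, w.1.2) = c w.1 + c w.2 ∧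
      s (w.1.1, w.2.2) + s (w.2.1, w.1.2) < s w.1 + s w.2} = 0 := by
  set N := {w : (E × E) × (E × E) | c (w.1.1, w.2.2) + c (w.2.1, w.1.2) = c w.1 + c w.2 ∧
      s (w.1.1, w.2.2) + s (w.2.1, w.1.2) < s w.1 + s w.2} with hN
  have mu : Measurable fun w : (E × E) × (E × E) => s w.1 + s w.2 := by fun_prop
  have mv : Measurable fun w : (E × E) × (E × E) => s (w.1.1, w.2.2) + s (w.2.1, w.1.2) := by fun_prop
  have mN : MeasurableSet N :=
    (measurableSet_eq_fun (by fun_prop) (by fun_prop)).inter (measurableSet_lt mv mu)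
  have g1 := restrict_marg σ _ measurable_fst π h1 N
  have g2 := restrict_marg σ _ measurable_snd π h2 N
  obtain ⟨π', a1, a2, a3⟩ := swap_core π (σ.restrict N) g1 g2
  have hfin : ∀ u : E × E → ENNReal, Measurable u → ∫⁻ z, u z ∂π ≠ ⊤ →
      ∫⁻ w in N, (u w.1 + u w.2) ∂σ ≠ ⊤ := by
    intro u hu hufin
    rw [lintegral_add_left (f := fun w : (E × E) × (E × E) => u w.1) (by fun_prop)]
    have e1 : ∫⁻ w in N, u w.1 ∂σ ≤ ∫⁻ z, u z ∂π := by
      rw [← lintegral_map hu measurable_fst]; exact lintegral_mono' g1 le_rfl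
    have e2 : ∫⁻ w in N, u w.2 ∂σ ≤ ∫⁻ z, u z ∂π := by
      rw [← lintegral_map hu measurable_snd]; exact lintegral_mono' g2 le_rfl
    exact ENNReal.add_ne_top.2 ⟨ne_top_of_le_ne_top hufin e1, ne_top_of_le_ne_top hufin e2⟩
  apply lint_null σ _ _ mu mv N mN (fun z hz => hz.2) _ (hfin s hs hsfin)
  have hceq : ∫⁻ z, c z ∂π' = ∫⁻ z, c z ∂π := by
    have := a3 c hc
    have e : ∫⁻ w in N, (c (w.1.1, w.2.2) + c (w.2.1, w.1.2)) ∂σ = ∫⁻ w in N, (c w.1 + c w.2) ∂σ :=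
      setLIntegral_congr_fun mN fun w hw => hw.1
    rw [e] at this
    exact (ENNReal.add_left_inj (ENNReal.mul_ne_top (by simp) (hfin c hc hcfin))).1 this
  have hle := hmin π' a1 a2 hceq
  have := a3 s hs
  have h4 : ∫⁻ z, s z ∂π + (2 : ENNReal)⁻¹ * ∫⁻ w in N, (s w.1 + s w.2) ∂σ ≤
    ∫⁻ z, s z ∂π + (2 : ENNReal)⁻¹ * ∫⁻ w in N, (s (w.1.1, w.2.2) + s (w.2.1, w.1.2)) ∂σ := by
    rw [← this]; gcongr
  have h5 := (ENNReal.add_le_add_iff_left hsfin).1 h4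
  rwa [ENNReal.mul_le_mul_iff_right (by simp) (by simp)] at h5

lemma fiber_lemma {Z W : Type*} [TopologicalSpace Z] [SecondCountableTopology Z] [MeasurableSpace Z] [BorelSpace Z]
    [StandardBorelSpace Z] [Nonempty Z] [MeasurableSpace W] [MeasurableEq W]
    (π : Measure Z) [IsFiniteMeasure π] (F : Z → W) (hF : Measurable F) (N : Set (Z × Z)) (hN : IsOpen N)
    (H : ∀ σ : Measure (Z × Z), σ.map Prod.fst ≤ π → σ.map Prod.snd ≤ π →
      σ (N ∩ {w | F w.1 = F w.2}) = 0) :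
    ∃ Γ : Set Z, MeasurableSet Γ ∧ π Γᶜ = 0 ∧ ∀ γ ∈ Γ, ∀ γ' ∈ Γ, F γ = F γ' → (γ, γ') ∉ N := by
  set κ := condDistrib (id : Z → Z) F π with hκ
  set m := π.map F with hm
  have mN : MeasurableSet N := hN.measurableSet
  have hcomp : m ⊗ₘ κ = π.map (fun a => (F a, a)) := by
    exact compProd_map_condDistrib (X := F) (Y := (id : Z → Z)) (μ := π) measurable_id.aemeasurable
  set σ : Measure (Z × Z) := (κ ×ₖ κ) ∘ₘ m with hσ
  have σapp : ∀ s, MeasurableSet s → σ s = ∫⁻ w, ((κ w).prod (κ w)) s ∂m := by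
    intro s hs
    rw [hσ, Measure.bind_apply hs (Kernel.aemeasurable _)]
    simp only [Kernel.prod_apply]
  have bindκ : κ ∘ₘ m = π := by
    rw [← Measure.snd_compProd, hcomp, Measure.snd, Measure.map_map measurable_snd (by fun_prop)]
    simp [Function.comp_def]
  have s1 : σ.map Prod.fst = π := by
    rw [← bindκ]
    ext s hs
    rw [Measure.map_apply measurable_fst hs, σapp _ (measurable_fst hs), Measure.bind_apply hs (Kernel.aemeasurable _)]
    congr 1; ext w
    rw [show Prod.fst ⁻¹' s = s ×ˢ (Set.univ : Set Z) by ext; simp, Measure.prod_prod]; simp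
  have s2 : σ.map Prod.snd = π := by
    rw [← bindκ]
    ext s hs
    rw [Measure.map_apply measurable_snd hs, σapp _ (measurable_snd hs), Measure.bind_apply hs (Kernel.aemeasurable _)]
    congr 1; ext w
    rw [show Prod.snd ⁻¹' s = (Set.univ : Set Z) ×ˢ s by ext; simp, Measure.prod_prod]; simp
  -- κ w concentrated on the fibre
  have hfib : ∀ᵐ w ∂m, ∀ᵐ z ∂(κ w), F z = w := by
    rw [← Measure.ae_compProd_iff (p := fun x : W × Z => F x.2 = x.1)
      (measurableSet_eq_fun (by fun_prop) (by fun_prop)), hcomp, ae_map_iff (by fun_prop)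
      (measurableSet_eq_fun (by fun_prop) (by fun_prop))]
    simp
  have hσN : σ N = 0 := by
    have h0 := H σ s1.le s2.le
    have meq : MeasurableSet {w : Z × Z | F w.1 = F w.2} := measurableSet_eq_fun (by fun_prop) (by fun_prop)
    have h1 : σ {w : Z × Z | F w.1 = F w.2}ᶜ = 0 := by
      rw [σapp _ meq.compl, lintegral_eq_zero_iff']
      · filter_upwards [hfib] with w hw
        have : ∀ᵐ x ∂(κ w).prod (κ w), F x.1 = F x.2 := by
          have e1 : ∀ᵐ x ∂(κ w).prod (κ w), F x.1 = w := Measure.quasiMeasurePreserving_fst.ae hw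
          have e2 : ∀ᵐ x ∂(κ w).prod (κ w), F x.2 = w := Measure.quasiMeasurePreserving_snd.ae hw
          filter_upwards [e1, e2] with x h1 h2 using h1.trans h2.symm
        exact this
      · have := (Kernel.measurable_coe (κ ×ₖ κ) meq.compl).aemeasurable (μ := m)
        simpa only [Kernel.prod_apply] using this
    refine measure_mono_null (t := (N ∩ {w | F w.1 = F w.2}) ∪ {w : Z × Z | F w.1 = F w.2}ᶜ) ?_
      (measure_union_null h0 h1)
    intro x hx
    by_cases h : F x.1 = F x.2
    · left; exact ⟨hx, h⟩
    · right; exact h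
  have hG : ∀ᵐ w ∂m, ((κ w).prod (κ w)) N = 0 := by
    rw [σapp N mN, lintegral_eq_zero_iff'] at hσN
    · exact hσN
    · have := (Kernel.measurable_coe (κ ×ₖ κ) mN).aemeasurable (μ := m)
      simpa only [Kernel.prod_apply] using this
  have hG' : ∀ᵐ z ∂π, ((κ (F z)).prod (κ (F z))) N = 0 := ae_of_ae_map hF.aemeasurable hG
  have hB : ∀ b ∈ TopologicalSpace.countableBasis Z, ∀ᵐ z ∂π, z ∈ b → κ (F z) b ≠ 0 := by
    intro b hb
    have mb : MeasurableSet b := (TopologicalSpace.isOpen_of_mem_countableBasis hb).measurableSet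
    have mset : MeasurableSet {x : W × Z | x.2 ∈ b → κ x.1 b ≠ 0} := by
      have e1 : MeasurableSet {x : W × Z | x.2 ∈ b} := measurable_snd mb
      have e2 : MeasurableSet {x : W × Z | κ x.1 b = 0} :=
        measurableSet_eq_fun ((Kernel.measurable_coe κ mb).comp measurable_fst) measurable_const
      exact e1.imp e2.compl
    have : ∀ᵐ x ∂(m ⊗ₘ κ), x.2 ∈ b → κ x.1 b ≠ 0 := by
      rw [Measure.ae_compProd_iff mset]
      filter_upwards with w
      by_cases h : κ w b = 0
      · have : ∀ᵐ z ∂(κ w), z ∉ b := by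
          rw [ae_iff]; simpa using h
        filter_upwards [this] with z hz hz'
        exact absurd hz' hz
      · filter_upwards with z _
        exact h
    rw [hcomp] at this
    exact ae_of_ae_map (f := fun a => (F a, a)) (by fun_prop) this
  have hB' := (ae_ball_iff (TopologicalSpace.countable_countableBasis Z)).2 hB
  have hall := hB'.and hG'
  obtain ⟨Γ, hΓ, mΓ, h0⟩ : ∃ Γ ⊆ {z | (∀ b ∈ TopologicalSpace.countableBasis Z, z ∈ b → κ (F z) b ≠ 0) ∧
      ((κ (F z)).prod (κ (F z))) N = 0}, MeasurableSet Γ ∧ π Γᶜ = 0 := by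
    obtain ⟨t, ht, mt, h0⟩ := exists_measurable_superset_of_null (ae_iff.1 hall)
    refine ⟨tᶜ, ?_, mt.compl, by simpa using h0⟩
    intro z hz
    by_contra hc
    exact hz (ht hc)
  refine ⟨Γ, mΓ, h0, ?_⟩
  intro γ hγ γ' hγ' he hmem
  have a := hΓ hγ
  have a' := hΓ hγ'
  rw [isOpen_prod_iff] at hN
  obtain ⟨u, v, hu, hv, hγu, hγv, huv⟩ := hN γ γ' hmem
  obtain ⟨b, hb, hγb, hbu⟩ := (TopologicalSpace.isBasis_countableBasis Z).exists_subset_of_mem_open hγu hu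
  obtain ⟨b', hb', hγb', hbv⟩ := (TopologicalSpace.isBasis_countableBasis Z).exists_subset_of_mem_open hγv hv
  have n1 := a.1 b hb hγb
  have n2 := a'.1 b' hb' hγb'
  rw [← he] at n2
  have : ((κ (F γ)).prod (κ (F γ))) (b ×ˢ b') = 0 :=
    measure_mono_null ((Set.prod_mono hbu hbv).trans huv) a.2
  rw [Measure.prod_prod, mul_eq_zero] at this
  tauto

open MeasureTheory ProbabilityTheory

lemma W2_symm {E : Type*} [MeasurableSpace E] [PseudoMetricSpace E] (μ ν : Measure E) (hd : Measurable fun p : E × E => dist p.1 p.2) :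
    W2sq dist μ ν = W2sq dist ν μ := by
  have key : ∀ μ ν : Measure E, W2sq dist μ ν ≤ W2sq dist ν μ := by
    intro μ ν
    unfold W2sq
    refine le_iInf₂ fun π hπ => ?_
    refine iInf₂_le_of_le (π.map Prod.swap) ⟨?_, ?_⟩ ?_
    · rw [Measure.map_map measurable_fst measurable_swap]; exact hπ.2
    · rw [Measure.map_map measurable_snd measurable_swap]; exact hπ.1
    · rw [lintegral_map (by fun_prop) measurable_swap]
      simp [dist_comm]
  exact le_antisymm (key _ _) (key _ _)

lemma W2_tri {E : Type*} [MeasurableSpace E] [PseudoMetricSpace E] [StandardBorelSpace E] [Nonempty E]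
    (hd : Measurable fun p : E × E => dist p.1 p.2)
    (μ ν ξ : Measure E) [IsProbabilityMeasure μ] [IsProbabilityMeasure ν] [IsProbabilityMeasure ξ]
    (θ : ℝ) (h0 : 0 < θ) (h1 : θ < 1) :
    W2sq dist μ ξ ≤ ENNReal.ofReal θ⁻¹ * W2sq dist μ ν + ENNReal.ofReal (1 - θ)⁻¹ * W2sq dist ν ξ := by
  have h1' : 0 < 1 - θ := by linarith
  have key : ∀ (π1 : {π : Measure (E × E) // π.map Prod.fst = μ ∧ π.map Prod.snd = ν})
      (π2 : {π : Measure (E × E) // π.map Prod.fst = ν ∧ π.map Prod.snd = ξ}),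
      W2sq dist μ ξ ≤ ENNReal.ofReal θ⁻¹ * ∫⁻ p, ENNReal.ofReal (dist p.1 p.2 ^ 2) ∂π1.1 +
        ENNReal.ofReal (1 - θ)⁻¹ * ∫⁻ p, ENNReal.ofReal (dist p.1 p.2 ^ 2) ∂π2.1 := by
    rintro ⟨π1, a1, a2⟩ ⟨π2, b1, b2⟩
    have p1 : IsProbabilityMeasure π1 := by
      constructor
      rw [← Set.preimage_univ (f := Prod.fst), ← Measure.map_apply measurable_fst MeasurableSet.univ, a1]
      simp
    have p2 : IsProbabilityMeasure π2 := by
      constructor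
      rw [← Set.preimage_univ (f := Prod.fst), ← Measure.map_apply measurable_fst MeasurableSet.univ, b1]
      simp
    set κ := π2.condKernel with hκ
    have hdis : ν ⊗ₘ κ = π2 := by
      rw [← b1]; exact π2.disintegrate π2.condKernel
    set G : Measure ((E × E) × E) := π1 ⊗ₘ (κ.comap Prod.snd measurable_snd) with hG
    have G1 : G.map Prod.fst = π1 := by
      have := Measure.fst_compProd π1 (κ.comap Prod.snd measurable_snd)
      exact this
    have G2 : G.map (fun w => (w.1.2, w.2)) = π2 := by
      rw [← hdis]
      ext s hs
      rw [Measure.map_apply (by fun_prop) hs, hG, Measure.compProd_apply ((by fun_prop : Measurable _) hs),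
        Measure.compProd_apply hs, ← a2, lintegral_map (Kernel.measurable_kernel_prodMk_left hs) measurable_snd]
      rfl
    have m13 : Measurable fun w : (E × E) × E => (w.1.1, w.2) := by fun_prop
    unfold W2sq
    refine iInf₂_le_of_le (G.map fun w => (w.1.1, w.2)) ⟨?_, ?_⟩ ?_
    · rw [Measure.map_map measurable_fst m13, ← a1, ← G1, Measure.map_map measurable_fst measurable_fst]
      rfl
    · rw [Measure.map_map measurable_snd m13, ← b2]
      conv_rhs => rw [← G2]
      rw [Measure.map_map measurable_snd (by fun_prop)]
      rfl
    · have mc : Measurable fun p : E × E => ENNReal.ofReal (dist p.1 p.2 ^ 2) := by fun_prop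
      rw [lintegral_map mc m13]
      show _ ≤ ENNReal.ofReal θ⁻¹ * ∫⁻ p, ENNReal.ofReal (dist p.1 p.2 ^ 2) ∂π1 +
        ENNReal.ofReal (1 - θ)⁻¹ * ∫⁻ p, ENNReal.ofReal (dist p.1 p.2 ^ 2) ∂π2
      have I1 : ∫⁻ p, ENNReal.ofReal (dist p.1 p.2 ^ 2) ∂π1 = ∫⁻ p, ENNReal.ofReal (dist p.1 p.2 ^ 2) ∂(G.map Prod.fst) := by rw [G1]
      have I2 : ∫⁻ p, ENNReal.ofReal (dist p.1 p.2 ^ 2) ∂π2 = ∫⁻ p, ENNReal.ofReal (dist p.1 p.2 ^ 2) ∂(G.map (fun w => (w.1.2, w.2))) := by rw [G2]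
      rw [I1, I2]
      have mA : Measurable fun a : (E × E) × E => ENNReal.ofReal (dist a.1.1 a.1.2 ^ 2) :=
        mc.comp measurable_fst
      have mB : Measurable fun a : (E × E) × E => ENNReal.ofReal (dist a.1.2 a.2 ^ 2) :=
        mc.comp (by fun_prop : Measurable fun a : (E × E) × E => (a.1.2, a.2))
      rw [lintegral_map mc measurable_fst, lintegral_map mc (by fun_prop)]
      rw [← lintegral_const_mul _ mA, ← lintegral_const_mul _ mB, ← lintegral_add_left (by fun_prop)]
      apply lintegral_mono
      intro w
      simp only
      rw [← ENNReal.ofReal_mul (by positivity), ← ENNReal.ofReal_mul (by positivity),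
        ← ENNReal.ofReal_add (by positivity) (by positivity)]
      apply ENNReal.ofReal_le_ofReal
      have ht := dist_triangle w.1.1 w.1.2 w.2
      set x := dist w.1.1 w.1.2
      set y := dist w.1.2 w.2
      have hxy : dist w.1.1 w.2 ^ 2 ≤ (x + y) ^ 2 := by gcongr
      refine hxy.trans ?_
      have : θ⁻¹ * x ^ 2 + (1 - θ)⁻¹ * y ^ 2 - (x + y) ^ 2 = ((1 - θ) * x - θ * y) ^ 2 / (θ * (1 - θ)) := by
        field_simp; ring
      have h2 : 0 ≤ ((1 - θ) * x - θ * y) ^ 2 / (θ * (1 - θ)) := by positivity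
      linarith
  have e1 : W2sq dist μ ν = ⨅ π1 : {π : Measure (E × E) // π.map Prod.fst = μ ∧ π.map Prod.snd = ν},
      ∫⁻ p, ENNReal.ofReal (dist p.1 p.2 ^ 2) ∂π1.1 := by
    unfold W2sq; rw [iInf_subtype']
  have e2 : W2sq dist ν ξ = ⨅ π1 : {π : Measure (E × E) // π.map Prod.fst = ν ∧ π.map Prod.snd = ξ},
      ∫⁻ p, ENNReal.ofReal (dist p.1 p.2 ^ 2) ∂π1.1 := by
    unfold W2sq; rw [iInf_subtype']
  rw [e1, e2, ENNReal.mul_iInf_of_ne (by simpa using h0) (by simp),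
    ENNReal.mul_iInf_of_ne (by simpa using h1) (by simp), ENNReal.iInf_add]
  refine le_iInf fun π1 => ?_
  rw [ENNReal.add_iInf]
  exact le_iInf fun π2 => key π1 π2

lemma W2_geod {E : Type*} [MeasurableSpace E] [PseudoMetricSpace E] [StandardBorelSpace E] [Nonempty E]
    (hd : Measurable fun p : E × E => dist p.1 p.2) (μ : ℝ → Measure E)
    (hp : ∀ t ∈ Set.Icc (0 : ℝ) 1, IsProbabilityMeasure (μ t))
    (hfin : W2sq dist (μ 0) (μ 1) ≠ ⊤)
    (hub : ∀ s ∈ Set.Icc (0 : ℝ) 1, ∀ t ∈ Set.Icc (0 : ℝ) 1,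
      W2sq dist (μ s) (μ t) ≤ ENNReal.ofReal ((t - s) ^ 2) * W2sq dist (μ 0) (μ 1)) :
    ∀ s ∈ Set.Icc (0 : ℝ) 1, ∀ t ∈ Set.Icc (0 : ℝ) 1,
      W2sq dist (μ s) (μ t) = ENNReal.ofReal ((t - s) ^ 2) * W2sq dist (μ 0) (μ 1) := by
  generalize hD : W2sq dist (μ 0) (μ 1) = D at *
  lift D to NNReal using hfin
  have wex : ∀ s t : ℝ, ∃ w : ℝ, s ∈ Set.Icc (0 : ℝ) 1 → t ∈ Set.Icc (0 : ℝ) 1 →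
      0 ≤ w ∧ W2sq dist (μ s) (μ t) = ENNReal.ofReal w ∧ w ≤ (t - s) ^ 2 * D := by
    intro s t
    refine ⟨(W2sq dist (μ s) (μ t)).toReal, fun hs ht => ?_⟩
    have h := hub s hs t ht
    have e : ENNReal.ofReal ((t - s) ^ 2) * (D : ENNReal) = ENNReal.ofReal ((t - s) ^ 2 * D) := by
      rw [ENNReal.ofReal_mul (sq_nonneg _), ENNReal.ofReal_coe_nnreal]
    rw [e] at h
    have hne : W2sq dist (μ s) (μ t) ≠ ⊤ := ne_top_of_le_ne_top ENNReal.ofReal_ne_top h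
    refine ⟨ENNReal.toReal_nonneg, (ENNReal.ofReal_toReal hne).symm, ?_⟩
    exact ENNReal.toReal_le_of_le_ofReal (mul_nonneg (sq_nonneg _) D.2) h
  choose w hw using wex
  have tri : ∀ a ∈ Set.Icc (0 : ℝ) 1, ∀ b ∈ Set.Icc (0 : ℝ) 1, ∀ c ∈ Set.Icc (0 : ℝ) 1, ∀ θ : ℝ, 0 < θ → θ < 1 →
      w a c ≤ θ⁻¹ * w a b + (1 - θ)⁻¹ * w b c := by
    intro a ha b hb c hc θ h0 h1
    have := hp a ha
    have := hp b hb
    have := hp c hc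
    have h := W2_tri hd (μ a) (μ b) (μ c) θ h0 h1
    have i0 : 0 ≤ θ⁻¹ := by positivity
    have i1 : 0 ≤ (1 - θ)⁻¹ := inv_nonneg.2 (by linarith)
    rw [(hw a c ha hc).2.1, (hw a b ha hb).2.1, (hw b c hb hc).2.1, ← ENNReal.ofReal_mul i0,
      ← ENNReal.ofReal_mul i1, ← ENNReal.ofReal_add (mul_nonneg i0 (hw a b ha hb).1) (mul_nonneg i1 (hw b c hb hc).1)] at h
    exact (ENNReal.ofReal_le_ofReal_iff (add_nonneg (mul_nonneg i0 (hw a b ha hb).1) (mul_nonneg i1 (hw b c hb hc).1))).1 h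
  have m0 : (0 : ℝ) ∈ Set.Icc (0 : ℝ) 1 := by simp
  have m1 : (1 : ℝ) ∈ Set.Icc (0 : ℝ) 1 := by simp
  have w01 : w 0 1 = D := by
    have h := (hw 0 1 m0 m1).2.1
    rw [hD] at h
    have := congrArg ENNReal.toReal h
    rw [ENNReal.toReal_ofReal (hw 0 1 m0 m1).1] at this
    simpa using this.symm
  have hD0 : (0 : ℝ) ≤ D := D.2
  have stepA : ∀ s ∈ Set.Icc (0 : ℝ) 1, (1 - s) ^ 2 * D ≤ w s 1 := by
    intro s hs
    rcases eq_or_lt_of_le hs.1 with h | h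
    · rw [← h, w01]; simp
    rcases eq_or_lt_of_le hs.2 with h' | h'
    · rw [h']; simpa using (hw 1 1 m1 m1).1
    have tr := tri 0 m0 s hs 1 m1 s h h'
    have u := (hw 0 s m0 hs).2.2
    rw [w01] at tr
    have hs' : 0 < 1 - s := by linarith
    have e1 : s⁻¹ * w 0 s ≤ s * D := by
      rw [inv_mul_le_iff₀ h]; nlinarith
    have e2 : (1 - s) * D ≤ (1 - s)⁻¹ * w s 1 := by linarith
    rw [le_inv_mul_iff₀ hs'] at e2
    linarith
  have main : ∀ s ∈ Set.Icc (0 : ℝ) 1, ∀ t ∈ Set.Icc (0 : ℝ) 1, s ≤ t →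
      W2sq dist (μ s) (μ t) = ENNReal.ofReal ((t - s) ^ 2) * D := by
    intro s hs t ht hst
    refine le_antisymm (hub s hs t ht) ?_
    rw [(hw s t hs ht).2.1]
    have e : ENNReal.ofReal ((t - s) ^ 2) * (D : ENNReal) = ENNReal.ofReal ((t - s) ^ 2 * D) := by
      rw [ENNReal.ofReal_mul (sq_nonneg _), ENNReal.ofReal_coe_nnreal]
    rw [e]
    apply ENNReal.ofReal_le_ofReal
    rcases eq_or_lt_of_le hst with h | h
    · rw [← h]; simpa using (hw s s hs hs).1
    rcases eq_or_lt_of_le ht.2 with h' | h'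
    · rw [h']; exact stepA s hs
    have hs1 : 0 < 1 - s := by linarith
    have ht1 : 0 < 1 - t := by linarith
    have hts : 0 < t - s := by linarith
    have hθ : 1 - (t - s) / (1 - s) = (1 - t) / (1 - s) := by field_simp; ring
    have tr := tri s hs t ht 1 m1 ((t - s) / (1 - s)) (by positivity) (by rw [div_lt_one hs1]; linarith)
    rw [hθ, inv_div, inv_div] at tr
    have a := stepA s hs
    have u := (hw t 1 ht m1).2.2
    have e1 : (1 - s) / (1 - t) * w t 1 ≤ (1 - s) * (1 - t) * D := by
      rw [div_mul_eq_mul_div, div_le_iff₀ ht1]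
      nlinarith
    have e2 : (1 - s) * ((t - s) * D) ≤ (1 - s) / (t - s) * w s t := by nlinarith
    rw [div_mul_eq_mul_div, le_div_iff₀ hts] at e2
    have e3 : (1 - s) * ((t - s) ^ 2 * D) ≤ (1 - s) * w s t := by nlinarith
    exact le_of_mul_le_mul_left e3 hs1
  intro s hs t ht
  rcases le_total s t with h | h
  · exact main s hs t ht h
  · rw [W2_symm _ _ hd, main t ht s hs h, show (s - t) ^ 2 = (t - s) ^ 2 by ring]


lemma neg_log_bound (u : ℝ) (hu : |u| ≤ 1 / 2) : -Real.log (1 + u) ≤ -u + 2 * u ^ 2 := by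
  obtain ⟨h1, h2⟩ := abs_le.1 hu
  have hp : 0 < 1 + u := by linarith
  have := Real.log_le_sub_one_of_pos (inv_pos.2 hp)
  rw [Real.log_inv] at this
  refine this.trans ?_
  rw [sub_le_iff_le_add, inv_le_iff_one_le_mul₀ hp]
  nlinarith [mul_nonneg (sq_nonneg u) (by linarith : 0 ≤ 1 + 2 * u)]

lemma R2_gain (k t ξ h0 h1 ω β : ℝ) (hk : 0 < k) (hk' : k ≤ 1 / 1000) (ht0 : 0 < t) (ht1 : 0 < 1 - t)
    (hξ : 0 < ξ) (hξ3 : ξ ≤ 3) (h00 : 0 ≤ h0) (h01 : h0 ≤ 1) (h10 : 0 ≤ h1) (h11 : h1 ≤ 1)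
    (hω0 : 0 < ω) (hω1 : ω < 1) (T : ℝ) (hT : T = t * (1 - t)) (hβb : |β| ≤ T * (3 * k * ξ ^ 2)) (hΔ0 : 0.49 * ξ ≤ |h1 - h0|) :
    ((((1 - t) * h0 + t * h1) + ω * β) ^ 2 - (1 - t) * h0 ^ 2 - t * h1 ^ 2) ≤ - (T * (0.2 * ξ ^ 2)) := by
  have hTp : 0 < T := by rw [hT]; positivity
  have e : ((((1 - t) * h0 + t * h1) + ω * β) ^ 2 - (1 - t) * h0 ^ 2 - t * h1 ^ 2) =
      - (T * (h1 - h0) ^ 2) + 2 * ((1 - t) * h0 + t * h1) * (ω * β) + (ω * β) ^ 2 := by rw [hT]; ring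
  have hwb : |ω * β| ≤ T * (3 * k * ξ ^ 2) := by
    rw [abs_mul, abs_of_pos hω0]
    calc ω * |β| ≤ 1 * (T * (3 * k * ξ ^ 2)) := by gcongr
      _ = _ := one_mul _
  have hl0 : 0 ≤ (1 - t) * h0 + t * h1 := by positivity
  have hl1 : (1 - t) * h0 + t * h1 ≤ 1 := by
    have := mul_le_mul_of_nonneg_left h01 ht1.le
    have := mul_le_mul_of_nonneg_left h11 ht0.le
    linarith
  have i1 : 2 * ((1 - t) * h0 + t * h1) * (ω * β) ≤ 2 * (T * (3 * k * ξ ^ 2)) := by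
    have : ((1 - t) * h0 + t * h1) * (ω * β) ≤ 1 * (T * (3 * k * ξ ^ 2)) := by
      calc _ ≤ ((1 - t) * h0 + t * h1) * |ω * β| := by gcongr; exact le_abs_self _
        _ ≤ _ := by gcongr
    linarith
  have hsmall : |ω * β| ≤ 1 := by
    refine hwb.trans ?_
    have a1 : T ≤ 1 := by rw [hT]; nlinarith
    have a2 : 3 * k * ξ ^ 2 ≤ 3 * (1 / 1000) * 3 ^ 2 := by gcongr
    calc T * (3 * k * ξ ^ 2) ≤ 1 * (3 * (1 / 1000) * 3 ^ 2) := by gcongr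
      _ ≤ 1 := by norm_num
  have i2 : (ω * β) ^ 2 ≤ T * (3 * k * ξ ^ 2) := by
    rw [← sq_abs, sq]
    calc _ ≤ |ω * β| * 1 := by gcongr
      _ ≤ _ := by rw [mul_one]; exact hwb
  have i3 : (0.49 * ξ) ^ 2 ≤ (h1 - h0) ^ 2 := by
    rw [← sq_abs (h1 - h0)]; gcongr
  rw [e]
  have i4 : T * ((0.49 * ξ) ^ 2) ≤ T * (h1 - h0) ^ 2 := by gcongr
  have i5 : T * (k * ξ ^ 2) ≤ T * (1 / 1000 * ξ ^ 2) := by gcongr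
  have i6 := mul_pos hTp (pow_pos hξ 2)
  have i7 : T * ((0.49 * ξ) ^ 2) = 0.2401 * (T * ξ ^ 2) := by ring
  have i8 : T * (3 * k * ξ ^ 2) = 3 * (T * (k * ξ ^ 2)) := by ring
  linarith

set_option maxHeartbeats 2000000 in
lemma R2_core (k t ξ α0 α1 h0 h1 K σ : ℝ) (hk : 0 < k) (hk' : k ≤ 1 / 1000) (ht0 : 0 < t) (ht1 : t < 1)
    (hξ : 0 < ξ) (hξ3 : ξ ≤ 3) (hα0 : |α0| ≤ t * (k * ξ)) (hα1 : |α1| ≤ (1 - t) * (k * ξ))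
    (h00 : 0 ≤ h0) (h01 : h0 ≤ 1) (h10 : 0 ≤ h1) (h11 : h1 ≤ 1)
    (hκ0 : 0 ≤ (1 - t) * α0 + t * α1) (hκ : (1 - t) * α0 + t * α1 ≤ t * (1 - t) * (k * ξ ^ 2))
    (hσ : σ = 1 ∨ σ = -1) (hη0 : ξ / 2 < σ * ((1 + α1) * h1 - (1 + α0) * h0))
    (hη1 : σ * ((1 + α1) * h1 - (1 + α0) * h0) < ξ) (hK : 1 ≤ K)
    (ω β P0 P1 : ℝ) (hω : ω = 2 * (σ * ((1 + α1) * h1 - (1 + α0) * h0)) / ξ - 1)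
    (hβ : β = (1 - t) * α0 * h0 + t * α1 * h1)
    (hP0 : P0 = (1 - t) * (1 + ω * α0) - 2 * σ * β / ξ * (1 + α0))
    (hP1 : P1 = t * (1 + ω * α1) + 2 * σ * β / ξ * (1 + α1)) :
    0 < P0 ∧ 0 < P1 ∧ (1 - t) * Real.log ((1 - t) / P0) + t * Real.log (t / P1) +
      K * ((((1 - t) * h0 + t * h1) + ω * β) ^ 2 - (1 - t) * h0 ^ 2 - t * h1 ^ 2) < 0 := by
  have ht1' : 0 < 1 - t := by linarith
  have hσ2 : |σ| = 1 := by rcases hσ with h | h <;> simp [h]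
  set ε := k * ξ with hε
  have hε0 : 0 < ε := by positivity
  have hε1 : ε ≤ 3 / 1000 := by nlinarith
  have hω0 : 0 < ω := by
    rw [hω, sub_pos, lt_div_iff₀ hξ]; linarith
  have hω1 : ω < 1 := by
    rw [hω, sub_lt_iff_lt_add, div_lt_iff₀ hξ]; linarith
  have a0e : |α0| ≤ ε := hα0.trans (by nlinarith)
  have a1e : |α1| ≤ ε := hα1.trans (by nlinarith)
  -- Δh bounds
  have hηabs : |(1 + α1) * h1 - (1 + α0) * h0| = σ * ((1 + α1) * h1 - (1 + α0) * h0) := by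
    have : 0 < σ * ((1 + α1) * h1 - (1 + α0) * h0) := by linarith
    rcases hσ with h | h
    · rw [h] at this ⊢; rw [one_mul] at this ⊢; exact abs_of_pos this
    · rw [h] at this ⊢; rw [neg_one_mul] at this ⊢; exact abs_of_neg (by linarith)
  have hαh : |α1 * h1 - α0 * h0| ≤ ε := by
    have e1 : |α1 * h1| ≤ (1 - t) * ε := by
      rw [abs_mul, abs_of_nonneg h10]
      calc |α1| * h1 ≤ |α1| * 1 := by gcongr
        _ ≤ _ := by rw [mul_one]; exact hα1
    have e0 : |α0 * h0| ≤ t * ε := by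
      rw [abs_mul, abs_of_nonneg h00]
      calc |α0| * h0 ≤ |α0| * 1 := by gcongr
        _ ≤ _ := by rw [mul_one]; exact hα0
    calc |α1 * h1 - α0 * h0| ≤ |α1 * h1| + |α0 * h0| := abs_sub _ _
      _ ≤ ε := by linarith
  have hΔ1 : |h1 - h0| ≤ 1.001 * ξ := by
    have : h1 - h0 = ((1 + α1) * h1 - (1 + α0) * h0) - (α1 * h1 - α0 * h0) := by ring
    rw [this]
    refine (abs_sub _ _).trans ?_
    rw [hηabs]
    nlinarith
  have hΔ0 : 0.49 * ξ ≤ |h1 - h0| := by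
    have : (1 + α1) * h1 - (1 + α0) * h0 = (h1 - h0) + (α1 * h1 - α0 * h0) := by ring
    have h3 : |(1 + α1) * h1 - (1 + α0) * h0| ≤ |h1 - h0| + ε := by
      rw [this]; exact (abs_add_le _ _).trans (by linarith)
    rw [hηabs] at h3
    nlinarith
  -- β bound
  have hβb : |β| ≤ t * (1 - t) * (3 * k * ξ ^ 2) := by
    have e : β = t * (α1 * (h1 - h0)) + ((1 - t) * α0 + t * α1) * h0 := by rw [hβ]; ring
    rw [e]
    have e1 : |t * (α1 * (h1 - h0))| ≤ t * ((1 - t) * ε * (1.001 * ξ)) := by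
      rw [abs_mul, abs_mul, abs_of_pos ht0]
      gcongr
    have e2 : |((1 - t) * α0 + t * α1) * h0| ≤ t * (1 - t) * (k * ξ ^ 2) := by
      rw [abs_mul, abs_of_nonneg hκ0, abs_of_nonneg h00]
      calc _ ≤ ((1 - t) * α0 + t * α1) * 1 := by gcongr
        _ ≤ _ := by linarith
    refine (abs_add_le _ _).trans ((add_le_add e1 e2).trans ?_)
    rw [hε]
    have : 0 < t * (1 - t) * (k * ξ ^ 2) := by positivity
    have e3 : t * ((1 - t) * (k * ξ) * (1.001 * ξ)) = 1.001 * (t * (1 - t) * (k * ξ ^ 2)) := by ring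
    have e4 : t * (1 - t) * (3 * k * ξ ^ 2) = 3 * (t * (1 - t) * (k * ξ ^ 2)) := by ring
    rw [e3, e4]; linarith
  set q := 2 * σ * β / ξ with hq
  have hqb : |q| ≤ t * (1 - t) * (6 * ε) := by
    rw [hq, abs_div, abs_mul, abs_mul, hσ2, abs_of_pos hξ, abs_of_pos (two_pos), div_le_iff₀ hξ, hε]
    calc 2 * 1 * |β| ≤ 2 * 1 * (t * (1 - t) * (3 * k * ξ ^ 2)) := by gcongr
      _ = _ := by ring
  set A := ω * α0 - q / (1 - t) * (1 + α0) with hA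
  set B := ω * α1 + q / t * (1 + α1) with hB
  have eP0 : P0 = (1 - t) * (1 + A) := by
    rw [hP0, hA]; field_simp; ring
  have eP1 : P1 = t * (1 + B) := by
    rw [hP1, hB]; field_simp; ring
  have hAb : |A| ≤ t * (8 * ε) := by
    have e1 : |ω * α0| ≤ t * ε := by
      rw [abs_mul, abs_of_pos hω0]
      calc ω * |α0| ≤ 1 * (t * ε) := by gcongr
        _ = _ := one_mul _
    have e2 : |q / (1 - t)| ≤ t * (6 * ε) := by
      rw [abs_div, abs_of_pos ht1', div_le_iff₀ ht1']; linarith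
    have e3 : |1 + α0| ≤ 1.01 := by
      refine (abs_add_le _ _).trans ?_; rw [abs_one]; linarith
    refine (abs_sub _ _).trans ?_
    rw [abs_mul (q / (1 - t))]
    have : |q / (1 - t)| * |1 + α0| ≤ t * (6 * ε) * 1.01 := by gcongr
    linarith [mul_pos ht0 hε0]
  have hBb : |B| ≤ (1 - t) * (8 * ε) := by
    have e1 : |ω * α1| ≤ (1 - t) * ε := by
      rw [abs_mul, abs_of_pos hω0]
      calc ω * |α1| ≤ 1 * ((1 - t) * ε) := by gcongr
        _ = _ := one_mul _
    have e2 : |q / t| ≤ (1 - t) * (6 * ε) := by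
      rw [abs_div, abs_of_pos ht0, div_le_iff₀ ht0]; linarith
    have e3 : |1 + α1| ≤ 1.01 := by
      refine (abs_add_le _ _).trans ?_; rw [abs_one]; linarith
    refine (abs_add_le _ _).trans ?_
    rw [abs_mul (q / t)]
    have : |q / t| * |1 + α1| ≤ (1 - t) * (6 * ε) * 1.01 := by gcongr
    linarith [mul_pos ht1' hε0]
  have hA2 : |A| ≤ 1 / 2 := hAb.trans (by nlinarith)
  have hB2 : |B| ≤ 1 / 2 := hBb.trans (by nlinarith)
  have hAp : 0 < 1 + A := by linarith [(abs_le.1 hA2).1]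
  have hBp : 0 < 1 + B := by linarith [(abs_le.1 hB2).1]
  refine ⟨by rw [eP0]; positivity, by rw [eP1]; positivity, ?_⟩
  have l0 : Real.log ((1 - t) / P0) = -Real.log (1 + A) := by
    rw [eP0, ← div_div, div_self ht1'.ne', one_div, Real.log_inv]
  have l1 : Real.log (t / P1) = -Real.log (1 + B) := by
    rw [eP1, ← div_div, div_self ht0.ne', one_div, Real.log_inv]
  rw [l0, l1]
  have n0 := neg_log_bound A hA2
  have n1 := neg_log_bound B hB2
  have hAB : (1 - t) * A + t * B = ω * ((1 - t) * α0 + t * α1) + q * (α1 - α0) := by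
    rw [hA, hB]; field_simp; ring
  have hqa : -(t * (1 - t) * (6 * ε ^ 2)) ≤ q * (α1 - α0) := by
    have : |q * (α1 - α0)| ≤ t * (1 - t) * (6 * ε) * ε := by
      rw [abs_mul]
      have : |α1 - α0| ≤ ε := (abs_sub _ _).trans (by linarith)
      gcongr
    have := (abs_le.1 this).1
    have e5 : t * (1 - t) * (6 * ε) * ε = t * (1 - t) * (6 * ε ^ 2) := by ring
    linarith
  have hAsq : A ^ 2 ≤ (t * (8 * ε)) ^ 2 := sq_le_sq' (by linarith [(abs_le.1 hAb).1]) (by linarith [(abs_le.1 hAb).2])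
  have hBsq : B ^ 2 ≤ ((1 - t) * (8 * ε)) ^ 2 := sq_le_sq' (by linarith [(abs_le.1 hBb).1]) (by linarith [(abs_le.1 hBb).2])
  set T := t * (1 - t) with hT
  have hTp : 0 < T := by positivity
  have loss : (1 - t) * -Real.log (1 + A) + t * -Real.log (1 + B) ≤ T * (134 * ε ^ 2) := by
    have m0 : (1 - t) * -Real.log (1 + A) ≤ (1 - t) * (-A + 2 * (t * (8 * ε)) ^ 2) := by
      apply mul_le_mul_of_nonneg_left _ ht1'.le; linarith
    have m1 : t * -Real.log (1 + B) ≤ t * (-B + 2 * ((1 - t) * (8 * ε)) ^ 2) := by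
      apply mul_le_mul_of_nonneg_left _ ht0.le; linarith
    have e : (1 - t) * (t * (8 * ε)) ^ 2 + t * ((1 - t) * (8 * ε)) ^ 2 = T * (64 * ε ^ 2) := by
      rw [hT]; ring
    have e2 : 0 ≤ ω * ((1 - t) * α0 + t * α1) := by positivity
    have e3 : -((1 - t) * A + t * B) ≤ T * (6 * ε ^ 2) := by rw [hAB]; linarith
    linarith
  have gain := R2_gain k t ξ h0 h1 ω β hk hk' ht0 ht1' hξ hξ3 h00 h01 h10 h11 hω0 hω1 T hT hβb hΔ0
  have hεξ : ε ^ 2 ≤ 1 / 1000000 * ξ ^ 2 := by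
    rw [hε, mul_pow]; gcongr; rw [show (1:ℝ)/1000000 = (1/1000)^2 by norm_num]; gcongr
  have hTξ : 0 < T * ξ ^ 2 := by positivity
  have g2 : K * ((((1 - t) * h0 + t * h1) + ω * β) ^ 2 - (1 - t) * h0 ^ 2 - t * h1 ^ 2) ≤ - (T * (0.2 * ξ ^ 2)) := by
    have gn : 0 ≤ T * (0.2 * ξ ^ 2) := by positivity
    have := mul_le_mul_of_nonneg_left gain (by linarith : (0:ℝ) ≤ K)
    have := mul_le_mul_of_nonneg_right hK gn
    linarith
  have l2 : T * (134 * ε ^ 2) ≤ T * (134 * (1 / 1000000 * ξ ^ 2)) := by gcongr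
  linarith

open MeasureTheory

structure FH (k : ℝ) (f f' φ : ℝ → ℝ) : Prop where
  kpos : 0 < k
  kle : k ≤ 1 / 1000
  df : ∀ x, HasDerivAt f (f' x) x
  df' : ∀ x, HasDerivAt f' (φ x) x
  phi0 : ∀ x, 0 ≤ φ x
  phi1 : ∀ x, φ x ≤ 1
  fp0 : ∀ x, 0 ≤ f' x
  fpk : ∀ x, f' x ≤ k
  f0 : ∀ x, 0 ≤ f x
  fm1 : f (-1) = 0

lemma FH_of (k : ℝ) (hk : 0 < k) (hk' : k ≤ 1 / 1000) (φ f f' : ℝ → ℝ) (hc : Continuous φ) (h0 : ∀ x, 0 ≤ φ x)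
    (h1 : ∀ x, φ x ≤ 1) (hs : ∀ x, x ∉ Set.Icc (-k) k → φ x = 0) (hi : (∫ x, φ x) = k)
    (hf : ∀ x, HasDerivAt f (f' x) x) (hf' : ∀ x, HasDerivAt f' (φ x) x) (e' : f' (-1) = 0) (e : f (-1) = 0) :
    FH k f f' φ := by
  have hphi : Integrable φ := by
    apply hc.integrable_of_hasCompactSupport
    exact HasCompactSupport.intro (K := Set.Icc (-k) k) isCompact_Icc (fun x hx => hs x hx)
  have hF : ∀ x, f' x = ∫ y in (-1)..x, φ y := by
    intro x
    rw [intervalIntegral.integral_eq_sub_of_hasDerivAt (fun y _ => hf' y) hphi.intervalIntegrable, e', sub_zero]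
  have hmono' : Monotone f' := by
    apply monotone_of_deriv_nonneg (fun x => (hf' x).differentiableAt)
    intro x; rw [(hf' x).deriv]; exact h0 x
  have hleft : ∀ x, x ≤ -1 → f' x = 0 := by
    intro x hx
    rw [hF, intervalIntegral.integral_symm]
    have : ∫ y in x..(-1), φ y = ∫ y in x..(-1), (0 : ℝ) := by
      apply intervalIntegral.integral_congr
      intro y hy
      rw [Set.uIcc_of_le hx] at hy
      apply hs; intro h; linarith [h.1, hy.2]
    rw [this]; simp
  have hp0 : ∀ x, 0 ≤ f' x := by
    intro x
    rcases le_total x (-1) with hx | hx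
    · rw [hleft x hx]
    · rw [← e']; exact hmono' hx
  have hmono : Monotone f := by
    apply monotone_of_deriv_nonneg (fun x => (hf x).differentiableAt)
    intro x; rw [(hf x).deriv]; exact hp0 x
  refine ⟨hk, hk', hf, hf', h0, h1, hp0, ?_, ?_, e⟩
  · intro x
    rcases le_total x (-1) with hx | hx
    · rw [hleft x hx]; exact hk.le
    · rw [hF, intervalIntegral.integral_of_le hx, ← hi]
      exact setIntegral_le_integral hphi (Filter.Eventually.of_forall h0)
  · intro x
    rcases le_total x (-1) with hx | hx
    · have : f (-1) - f x = 0 := by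
        have := intervalIntegral.integral_eq_sub_of_hasDerivAt (a := x) (b := -1) (fun y _ => hf y)
          ((continuous_iff_continuousAt.2 fun y => (hf' y).continuousAt).intervalIntegrable _ _)
        rw [← this]
        have : ∫ y in x..(-1), f' y = ∫ y in x..(-1), (0 : ℝ) := by
          apply intervalIntegral.integral_congr
          intro y hy
          rw [Set.uIcc_of_le hx] at hy
          exact hleft y hy.2
        rw [this]; simp
      linarith
    · rw [← e]; exact hmono hx

namespace FH

lemma cont {k : ℝ} {f f' φ : ℝ → ℝ} (H : FH k f f' φ) : Continuous f := continuous_iff_continuousAt.2 fun y => (H.df y).continuousAt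
lemma cont' {k : ℝ} {f f' φ : ℝ → ℝ} (H : FH k f f' φ) : Continuous f' := continuous_iff_continuousAt.2 fun y => (H.df' y).continuousAt

lemma mono {k : ℝ} {f f' φ : ℝ → ℝ} (H : FH k f f' φ) : Monotone f := by
  apply monotone_of_deriv_nonneg (fun x => (H.df x).differentiableAt)
  intro x; rw [(H.df x).deriv]; exact H.fp0 x

lemma mono' {k : ℝ} {f f' φ : ℝ → ℝ} (H : FH k f f' φ) : Monotone f' := by
  apply monotone_of_deriv_nonneg (fun x => (H.df' x).differentiableAt)
  intro x; rw [(H.df' x).deriv]; exact H.phi0 x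

lemma lip {k : ℝ} {f f' φ : ℝ → ℝ} (H : FH k f f' φ) (x y : ℝ) : |f x - f y| ≤ k * |x - y| := by
  have := Convex.norm_image_sub_le_of_norm_hasDerivWithin_le (f := f) (f' := f') (s := Set.univ) (C := k) (x := y) (y := x)
    (fun z _ => (H.df z).hasDerivWithinAt) (fun z _ => by
      rw [Real.norm_eq_abs, abs_of_nonneg (H.fp0 z)]; exact H.fpk z) convex_univ trivial trivial
  simpa [Real.norm_eq_abs] using this

lemma le2k {k : ℝ} {f f' φ : ℝ → ℝ} (H : FH k f f' φ) (x : ℝ) (h : x ≤ 1) : f x ≤ 2 * k := by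
  have h1 := H.mono h
  have := (abs_le.1 (H.lip 1 (-1))).2
  rw [H.fm1] at this
  have e : |(1:ℝ) - -1| = 2 := by norm_num
  rw [e] at this; linarith

lemma cvx {k : ℝ} {f f' φ : ℝ → ℝ} (H : FH k f f' φ) : ConvexOn ℝ Set.univ f := by
  apply MonotoneOn.convexOn_of_deriv convex_univ H.cont.continuousOn
  · intro x _; exact (H.df x).differentiableAt.differentiableWithinAt
  · have : deriv f = f' := by ext x; exact (H.df x).deriv
    rw [this]; exact H.mono'.monotoneOn _

lemma cvx2 {k : ℝ} {f f' φ : ℝ → ℝ} (H : FH k f f' φ) : ConvexOn ℝ Set.univ (fun x => x ^ 2 / 2 - f x) := by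
  have hd : ∀ x, HasDerivAt (fun x => x ^ 2 / 2 - f x) (x - f' x) x := by
    intro x
    have := ((hasDerivAt_pow 2 x).div_const 2).sub (H.df x)
    refine this.congr_deriv ?_; ring
  apply MonotoneOn.convexOn_of_deriv convex_univ
  · exact ((continuous_pow 2).div_const 2 |>.sub H.cont).continuousOn
  · intro x _; exact (hd x).differentiableAt.differentiableWithinAt
  · have : deriv (fun x => x ^ 2 / 2 - f x) = fun x => x - f' x := by ext x; exact (hd x).deriv
    rw [this]
    apply Monotone.monotoneOn
    have hd2 : ∀ x, HasDerivAt (fun x => x - f' x) (1 - φ x) x := fun x => (hasDerivAt_id x).sub (H.df' x)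
    apply monotone_of_deriv_nonneg (fun x => (hd2 x).differentiableAt)
    intro x; rw [(hd2 x).deriv]; linarith [H.phi1 x]

lemma gap0 {k : ℝ} {f f' φ : ℝ → ℝ} (H : FH k f f' φ) (t x y : ℝ) (h0 : 0 ≤ t) (h1 : t ≤ 1) : f ((1 - t) * x + t * y) ≤ (1 - t) * f x + t * f y := by
  have := H.cvx.2 (Set.mem_univ x) (Set.mem_univ y) (by linarith : 0 ≤ 1 - t) h0 (by ring)
  simpa using this

lemma gap1 {k : ℝ} {f f' φ : ℝ → ℝ} (H : FH k f f' φ) (t x y : ℝ) (h0 : 0 ≤ t) (h1 : t ≤ 1) :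
    (1 - t) * f x + t * f y ≤ f ((1 - t) * x + t * y) + t * (1 - t) * (x - y) ^ 2 / 2 := by
  have := H.cvx2.2 (Set.mem_univ x) (Set.mem_univ y) (by linarith : 0 ≤ 1 - t) h0 (by ring)
  simp only [smul_eq_mul] at this
  nlinarith

lemma lip0 {k : ℝ} {f f' φ : ℝ → ℝ} (H : FH k f f' φ) (t x0 x1 : ℝ) (h0 : 0 ≤ t) : |f x0 - f ((1 - t) * x0 + t * x1)| ≤ k * (t * |x1 - x0|) := by
  refine (H.lip _ _).trans (le_of_eq ?_)
  rw [show x0 - ((1 - t) * x0 + t * x1) = - (t * (x1 - x0)) by ring, abs_neg, abs_mul, abs_of_nonneg h0]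

lemma lip1 {k : ℝ} {f f' φ : ℝ → ℝ} (H : FH k f f' φ) (t x0 x1 : ℝ) (h1 : t ≤ 1) : |f x1 - f ((1 - t) * x0 + t * x1)| ≤ k * ((1 - t) * |x1 - x0|) := by
  refine (H.lip _ _).trans (le_of_eq ?_)
  rw [show x1 - ((1 - t) * x0 + t * x1) = ((1 - t) * (x1 - x0)) by ring, abs_mul, abs_of_nonneg (by linarith : 0 ≤ 1 - t)]

lemma ylin_le {k : ℝ} {f f' φ : ℝ → ℝ} (H : FH k f f' φ) (t x0 x1 h0 h1 : ℝ) (ht0 : 0 ≤ t) (ht1 : t ≤ 1) (h01 : h0 ≤ 1) (h11 : h1 ≤ 1)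
    (hb : |x1 - x0| / 2 ≤ |f x1 * h1 - f x0 * h0|) :
    (1 - t) * (f x0 * h0) + t * (f x1 * h1) ≤ f ((1 - t) * x0 + t * x1) := by
  have l0 := (abs_le.1 (H.lip0 t x0 x1 ht0)).2
  have l1 := (abs_le.1 (H.lip1 t x0 x1 ht1)).2
  have y0 : f x0 * h0 ≤ f x0 := mul_le_of_le_one_right (H.f0 _) h01
  have y1 : f x1 * h1 ≤ f x1 := mul_le_of_le_one_right (H.f0 _) h11
  have ha := abs_nonneg (x1 - x0)
  have hk : k * |x1 - x0| ≤ |x1 - x0| / 2 := by nlinarith [H.kle]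
  have s1 : 0 ≤ 1 - t := by linarith
  rcases abs_cases (f x1 * h1 - f x0 * h0) with ⟨e, _⟩ | ⟨e, _⟩
  · rw [e] at hb
    have := mul_le_mul_of_nonneg_left (hk.trans hb) s1
    nlinarith
  · rw [e] at hb
    have := mul_le_mul_of_nonneg_left (hk.trans hb) ht0
    nlinarith

end FH

noncomputable def om (a b : ℝ) : ℝ := open Classical in
  if |a| ≤ |b| ∧ b ≠ 0 then 1 else max 0 (2 * |b| / |a| - 1)

lemma om_nonneg (a b : ℝ) : 0 ≤ om a b := by
  unfold om; split_ifs
  · exact zero_le_one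
  · exact le_max_left _ _

lemma om_one (a b : ℝ) (h : |a| ≤ |b|) (hb : b ≠ 0) : om a b = 1 := by
  unfold om; rw [if_pos ⟨h, hb⟩]

lemma om_eq (a b : ℝ) (ha : a ≠ 0) (h : |b| ≤ |a|) : om a b = max 0 (2 * |b| / |a| - 1) := by
  have ha' : 0 < |a| := abs_pos.2 ha
  unfold om; split_ifs with h1
  · have : |b| = |a| := le_antisymm h h1.1
    rw [this, mul_div_assoc, div_self ha'.ne']; norm_num
  · rfl

lemma om_le_one (a b : ℝ) : om a b ≤ 1 := by
  unfold om; split_ifs with h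
  · exact le_rfl
  · apply max_le zero_le_one
    rcases eq_or_ne a 0 with ha | ha
    · simp [ha]
    · have ha' : 0 < |a| := abs_pos.2 ha
      rw [sub_le_iff_le_add, div_le_iff₀ ha']
      by_cases hb : b = 0
      · simp [hb]
      · have : ¬ (|a| ≤ |b|) := fun h' => h ⟨h', hb⟩
        push Not at this; linarith

lemma om_pos (a b : ℝ) (h : 0 < om a b) : |a| / 2 ≤ |b| ∧ b ≠ 0 := by
  unfold om at h; split_ifs at h with h'
  · exact ⟨by linarith [abs_nonneg a, h'.1], h'.2⟩
  · have h2 : 0 < 2 * |b| / |a| - 1 := by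
      rcases lt_max_iff.1 h with h | h
      · exact absurd h (lt_irrefl _)
      · exact h
    rcases eq_or_ne a 0 with ha | ha
    · simp [ha] at h2; linarith
    · have ha' : 0 < |a| := abs_pos.2 ha
      rw [sub_pos, lt_div_iff₀ ha'] at h2
      refine ⟨by linarith, ?_⟩
      rintro rfl; simp at h2; linarith

lemma om_bound_lt (a b : ℝ) (h : |b| < |a|) : (1 - om a b) * |a| ≤ 2 * (|a| - |b|) := by
  have ha' : 0 < |a| := (abs_nonneg b).trans_lt h
  rw [om_eq a b (abs_pos.1 ha') h.le]
  have : 2 * |b| / |a| - 1 ≤ max 0 (2 * |b| / |a| - 1) := le_max_right _ _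
  have e : 2 * |b| / |a| * |a| = 2 * |b| := by field_simp
  nlinarith

lemma om_bound_strict (k a b : ℝ) (hk : 0 < k) (hk' : k ≤ 1 / 1000) (h : |b| < |a|) :
    |b| + (1 - om a b) * (2 * k * |a|) < |a| := by
  have := om_bound_lt a b h
  nlinarith

lemma om_bound (k a b : ℝ) (hk : 0 < k) (hk' : k ≤ 1 / 1000) :
    |b| + (1 - om a b) * (2 * k * |a|) ≤ max |a| |b| := by
  rcases lt_or_ge |b| |a| with h | h
  · exact (om_bound_strict k a b hk hk' h).le.trans (le_max_left _ _)
  · by_cases hb : b = 0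
    · subst hb
      have : a = 0 := by simpa using h
      simp [this]
    · rw [om_one a b h hb]; simp

lemma om_lip (a b b' : ℝ) (ha : a ≠ 0) (h : |b| ≤ |a|) (h' : |b'| ≤ |a|) :
    |om a b' - om a b| ≤ 2 / |a| * |b' - b| := by
  rw [om_eq a b ha h, om_eq a b' ha h']
  have ha' : 0 < |a| := abs_pos.2 ha
  refine (abs_max_sub_max_le_max (0:ℝ) _ _ _).trans ?_
  rw [sub_self, abs_zero]
  apply max_le (by positivity)
  have : 2 * |b'| / |a| - 1 - (2 * |b| / |a| - 1) = 2 / |a| * (|b'| - |b|) := by ring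
  rw [this, abs_mul, abs_of_pos (by positivity : 0 < 2 / |a|)]
  exact mul_le_mul_of_nonneg_left (abs_abs_sub_abs_le b' b) (by positivity)

open MeasureTheory

abbrev ZZ := (ℝ × ℝ) × (ℝ × ℝ)
def PP (f : ℝ → ℝ) (p : ℝ × ℝ) : ℝ × ℝ := (p.1, f p.1 * p.2)
def gdx (γ : ZZ) : ℝ := γ.2.1 - γ.1.1
def gdy (f : ℝ → ℝ) (γ : ZZ) : ℝ := f γ.2.1 * γ.2.2 - f γ.1.1 * γ.1.2
def gx (t : ℝ) (γ : ZZ) : ℝ := (1 - t) * γ.1.1 + t * γ.2.1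
def gh (t : ℝ) (γ : ZZ) : ℝ := (1 - t) * γ.1.2 + t * γ.2.2
def gy (f : ℝ → ℝ) (t : ℝ) (γ : ZZ) : ℝ := (1 - t) * (f γ.1.1 * γ.1.2) + t * (f γ.2.1 * γ.2.2)
noncomputable def gw (f : ℝ → ℝ) (γ : ZZ) : ℝ := om (gdx γ) (gdy f γ)
noncomputable def Gh (f : ℝ → ℝ) (t : ℝ) (γ : ZZ) : ℝ × ℝ :=
  (gx t γ, (1 - gw f γ) * gh t γ + gw f γ * (gy f t γ / f (gx t γ)))
def RR : Set (ℝ × ℝ) := Set.Icc (-1) 1 ×ˢ Set.Icc 0 1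
def R2 : Set ZZ := RR ×ˢ RR

lemma PP_dist (f : ℝ → ℝ) (γ : ZZ) : dist (PP f γ.1) (PP f γ.2) = max |gdx γ| |gdy f γ| := by
  rw [Prod.dist_eq, Real.dist_eq, Real.dist_eq, abs_sub_comm]
  congr 1
  rw [abs_sub_comm]; rfl

namespace FH

lemma gy_nonneg {k : ℝ} {f f' φ : ℝ → ℝ} (H : FH k f f' φ) {γ : ZZ} (hγ : γ ∈ R2) {t : ℝ} (h0 : 0 ≤ t) (h1 : t ≤ 1) : 0 ≤ gy f t γ := by
  have := H.f0 γ.1.1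
  have := H.f0 γ.2.1
  have := hγ.1.2.1
  have := hγ.2.2.1
  have : 0 ≤ 1 - t := by linarith
  unfold gy; positivity

lemma gy_le {k : ℝ} {f f' φ : ℝ → ℝ} (H : FH k f f' φ) {γ : ZZ} (hγ : γ ∈ R2) {t : ℝ} (h0 : 0 ≤ t) (h1 : t ≤ 1) (hw : 0 < gw f γ) : gy f t γ ≤ f (gx t γ) :=
  H.ylin_le t _ _ _ _ h0 h1 hγ.1.2.2 hγ.2.2.2 (om_pos _ _ hw).1

lemma gy_pos {k : ℝ} {f f' φ : ℝ → ℝ} (H : FH k f f' φ) {γ : ZZ} (hγ : γ ∈ R2) {t : ℝ} (h0 : 0 < t) (h1 : t < 1) (hw : gdy f γ ≠ 0) : 0 < gy f t γ := by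
  have hb := hw
  have y0 : 0 ≤ f γ.1.1 * γ.1.2 := mul_nonneg (H.f0 _) hγ.1.2.1
  have y1 : 0 ≤ f γ.2.1 * γ.2.2 := mul_nonneg (H.f0 _) hγ.2.2.1
  have s1 : 0 < 1 - t := by linarith
  unfold gy
  rcases y0.eq_or_lt with e | e
  · rcases y1.eq_or_lt with e' | e'
    · exact absurd (by rw [gdy, ← e, ← e']; ring) hb
    · positivity
  · positivity

lemma gf_pos {k : ℝ} {f f' φ : ℝ → ℝ} (H : FH k f f' φ) {γ : ZZ} (hγ : γ ∈ R2) {t : ℝ} (h0 : 0 < t) (h1 : t < 1) (hw : 0 < gw f γ) : 0 < f (gx t γ) :=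
  (H.gy_pos hγ h0 h1 (om_pos _ _ hw).2).trans_le (H.gy_le hγ h0.le h1.le hw)

lemma gx_mem {k : ℝ} {f f' φ : ℝ → ℝ} (H : FH k f f' φ) {γ : ZZ} (hγ : γ ∈ R2) {t : ℝ} (h0 : 0 ≤ t) (h1 : t ≤ 1) : gx t γ ∈ Set.Icc (-1 : ℝ) 1 := by
  have := (convex_Icc (-1 : ℝ) 1) hγ.1.1 hγ.2.1 (by linarith : 0 ≤ 1 - t) h0 (by ring)
  simpa [gx] using this

lemma gh_mem {k : ℝ} {f f' φ : ℝ → ℝ} (H : FH k f f' φ) {γ : ZZ} (hγ : γ ∈ R2) {t : ℝ} (h0 : 0 ≤ t) (h1 : t ≤ 1) : gh t γ ∈ Set.Icc (0 : ℝ) 1 := by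
  have := (convex_Icc (0 : ℝ) 1) hγ.1.2 hγ.2.2 (by linarith : 0 ≤ 1 - t) h0 (by ring)
  simpa [gh] using this

lemma Gh_mem {k : ℝ} {f f' φ : ℝ → ℝ} (H : FH k f f' φ) {γ : ZZ} (hγ : γ ∈ R2) {t : ℝ} (h0 : 0 ≤ t) (h1 : t ≤ 1) : Gh f t γ ∈ RR := by
  refine ⟨H.gx_mem hγ h0 h1, ?_⟩
  rcases (om_nonneg (gdx γ) (gdy f γ)).eq_or_lt with e | e
  · have e : gw f γ = 0 := e.symm
    simp only [Gh, e]; simpa using H.gh_mem hγ h0 h1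
  · have e : 0 < gw f γ := e
    have hq : gy f t γ / f (gx t γ) ∈ Set.Icc (0 : ℝ) 1 :=
      ⟨div_nonneg (H.gy_nonneg hγ h0 h1) (H.f0 _), div_le_one_of_le₀ (H.gy_le hγ h0 h1 e) (H.f0 _)⟩
    have h1' : gw f γ ≤ 1 := om_le_one _ _
    have := (convex_Icc (0 : ℝ) 1) (H.gh_mem hγ h0 h1) hq (by linarith : 0 ≤ 1 - gw f γ) e.le (by ring)
    simpa [Gh] using this

lemma Gh_Y {k : ℝ} {f f' φ : ℝ → ℝ} (H : FH k f f' φ) {γ : ZZ} (hγ : γ ∈ R2) {t : ℝ} (h0 : 0 ≤ t) (h1 : t ≤ 1) :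
    f (gx t γ) * (Gh f t γ).2 = (1 - gw f γ) * (f (gx t γ) * gh t γ) + gw f γ * gy f t γ := by
  rcases (om_nonneg (gdx γ) (gdy f γ)).eq_or_lt with e | e
  · have e : gw f γ = 0 := e.symm
    simp only [Gh, e]; ring
  · have e : 0 < gw f γ := e
    have e' := H.gy_le hγ h0 h1 e
    have hn := H.gy_nonneg hγ h0 h1
    have : f (gx t γ) * (gy f t γ / f (gx t γ)) = gy f t γ := by
      rcases (H.f0 (gx t γ)).eq_or_lt with z | z
      · rw [← z] at e' ⊢; rw [zero_mul]; exact le_antisymm hn e'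
      · field_simp
    simp only [Gh]
    calc _ = (1 - gw f γ) * (f (gx t γ) * gh t γ) + gw f γ * (f (gx t γ) * (gy f t γ / f (gx t γ))) := by ring
      _ = _ := by rw [this]

lemma Gh_diff {k : ℝ} {f f' φ : ℝ → ℝ} (H : FH k f f' φ) {γ : ZZ} (hγ : γ ∈ R2) {s t : ℝ} (h0 : 0 ≤ t) (h1 : t ≤ 1) (s0 : 0 ≤ s) (s1 : s ≤ 1) :
    |f (gx s γ) * (Gh f s γ).2 - f (gx t γ) * (Gh f t γ).2| ≤
      |s - t| * (|gdy f γ| + (1 - gw f γ) * (2 * k * |gdx γ|)) := by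
  rw [H.Gh_Y hγ h0 h1, H.Gh_Y hγ s0 s1]
  have l0 : |f γ.1.1 - f (gx s γ)| ≤ k * (s * |gdx γ|) := H.lip0 s γ.1.1 γ.2.1 s0
  have l1 : |f γ.2.1 - f (gx s γ)| ≤ k * ((1 - s) * |gdx γ|) := H.lip1 s γ.1.1 γ.2.1 s1
  have a1 : |f (gx s γ) * (γ.2.2 - γ.1.2)| ≤ |gdy f γ| + k * |gdx γ| := by
    have e : f (gx s γ) * (γ.2.2 - γ.1.2) = gdy f γ - (f γ.2.1 - f (gx s γ)) * γ.2.2 + (f γ.1.1 - f (gx s γ)) * γ.1.2 := by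
      unfold gdy; ring
    rw [e]
    refine (abs_add_le _ _).trans ?_
    have b1 : |(f γ.2.1 - f (gx s γ)) * γ.2.2| ≤ k * ((1 - s) * |gdx γ|) * 1 := by
      rw [abs_mul, abs_of_nonneg hγ.2.2.1]
      have := hγ.2.2.2; have := hγ.2.2.1
      gcongr; exact (abs_nonneg _).trans l1
    have b0 : |(f γ.1.1 - f (gx s γ)) * γ.1.2| ≤ k * (s * |gdx γ|) * 1 := by
      rw [abs_mul, abs_of_nonneg hγ.1.2.1]
      have := hγ.1.2.2; have := hγ.1.2.1
      gcongr; exact (abs_nonneg _).trans l0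
    have := abs_sub (gdy f γ) ((f γ.2.1 - f (gx s γ)) * γ.2.2)
    linarith
  have hgh := H.gh_mem hγ h0 h1
  have a2 : |(f (gx s γ) - f (gx t γ)) * gh t γ| ≤ |s - t| * (k * |gdx γ|) := by
    have := H.lip (gx s γ) (gx t γ)
    have e : gx s γ - gx t γ = (s - t) * gdx γ := by unfold gx gdx; ring
    rw [e, abs_mul] at this
    rw [abs_mul, abs_of_nonneg hgh.1]
    calc _ ≤ (k * (|s - t| * |gdx γ|)) * 1 := by
            have h1 := hgh.1; have h2 := hgh.2; gcongr; exact (abs_nonneg _).trans this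
      _ = _ := by ring
  have e : (1 - gw f γ) * (f (gx s γ) * gh s γ) + gw f γ * gy f s γ - ((1 - gw f γ) * (f (gx t γ) * gh t γ) + gw f γ * gy f t γ)
      = (1 - gw f γ) * ((s - t) * (f (gx s γ) * (γ.2.2 - γ.1.2)) + (f (gx s γ) - f (gx t γ)) * gh t γ) + gw f γ * ((s - t) * gdy f γ) := by
    unfold gh gy gdy; ring
  rw [e]
  have w0 : 0 ≤ gw f γ := om_nonneg _ _
  have w1 : 0 ≤ 1 - gw f γ := sub_nonneg.2 (om_le_one _ _)
  refine (abs_add_le _ _).trans ?_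
  rw [abs_mul, abs_mul, abs_of_nonneg w0, abs_of_nonneg w1, abs_mul]
  have a3 : |(s - t) * (f (gx s γ) * (γ.2.2 - γ.1.2)) + (f (gx s γ) - f (gx t γ)) * gh t γ| ≤
      |s - t| * (|gdy f γ| + k * |gdx γ|) + |s - t| * (k * |gdx γ|) := by
    refine (abs_add_le _ _).trans (add_le_add ?_ a2)
    rw [abs_mul]; gcongr
  have := mul_le_mul_of_nonneg_left a3 w1
  linarith

lemma Gh_dist {k : ℝ} {f f' φ : ℝ → ℝ} (H : FH k f f' φ) {γ : ZZ} (hγ : γ ∈ R2) {s t : ℝ} (h0 : 0 ≤ t) (h1 : t ≤ 1) (s0 : 0 ≤ s) (s1 : s ≤ 1) :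
    dist (PP f (Gh f s γ)) (PP f (Gh f t γ)) ≤ |s - t| * dist (PP f γ.1) (PP f γ.2) := by
  rw [PP_dist, Prod.dist_eq, Real.dist_eq, Real.dist_eq]
  apply max_le
  · change |gx s γ - gx t γ| ≤ _
    have e : gx s γ - gx t γ = (s - t) * gdx γ := by unfold gx gdx; ring
    rw [e, abs_mul]; gcongr; exact le_max_left _ _
  · refine (H.Gh_diff hγ h0 h1 s0 s1).trans ?_
    gcongr
    exact om_bound k _ _ H.kpos H.kle

lemma PGh_zero {k : ℝ} {f f' φ : ℝ → ℝ} (H : FH k f f' φ) {γ : ZZ} (hγ : γ ∈ R2) : PP f (Gh f 0 γ) = PP f γ.1 := by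
  have := H.Gh_Y hγ le_rfl zero_le_one
  have e : gx 0 γ = γ.1.1 := by simp [gx]
  rw [e] at this
  refine Prod.ext e ?_
  change f (gx 0 γ) * _ = _
  rw [e, this]; simp [gh, gy, PP]; ring

lemma PGh_one {k : ℝ} {f f' φ : ℝ → ℝ} (H : FH k f f' φ) {γ : ZZ} (hγ : γ ∈ R2) : PP f (Gh f 1 γ) = PP f γ.2 := by
  have := H.Gh_Y hγ zero_le_one le_rfl
  have e : gx 1 γ = γ.2.1 := by simp [gx]
  rw [e] at this
  refine Prod.ext e ?_
  change f (gx 1 γ) * _ = _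
  rw [e, this]; simp [gh, gy, PP]; ring

/-- increment formula on a fibre -/
lemma Gh_incr {k : ℝ} {f f' φ : ℝ → ℝ} (H : FH k f f' φ) {γ γ' : ZZ} (e0 : γ.1.1 = γ'.1.1) (e1 : γ.2.1 = γ'.2.1) (t : ℝ) :
    (Gh f t γ').2 - (Gh f t γ).2 =
      ((1 - t) + gw f γ' * ((1 - t) * (f γ.1.1 / f (gx t γ) - 1))) * (γ'.1.2 - γ.1.2)
      + (t + gw f γ' * (t * (f γ.2.1 / f (gx t γ) - 1))) * (γ'.2.2 - γ.2.2)
      + (gw f γ' - gw f γ) * (gy f t γ / f (gx t γ) - gh t γ) := by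
  have ex : gx t γ' = gx t γ := by simp [gx, e0, e1]
  simp only [Gh, ex]
  unfold gy gh
  rw [← e0, ← e1]
  simp only [div_eq_mul_inv]
  ring

lemma beta_eq {k : ℝ} {f f' φ : ℝ → ℝ} (H : FH k f f' φ) {γ : ZZ} {t : ℝ} (hf : f (gx t γ) ≠ 0) : gy f t γ / f (gx t γ) - gh t γ =
    (1 - t) * (f γ.1.1 / f (gx t γ) - 1) * γ.1.2 + t * (f γ.2.1 / f (gx t γ) - 1) * γ.2.2 := by
  unfold gy gh; field_simp; ring

lemma alpha0 {k : ℝ} {f f' φ : ℝ → ℝ} (H : FH k f f' φ) {γ : ZZ} {t : ℝ} (h0 : 0 ≤ t) (hf : 0 < f (gx t γ)) :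
    |f γ.1.1 / f (gx t γ) - 1| ≤ t * (k * (|gdx γ| / f (gx t γ))) := by
  have l0 : |f γ.1.1 - f (gx t γ)| ≤ k * (t * |gdx γ|) := H.lip0 t γ.1.1 γ.2.1 h0
  have : f γ.1.1 / f (gx t γ) - 1 = (f γ.1.1 - f (gx t γ)) / f (gx t γ) := by field_simp
  rw [this, abs_div, abs_of_pos hf, div_le_iff₀ hf]
  refine l0.trans (le_of_eq ?_); field_simp

lemma alpha1 {k : ℝ} {f f' φ : ℝ → ℝ} (H : FH k f f' φ) {γ : ZZ} {t : ℝ} (h0 : t ≤ 1) (hf : 0 < f (gx t γ)) :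
    |f γ.2.1 / f (gx t γ) - 1| ≤ (1 - t) * (k * (|gdx γ| / f (gx t γ))) := by
  have l0 : |f γ.2.1 - f (gx t γ)| ≤ k * ((1 - t) * |gdx γ|) := H.lip1 t γ.1.1 γ.2.1 h0
  have : f γ.2.1 / f (gx t γ) - 1 = (f γ.2.1 - f (gx t γ)) / f (gx t γ) := by field_simp
  rw [this, abs_div, abs_of_pos hf, div_le_iff₀ hf]
  refine l0.trans (le_of_eq ?_); field_simp

lemma xi_le {k : ℝ} {f f' φ : ℝ → ℝ} (H : FH k f f' φ) {γ : ZZ} (hγ : γ ∈ R2) {t : ℝ} (h0 : 0 ≤ t) (h1 : t ≤ 1) (hf : 0 < f (gx t γ)) (hw : 0 < gw f γ) :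
    |gdx γ| / f (gx t γ) ≤ 3 := by
  rw [div_le_iff₀ hf]
  obtain ⟨hb, -⟩ := om_pos _ _ hw
  have l0 := (abs_le.1 (H.lip0 t γ.1.1 γ.2.1 h0)).2
  have l1 := (abs_le.1 (H.lip1 t γ.1.1 γ.2.1 h1)).2
  change f γ.1.1 - f (gx t γ) ≤ k * (t * |gdx γ|) at l0
  change f γ.2.1 - f (gx t γ) ≤ k * ((1 - t) * |gdx γ|) at l1
  have y0 : 0 ≤ f γ.1.1 * γ.1.2 := mul_nonneg (H.f0 _) hγ.1.2.1
  have y1 : 0 ≤ f γ.2.1 * γ.2.2 := mul_nonneg (H.f0 _) hγ.2.2.1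
  have y0' : f γ.1.1 * γ.1.2 ≤ f γ.1.1 := mul_le_of_le_one_right (H.f0 _) hγ.1.2.2
  have y1' : f γ.2.1 * γ.2.2 ≤ f γ.2.1 := mul_le_of_le_one_right (H.f0 _) hγ.2.2.2
  have ha := abs_nonneg (gdx γ)
  have m0 : k * (t * |gdx γ|) ≤ 1 / 1000 * (1 * |gdx γ|) := by
    have := H.kle; gcongr
  have m1 : k * ((1 - t) * |gdx γ|) ≤ 1 / 1000 * (1 * |gdx γ|) := by
    have := H.kle; have := H.kpos; gcongr; linarith
  have : |gdy f γ| ≤ f (gx t γ) + 1 / 1000 * |gdx γ| := by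
    unfold gdy; rw [abs_le]; constructor <;> linarith
  linarith

end FH

open MeasureTheory

namespace FH

lemma fib_mono_aux {k : ℝ} {f f' φ : ℝ → ℝ} (H : FH k f f' φ) (t δ0 δ1 ft f0 f1 w' w α0 α1 β a b b' ξ : ℝ) (ht0 : 0 < t) (ht1 : t < 1) (hδ0 : 0 ≤ δ0) (hδ1 : 0 ≤ δ1)
    (hft : 0 < ft) (ha : 0 < a) (hξ : ξ = a / ft) (hξ3 : ξ ≤ 3) (hw0 : 0 ≤ w') (hw1 : w' ≤ 1)
    (hα0 : |α0| ≤ t * (k * ξ)) (hα1 : |α1| ≤ (1 - t) * (k * ξ)) (hβ : |β| ≤ 2 * (t * (1 - t) * (k * ξ)))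
    (e0 : f0 = ft * (1 + α0)) (e1 : f1 = ft * (1 + α1)) (hb : b' - b = f1 * δ1 - f0 * δ0)
    (hw : |w' - w| ≤ 2 / a * |b' - b|) :
    1 / 2 * ((1 - t) * δ0 + t * δ1) ≤ ((1 - t) + w' * ((1 - t) * α0)) * δ0 + (t + w' * (t * α1)) * δ1 + (w' - w) * β := by
  have hk := H.kpos
  have hk' := H.kle
  have s1 : 0 < 1 - t := by linarith
  have hξ0 : 0 < ξ := by rw [hξ]; positivity
  have hε : k * ξ ≤ 3 / 1000 := by
    calc k * ξ ≤ 1 / 1000 * 3 := by gcongr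
      _ = _ := by norm_num
  have hε0 : 0 < k * ξ := by positivity
  have A0 : |α0| ≤ 3 / 1000 := hα0.trans (by nlinarith)
  have A1 : |α1| ≤ 3 / 1000 := hα1.trans (by nlinarith)
  have B0 : |w' * α0| ≤ 3 / 1000 := by
    rw [abs_mul, abs_of_nonneg hw0]
    calc w' * |α0| ≤ 1 * (3 / 1000) := by gcongr
      _ = _ := one_mul _
  have B1 : |w' * α1| ≤ 3 / 1000 := by
    rw [abs_mul, abs_of_nonneg hw0]
    calc w' * |α1| ≤ 1 * (3 / 1000) := by gcongr
      _ = _ := one_mul _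
  have F0 : f0 * δ0 ≤ ft * 1.003 * δ0 := by
    rw [e0]; gcongr; linarith [(abs_le.1 A0).2]
  have F1 : f1 * δ1 ≤ ft * 1.003 * δ1 := by
    rw [e1]; gcongr; linarith [(abs_le.1 A1).2]
  have F0' : 0 ≤ f0 * δ0 := by
    rw [e0]; have : 0 ≤ 1 + α0 := by linarith [(abs_le.1 A0).1]
    positivity
  have F1' : 0 ≤ f1 * δ1 := by
    rw [e1]; have : 0 ≤ 1 + α1 := by linarith [(abs_le.1 A1).1]
    positivity
  have hbb : |b' - b| ≤ ft * 1.003 * (δ0 + δ1) := by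
    rw [hb, abs_le]; constructor <;> linarith
  have hww : |(w' - w) * β| ≤ 0.1 * (t * (1 - t)) * (δ0 + δ1) := by
    rw [abs_mul]
    calc |w' - w| * |β| ≤ (2 / a * (ft * 1.003 * (δ0 + δ1))) * (2 * (t * (1 - t) * (k * ξ))) := by
          gcongr; exact hw.trans (by gcongr)
      _ = 4.012 * k * (t * (1 - t)) * (δ0 + δ1) := by rw [hξ]; field_simp; ring
      _ ≤ _ := by gcongr; linarith
  have := (abs_le.1 hww).1
  have T0 : t * (1 - t) * δ0 ≤ (1 - t) * δ0 := by
    have : 0 ≤ (1 - t) * δ0 := by positivity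
    nlinarith
  have T1 : t * (1 - t) * δ1 ≤ t * δ1 := by
    have : 0 ≤ t * δ1 := by positivity
    nlinarith
  have C0 := mul_le_mul_of_nonneg_right (abs_le.1 B0).1 (by positivity : 0 ≤ (1 - t) * δ0)
  have C1 := mul_le_mul_of_nonneg_right (abs_le.1 B1).1 (by positivity : 0 ≤ t * δ1)
  have D0 : 0 ≤ (1 - t) * δ0 := by positivity
  have D1 : 0 ≤ t * δ1 := by positivity
  linarith

lemma beta_bd {k : ℝ} {f f' φ : ℝ → ℝ} (H : FH k f f' φ) {γ : ZZ} (hγ : γ ∈ R2) {t : ℝ} (ht0 : 0 ≤ t) (ht1 : t ≤ 1) (hf : 0 < f (gx t γ)) :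
    |gy f t γ / f (gx t γ) - gh t γ| ≤ 2 * (t * (1 - t) * (k * (|gdx γ| / f (gx t γ)))) := by
  rw [H.beta_eq hf.ne']
  have a0 := H.alpha0 ht0 hf
  have a1 := H.alpha1 ht1 hf
  have s1 : 0 ≤ 1 - t := by linarith
  have hk := H.kpos
  have hx : 0 ≤ k * (|gdx γ| / f (gx t γ)) := by positivity
  refine (abs_add_le _ _).trans ?_
  have e0 : |(1 - t) * (f γ.1.1 / f (gx t γ) - 1) * γ.1.2| ≤ (1 - t) * (t * (k * (|gdx γ| / f (gx t γ)))) * 1 := by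
    rw [abs_mul, abs_mul, abs_of_nonneg s1, abs_of_nonneg hγ.1.2.1]
    have := hγ.1.2.2; have := hγ.1.2.1
    gcongr
  have e1 : |t * (f γ.2.1 / f (gx t γ) - 1) * γ.2.2| ≤ t * ((1 - t) * (k * (|gdx γ| / f (gx t γ)))) * 1 := by
    rw [abs_mul, abs_mul, abs_of_nonneg ht0, abs_of_nonneg hγ.2.2.1]
    have := hγ.2.2.2; have := hγ.2.2.1
    gcongr
  linarith

lemma fib_mono {k : ℝ} {f f' φ : ℝ → ℝ} (H : FH k f f' φ) {γ γ' : ZZ} (hγ : γ ∈ R2) (hγ' : γ' ∈ R2) (e0 : γ.1.1 = γ'.1.1) (e1 : γ.2.1 = γ'.2.1)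
    (hb : |gdy f γ| ≤ |gdx γ|) (hb' : |gdy f γ'| ≤ |gdx γ'|) {t : ℝ} (ht0 : 0 < t) (ht1 : t < 1)
    (h0 : γ.1.2 ≤ γ'.1.2) (h1 : γ.2.2 ≤ γ'.2.2) :
    1 / 2 * ((1 - t) * (γ'.1.2 - γ.1.2) + t * (γ'.2.2 - γ.2.2)) ≤ (Gh f t γ').2 - (Gh f t γ).2 := by
  rw [H.Gh_incr e0 e1 t]
  have s1 : 0 < 1 - t := by linarith
  have d0 := sub_nonneg.2 h0
  have d1 := sub_nonneg.2 h1
  have edx : gdx γ' = gdx γ := by simp [gdx, e0, e1]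
  have egx : gx t γ' = gx t γ := by simp [gx, e0, e1]
  by_cases hw : gw f γ = 0 ∧ gw f γ' = 0
  · rw [hw.1, hw.2]
    have : 0 ≤ (1 - t) * (γ'.1.2 - γ.1.2) + t * (γ'.2.2 - γ.2.2) := by positivity
    linarith
  · have key : 0 < f (gx t γ) ∧ |gdx γ| / f (gx t γ) ≤ 3 ∧ gdx γ ≠ 0 := by
      by_cases hw1 : gw f γ = 0
      · have hw2 : 0 < gw f γ' := lt_of_le_of_ne (om_nonneg _ _) (fun h => hw ⟨hw1, h.symm⟩)
        have p := H.gf_pos hγ' ht0 ht1 hw2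
        have q := H.xi_le hγ' ht0.le ht1.le p hw2
        have r := (om_pos _ _ hw2).2
        rw [egx] at p q; rw [edx] at q hb'
        refine ⟨p, q, fun h => r ?_⟩
        rw [h] at hb'; simpa using hb'
      · have hw2 : 0 < gw f γ := lt_of_le_of_ne (om_nonneg _ _) (fun h => hw1 h.symm)
        have p := H.gf_pos hγ ht0 ht1 hw2
        have r := (om_pos _ _ hw2).2
        refine ⟨p, H.xi_le hγ ht0.le ht1.le p hw2, fun h => r ?_⟩
        rw [h] at hb; simpa using hb
    obtain ⟨p, q, r⟩ := key
    refine H.fib_mono_aux t _ _ (f (gx t γ)) (f γ.1.1) (f γ.2.1) _ _ _ _ _ |gdx γ| (gdy f γ) (gdy f γ') _ ht0 ht1 d0 d1 p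
      (abs_pos.2 r) rfl q (om_nonneg _ _) (om_le_one _ _) (H.alpha0 ht0.le p) (H.alpha1 ht1.le p) (H.beta_bd hγ ht0.le ht1.le p)
      (by field_simp; ring) (by field_simp; ring) (by unfold gdy; rw [e0, e1]; ring) ?_
    have := om_lip (gdx γ) (gdy f γ) (gdy f γ') r hb (by rw [← edx]; exact hb')
    unfold gw; rw [edx]; exact this

lemma om_R2 {k : ℝ} {f f' φ : ℝ → ℝ} (H : FH k f f' φ) (a b σ : ℝ) (hσ : σ = 1 ∨ σ = -1) (h1 : |a| / 2 < σ * b) (h2 : σ * b < |a|) :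
    om a b = 2 * (σ * b) / |a| - 1 ∧ |b| = σ * b := by
  have hb : |b| = σ * b := by
    have : 0 < σ * b := by linarith [abs_nonneg a]
    rcases hσ with h | h
    · rw [h, one_mul] at this ⊢; exact abs_of_pos this
    · rw [h, neg_one_mul] at this ⊢; exact abs_of_neg (by linarith)
  have ha : 0 < |a| := by linarith
  refine ⟨?_, hb⟩
  rw [om_eq a b (abs_pos.1 ha) (by rw [hb]; exact h2.le), hb]
  apply max_eq_right
  rw [sub_nonneg, le_div_iff₀ ha]; linarith

/-- Exact increment on `R2`. -/
lemma R2_incr {k : ℝ} {f f' φ : ℝ → ℝ} (H : FH k f f' φ) {γ γ' : ZZ} (e0 : γ.1.1 = γ'.1.1) (e1 : γ.2.1 = γ'.2.1) (σ t : ℝ) (hσ : σ = 1 ∨ σ = -1)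
    (h1 : |gdx γ| / 2 < σ * gdy f γ) (h2 : σ * gdy f γ < |gdx γ|)
    (h1' : |gdx γ'| / 2 < σ * gdy f γ') (h2' : σ * gdy f γ' < |gdx γ'|) :
    (Gh f t γ').2 - (Gh f t γ).2 =
      ((1 - t) + gw f γ' * ((1 - t) * (f γ.1.1 / f (gx t γ) - 1)) -
        2 * σ * (gy f t γ / f (gx t γ) - gh t γ) / |gdx γ| * f γ.1.1) * (γ'.1.2 - γ.1.2)
      + (t + gw f γ' * (t * (f γ.2.1 / f (gx t γ) - 1)) +
        2 * σ * (gy f t γ / f (gx t γ) - gh t γ) / |gdx γ| * f γ.2.1) * (γ'.2.2 - γ.2.2) := by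
  rw [H.Gh_incr e0 e1 t]
  have edx : gdx γ' = gdx γ := by simp [gdx, e0, e1]
  have w1 : gw f γ = _ := (H.om_R2 _ _ σ hσ h1 h2).1
  have w2 : gw f γ' = _ := (H.om_R2 _ _ σ hσ h1' h2').1
  have : gw f γ' - gw f γ = 2 * σ / |gdx γ| * (f γ.2.1 * (γ'.2.2 - γ.2.2) - f γ.1.1 * (γ'.1.2 - γ.1.2)) := by
    rw [w1, w2, edx]; unfold gdy; rw [e0, e1]; ring
  rw [this]; ring

/-- slack at a point of `R2` -/
lemma R2_slack {k : ℝ} {f f' φ : ℝ → ℝ} (H : FH k f f' φ) {γ : ZZ} (hγ : γ ∈ R2) (σ t K : ℝ) (hσ : σ = 1 ∨ σ = -1) (ht0 : 0 < t) (ht1 : t < 1) (hK : 1 ≤ K)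
    (h1 : |gdx γ| / 2 < σ * gdy f γ) (h2 : σ * gdy f γ < |gdx γ|) (P0 P1 : ℝ)
    (hP0 : P0 = (1 - t) + gw f γ * ((1 - t) * (f γ.1.1 / f (gx t γ) - 1)) -
        2 * σ * (gy f t γ / f (gx t γ) - gh t γ) / |gdx γ| * f γ.1.1)
    (hP1 : P1 = t + gw f γ * (t * (f γ.2.1 / f (gx t γ) - 1)) +
        2 * σ * (gy f t γ / f (gx t γ) - gh t γ) / |gdx γ| * f γ.2.1) :
    0 < P0 ∧ 0 < P1 ∧ (1 - t) * Real.log ((1 - t) / P0) + t * Real.log (t / P1) +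
      K * (((Gh f t γ).2) ^ 2 - (1 - t) * γ.1.2 ^ 2 - t * γ.2.2 ^ 2) < 0 := by
  have hk := H.kpos
  obtain ⟨w1, hb⟩ := H.om_R2 _ _ σ hσ h1 h2
  have ha : 0 < |gdx γ| := by linarith
  have hwp : 0 < gw f γ := by
    change 0 < om _ _
    rw [w1, sub_pos, lt_div_iff₀ ha]; linarith
  have p := H.gf_pos hγ ht0 ht1 hwp
  have q := H.xi_le hγ ht0.le ht1.le p hwp
  set ft := f (gx t γ) with hft
  have s1 : 0 < 1 - t := by linarith
  have g0 := H.gap0 t γ.1.1 γ.2.1 ht0.le ht1.le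
  have g1 := H.gap1 t γ.1.1 γ.2.1 ht0.le ht1.le
  change ft ≤ _ at g0
  change _ ≤ ft + _ at g1
  have hκ : (1 - t) * (f γ.1.1 / ft - 1) + t * (f γ.2.1 / ft - 1) = ((1 - t) * f γ.1.1 + t * f γ.2.1 - ft) / ft := by
    field_simp; ring
  have hft2 : ft ≤ 2 * k := H.le2k _ (H.gx_mem hγ ht0.le ht1.le).2
  have hy : (1 + (f γ.2.1 / ft - 1)) * γ.2.2 - (1 + (f γ.1.1 / ft - 1)) * γ.1.2 = gdy f γ / ft := by
    unfold gdy; field_simp; ring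
  have := R2_core k t (|gdx γ| / ft) (f γ.1.1 / ft - 1) (f γ.2.1 / ft - 1) γ.1.2 γ.2.2 K σ H.kpos H.kle ht0 ht1
    (by positivity) q (H.alpha0 ht0.le p) (H.alpha1 ht1.le p) hγ.1.2.1 hγ.1.2.2 hγ.2.2.1 hγ.2.2.2
    (by rw [hκ]; exact div_nonneg (by linarith) p.le)
    (by
      rw [hκ, div_le_iff₀ p]
      have e : t * (1 - t) * (k * (|gdx γ| / ft) ^ 2) * ft = t * (1 - t) * (gdx γ ^ 2) * (k / ft) := by
        rw [div_pow, sq_abs]; field_simp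
      rw [e]
      have : 1 / 2 ≤ k / ft := by rw [le_div_iff₀ p]; linarith
      have e2 : (γ.1.1 - γ.2.1) ^ 2 = gdx γ ^ 2 := by unfold gdx; ring
      rw [e2] at g1
      have : t * (1 - t) * (gdx γ ^ 2) * (1 / 2) ≤ t * (1 - t) * (gdx γ ^ 2) * (k / ft) := by gcongr
      linarith)
    hσ
    (by rw [hy, ← mul_div_assoc, div_div, mul_comm ft 2, ← div_div]; gcongr)
    (by rw [hy, ← mul_div_assoc]; gcongr) hK (gw f γ) (gy f t γ / ft - gh t γ) P0 P1
    (by rw [hy]; change om _ _ = _; rw [w1]; field_simp)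
    (by rw [H.beta_eq p.ne'])
    (by rw [hP0]; field_simp; ring)
    (by rw [hP1]; field_simp; ring)
  obtain ⟨a1, a2, a3⟩ := this
  refine ⟨a1, a2, ?_⟩
  have e : (Gh f t γ).2 = (1 - t) * γ.1.2 + t * γ.2.2 + gw f γ * (gy f t γ / ft - gh t γ) := by
    simp only [Gh, gh]; ring
  rw [e]; exact a3

lemma vconv {k : ℝ} {f f' φ : ℝ → ℝ} (H : FH k f f' φ) (K x0 x1 y0 y1 : ℝ) (hK : 1 ≤ K) (hx1 : x0 ∈ Set.Icc (-1 : ℝ) 1) (hx2 : x1 ∈ Set.Icc (-1 : ℝ) 1)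
    (hD : |x1 - x0| ≤ |y1 - y0|) 
    (hfp : ∀ s ∈ Set.Icc (0 : ℝ) 1, 0 < f (x0 + s * (x1 - x0)))
    (hy0 : ∀ s ∈ Set.Icc (0 : ℝ) 1, 0 ≤ y0 + s * (y1 - y0))
    (hy1 : ∀ s ∈ Set.Icc (0 : ℝ) 1, y0 + s * (y1 - y0) ≤ f (x0 + s * (x1 - x0))) :
    ConvexOn ℝ (Set.Icc (0 : ℝ) 1) (fun s => Real.log (f (x0 + s * (x1 - x0))) +
      K * ((y0 + s * (y1 - y0)) / f (x0 + s * (x1 - x0))) ^ 2) := by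
  set L := x1 - x0 with hL
  set D := y1 - y0 with hDD
  have hX : ∀ s, HasDerivAt (fun s => x0 + s * L) L s := fun s => by
    simpa using ((hasDerivAt_id s).mul_const L).const_add x0
  have hY : ∀ s, HasDerivAt (fun s => y0 + s * D) D s := fun s => by
    simpa using ((hasDerivAt_id s).mul_const D).const_add y0
  have hF : ∀ s, HasDerivAt (fun s => f (x0 + s * L)) (f' (x0 + s * L) * L) s := fun s => (H.df _).comp s (hX s)
  have hF' : ∀ s, HasDerivAt (fun s => f' (x0 + s * L) * L) (φ (x0 + s * L) * L * L) s := fun s =>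
    ((H.df' _).comp s (hX s)).mul_const L
  set F := fun s => f (x0 + s * L) with hFd
  set F' := fun s => f' (x0 + s * L) * L with hF'd
  set F2 := fun s => φ (x0 + s * L) * L * L with hF2d
  set w := fun s => (y0 + s * D) / F s with hwd
  have hw : ∀ s ∈ Set.Icc (0:ℝ) 1, HasDerivAt w ((D - w s * F' s) / F s) s := by
    intro s hs
    have hp : 0 < F s := hfp s hs
    refine ((hY s).div (hF s) hp.ne').congr_deriv ?_
    change (D * F s - (y0 + s * D) * F' s) / F s ^ 2 = _
    simp only [hwd]; field_simp
  have hv : ∀ s ∈ Set.Icc (0:ℝ) 1, HasDerivAt (fun s => Real.log (F s) + K * (w s) ^ 2)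
      ((F' s + 2 * K * (w s * (D - w s * F' s))) / F s) s := by
    intro s hs
    have hp : 0 < F s := hfp s hs
    refine (((hF s).log hp.ne').add (((hw s hs).pow 2).const_mul K)).congr_deriv ?_
    change F' s / F s + K * (_ * _ * ((D - w s * F' s) / F s)) = _
    field_simp; simp; ring
  have hv' : ∀ s ∈ Set.Icc (0:ℝ) 1, HasDerivAt (fun s => (F' s + 2 * K * (w s * (D - w s * F' s))) / F s)
      ((F2 s * F s - F' s ^ 2 + 2 * K * ((D - w s * F' s) * (D - 3 * (w s * F' s)) - w s ^ 2 * (F2 s * F s))) / F s ^ 2) s := by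
    intro s hs
    have hp : 0 < F s := hfp s hs
    have h1 := (hw s hs).mul (((hw s hs).mul (hF' s)).const_sub D)
    have h2 := ((hF' s).add (h1.const_mul (2 * K))).div (hF s) hp.ne'
    refine h2.congr_deriv ?_
    have e : (D - w s * F' s) = F s * ((D - w s * F' s) / F s) := by field_simp
    simp only [Pi.add_apply, Pi.mul_apply]
    generalize (D - w s * F' s) / F s = W at e ⊢
    rw [div_eq_div_iff (by positivity) (by positivity)]
    have e' : D = w s * F' s + F s * W := by linarith
    change ((F2 s + 2 * K * (W * (D - w s * F' s) + w s * -(W * F' s + w s * F2 s))) * F s -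
      (F' s + 2 * K * (w s * (D - w s * F' s))) * F' s) * F s ^ 2 = _
    rw [e']; ring
  apply convexOn_of_hasDerivWithinAt2_nonneg (convex_Icc 0 1)
    (f' := fun s => (F' s + 2 * K * (w s * (D - w s * F' s))) / F s)
    (f'' := fun s => (F2 s * F s - F' s ^ 2 + 2 * K * ((D - w s * F' s) * (D - 3 * (w s * F' s)) - w s ^ 2 * (F2 s * F s))) / F s ^ 2)
  · intro s hs; exact (hv s hs).continuousAt.continuousWithinAt
  · intro s hs; exact (hv s (interior_subset hs)).hasDerivWithinAt
  · intro s hs; exact (hv' s (interior_subset hs)).hasDerivWithinAt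
  · intro s hs
    replace hs := interior_subset hs
    have hp : 0 < F s := hfp s hs
    apply div_nonneg _ (by positivity)
    have hxs : x0 + s * L ≤ 1 := by
      have e : x0 + s * L = (1 - s) * x0 + s * x1 := by rw [hL]; ring
      rw [e]; nlinarith [hs.1, hs.2, hx1.2, hx2.2]
    have hF2k : F s ≤ 2 * k := H.le2k _ hxs
    have hw0 : 0 ≤ w s := div_nonneg (hy0 s hs) hp.le
    have hw1 : w s ≤ 1 := div_le_one_of_le₀ (hy1 s hs) hp.le
    have hk := H.kpos
    have hk' := H.kle
    have f1 : 0 ≤ F2 s := by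
      have : F2 s = φ (x0 + s * L) * L ^ 2 := by simp only [hF2d]; ring
      rw [this]; have := H.phi0 (x0 + s * L); positivity
    have hLD : L ^ 2 ≤ D ^ 2 := sq_le_sq.2 hD
    have f2 : F2 s ≤ D ^ 2 := by
      have : F2 s = φ (x0 + s * L) * L ^ 2 := by simp only [hF2d]; ring
      rw [this]
      calc _ ≤ 1 * L ^ 2 := by gcongr; exact H.phi1 _
        _ ≤ _ := by linarith
    have f3 : |F' s| ≤ k * |D| := by
      simp only [hF'd]; rw [abs_mul, abs_of_nonneg (H.fp0 _)]
      have := H.fpk (x0 + s * L)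
      gcongr
    have f3' : F' s ^ 2 ≤ k ^ 2 * D ^ 2 := by
      rw [← sq_abs (F' s), ← sq_abs D, ← mul_pow]; gcongr
    have f4 : 0 ≤ F2 s * F s := by positivity
    have f5 : F2 s * F s ≤ D ^ 2 * (2 * k) := by gcongr
    have f6 : w s ^ 2 * (F2 s * F s) ≤ 1 * (D ^ 2 * (2 * k)) := by
      gcongr; nlinarith
    have f7 : |w s * F' s| ≤ 1 * (k * |D|) := by
      rw [abs_mul, abs_of_nonneg hw0]; gcongr
    set u := w s * F' s with hu
    have f8 : D * u ≤ k * D ^ 2 := by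
      calc D * u ≤ |D| * |u| := by rw [← abs_mul]; exact le_abs_self _
        _ ≤ |D| * (1 * (k * |D|)) := by gcongr
        _ = _ := by rw [← sq_abs D]; ring
    have f9 : 0 ≤ D ^ 2 := sq_nonneg D
    have f10 : D ^ 2 * (1 / 2) ≤ (D - u) * (D - 3 * u) - w s ^ 2 * (F2 s * F s) := by
      have : (D - u) * (D - 3 * u) = D ^ 2 - 4 * (D * u) + 3 * u ^ 2 := by ring
      rw [this]
      have : k * D ^ 2 ≤ 1 / 1000 * D ^ 2 := by gcongr
      nlinarith [sq_nonneg u]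
    have f11 : k ^ 2 * D ^ 2 ≤ 1 * D ^ 2 := by gcongr; nlinarith
    have f12 : D ^ 2 ≤ 2 * K * ((D - u) * (D - 3 * u) - w s ^ 2 * (F2 s * F s)) := by
      calc D ^ 2 = 2 * 1 * (D ^ 2 * (1 / 2)) := by ring
        _ ≤ _ := by gcongr
    linarith

end FH

open MeasureTheory ProbabilityTheory

/-- lexicographic minimiser among couplings -/
lemma lex_min {E : Type*} [TopologicalSpace E] [MeasurableSpace E] [BorelSpace E] [SecondCountableTopology E]
    [T2Space E] [PolishSpace E]
    (μ ν : Measure E) [IsProbabilityMeasure μ] [IsProbabilityMeasure ν] (R : Set E) (hR : IsCompact R)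
    (hμ : μ Rᶜ = 0) (hν : ν Rᶜ = 0) (c s : E × E → NNReal) (hc : Continuous c) (hs : Continuous s) :
    ∃ π : Measure (E × E), π.map Prod.fst = μ ∧ π.map Prod.snd = ν ∧
      (∀ π' : Measure (E × E), π'.map Prod.fst = μ → π'.map Prod.snd = ν →
        ∫⁻ z, c z ∂π ≤ ∫⁻ z, c z ∂π') ∧
      (∀ π' : Measure (E × E), π'.map Prod.fst = μ → π'.map Prod.snd = ν →
        ∫⁻ z, c z ∂π' = ∫⁻ z, c z ∂π → ∫⁻ z, s z ∂π ≤ ∫⁻ z, s z ∂π') := by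
  have hRR : IsCompact (R ×ˢ R) := hR.prod hR
  obtain ⟨M, hM⟩ : ∃ M : NNReal, ∀ z ∈ R ×ˢ R, c z ≤ M ∧ s z ≤ M := by
    obtain ⟨M1, h1⟩ := hRR.bddAbove_image hc.continuousOn
    obtain ⟨M2, h2⟩ := hRR.bddAbove_image hs.continuousOn
    exact ⟨max M1 M2, fun z hz => ⟨(h1 ⟨z, hz, rfl⟩).trans (le_max_left _ _), (h2 ⟨z, hz, rfl⟩).trans (le_max_right _ _)⟩⟩
  have bdd : ∀ u : E × E → NNReal, ∀ x y, dist (min (u x) M) (min (u y) M) ≤ M := by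
    intro u x y
    rw [NNReal.dist_eq, abs_le]
    have h1 : ((min (u x) M : NNReal) : ℝ) ≤ M := NNReal.coe_le_coe.2 (min_le_right _ _)
    have h2 : ((min (u y) M : NNReal) : ℝ) ≤ M := NNReal.coe_le_coe.2 (min_le_right _ _)
    have h3 := (min (u x) M).coe_nonneg
    have h4 := (min (u y) M).coe_nonneg
    constructor <;> linarith
  let c' : BoundedContinuousFunction (E × E) NNReal :=
    BoundedContinuousFunction.mkOfBound ⟨fun z => min (c z) M, hc.min continuous_const⟩ M (bdd c)
  let s' : BoundedContinuousFunction (E × E) NNReal :=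
    BoundedContinuousFunction.mkOfBound ⟨fun z => min (s z) M, hs.min continuous_const⟩ M (bdd s)
  have hRm : MeasurableSet R := hR.isClosed.measurableSet
  have conc : ∀ π' : Measure (E × E), π'.map Prod.fst = μ → π'.map Prod.snd = ν → π' (R ×ˢ R)ᶜ = 0 := by
    intro π' h1 h2
    have e : (R ×ˢ R)ᶜ = Prod.fst ⁻¹' Rᶜ ∪ Prod.snd ⁻¹' Rᶜ := by
      ext z; simp [Set.mem_prod]; tauto
    rw [e, measure_union_null_iff]
    rw [← h1, Measure.map_apply measurable_fst hRm.compl] at hμ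
    rw [← h2, Measure.map_apply measurable_snd hRm.compl] at hν
    exact ⟨hμ, hν⟩
  have ce : ∀ π' : Measure (E × E), π'.map Prod.fst = μ → π'.map Prod.snd = ν → ∫⁻ z, c' z ∂π' = ∫⁻ z, c z ∂π' := by
    intro π' h1 h2
    apply lintegral_congr_ae
    filter_upwards [measure_eq_zero_iff_ae_notMem.1 (conc π' h1 h2)] with z hz
    rw [Set.notMem_compl_iff] at hz
    change ((min (c z) M : NNReal) : ENNReal) = c z
    rw [min_eq_left (hM z hz).1]
  have se : ∀ π' : Measure (E × E), π'.map Prod.fst = μ → π'.map Prod.snd = ν → ∫⁻ z, s' z ∂π' = ∫⁻ z, s z ∂π' := by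
    intro π' h1 h2
    apply lintegral_congr_ae
    filter_upwards [measure_eq_zero_iff_ae_notMem.1 (conc π' h1 h2)] with z hz
    rw [Set.notMem_compl_iff] at hz
    change ((min (s z) M : NNReal) : ENNReal) = s z
    rw [min_eq_left (hM z hz).2]
  have prob : ∀ π' : Measure (E × E), π'.map Prod.fst = μ → IsProbabilityMeasure π' := by
    intro π' h
    constructor
    rw [← Set.preimage_univ (f := Prod.fst), ← Measure.map_apply measurable_fst MeasurableSet.univ, h]
    exact measure_univ
  let μF : FiniteMeasure E := ⟨μ, inferInstance⟩
  let νF : FiniteMeasure E := ⟨ν, inferInstance⟩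
  let S : Set (FiniteMeasure (E × E)) := {π | π.mass ≤ 1 ∧ π (R ×ˢ R)ᶜ = 0} ∩ {π | π.map Prod.fst = μF ∧ π.map Prod.snd = νF}
  have hSc : IsCompact S := by
    apply (isCompact_setOfPred_finiteMeasure_le_of_isCompact 1 hRR).inter_right
    exact (isClosed_eq (FiniteMeasure.continuous_map continuous_fst) continuous_const).inter
      (isClosed_eq (FiniteMeasure.continuous_map continuous_snd) continuous_const)
  have memS : ∀ π' : Measure (E × E), π'.map Prod.fst = μ → π'.map Prod.snd = ν →
      ∃ p : FiniteMeasure (E × E), p ∈ S ∧ (p : Measure (E × E)) = π' := by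
    intro π' h1 h2
    have := prob π' h1
    refine ⟨⟨π', inferInstance⟩, ⟨⟨?_, ?_⟩, ?_, ?_⟩, rfl⟩
    · have e := FiniteMeasure.ennreal_mass (μ := (⟨π', inferInstance⟩ : FiniteMeasure (E × E)))
      rw [← ENNReal.coe_le_coe, e]; exact (prob_le_one (μ := π') (s := Set.univ))
    · have := conc π' h1 h2
      simp [FiniteMeasure.null_iff_toMeasure_null, this]
    · apply Subtype.ext; exact h1
    · apply Subtype.ext; exact h2
  have Smar : ∀ p ∈ S, (p : Measure (E × E)).map Prod.fst = μ ∧ (p : Measure (E × E)).map Prod.snd = ν := by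
    rintro p ⟨-, h1, h2⟩
    exact ⟨congrArg Subtype.val h1, congrArg Subtype.val h2⟩
  have hne : S.Nonempty := by
    obtain ⟨p, hp, -⟩ := memS (μ.prod ν) (by simp) (by simp)
    exact ⟨p, hp⟩
  obtain ⟨p0, hp0, hmin0⟩ := hSc.exists_isMinOn hne (FiniteMeasure.continuous_testAgainstNN_eval c').continuousOn
  let S1 := S ∩ {p | p.testAgainstNN c' = p0.testAgainstNN c'}
  have hS1 : IsCompact S1 := hSc.inter_right (isClosed_eq (FiniteMeasure.continuous_testAgainstNN_eval c') continuous_const)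
  obtain ⟨p1, hp1, hmin1⟩ := hS1.exists_isMinOn ⟨p0, hp0, rfl⟩ (FiniteMeasure.continuous_testAgainstNN_eval s').continuousOn
  obtain ⟨m1, m2⟩ := Smar p1 hp1.1
  have p1c : ∫⁻ z, c z ∂(p1 : Measure (E × E)) = p0.testAgainstNN c' := by
    rw [← ce _ m1 m2, ← FiniteMeasure.testAgainstNN_coe_eq]
    exact congrArg _ hp1.2
  refine ⟨p1, m1, m2, ?_, ?_⟩
  · intro π' h1 h2
    obtain ⟨p, hp, rfl⟩ := memS π' h1 h2
    rw [p1c, ← ce _ h1 h2, ← FiniteMeasure.testAgainstNN_coe_eq, ENNReal.coe_le_coe]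
    exact hmin0 hp
  · intro π' h1 h2 h3
    obtain ⟨p, hp, rfl⟩ := memS π' h1 h2
    rw [← se _ h1 h2, ← se _ m1 m2, ← FiniteMeasure.testAgainstNN_coe_eq, ← FiniteMeasure.testAgainstNN_coe_eq, ENNReal.coe_le_coe]
    apply hmin1
    refine ⟨hp, ?_⟩
    rw [p1c, ← ce _ h1 h2, ← FiniteMeasure.testAgainstNN_coe_eq, ENNReal.coe_inj] at h3
    exact h3

/-- lifting couplings -/
lemma lift_coupling {A B : Type*} [MeasurableSpace A] [MeasurableSpace B] [StandardBorelSpace B] [Nonempty B]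
    [MeasurableEq A] (P : B → A) (hP : Measurable P) (μ ν : Measure B) [IsProbabilityMeasure μ] [IsProbabilityMeasure ν]
    (π : Measure (A × A)) (h1 : π.map Prod.fst = μ.map P) (h2 : π.map Prod.snd = ν.map P) :
    ∃ π' : Measure (B × B), π'.map Prod.fst = μ ∧ π'.map Prod.snd = ν ∧ π'.map (fun z => (P z.1, P z.2)) = π := by
  have hpr : IsProbabilityMeasure π := by
    constructor
    rw [← Set.preimage_univ (f := Prod.fst), ← Measure.map_apply measurable_fst MeasurableSet.univ, h1,
      Measure.map_apply hP MeasurableSet.univ]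
    simp
  let κ := condDistrib id P μ
  let η := condDistrib id P ν
  let Θ := π ⊗ₘ (κ ∥ₖ η)
  have m1 : Θ.map (fun w => (w.1.1, w.2.1)) = μ.map (fun b => (P b, b)) := by
    have e : (μ.map P) ⊗ₘ κ = μ.map (fun b => (P b, b)) := compProd_map_condDistrib aemeasurable_id
    rw [← e, ← h1]
    ext S hS
    rw [Measure.map_apply (by fun_prop) hS, Measure.compProd_apply (by measurability), Measure.compProd_apply hS,
      lintegral_map (Kernel.measurable_kernel_prodMk_left hS) measurable_fst]
    apply lintegral_congr
    intro a
    rw [Kernel.parallelComp_apply]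
    have : (Prod.mk a ⁻¹' ((fun w : (A × A) × (B × B) => (w.1.1, w.2.1)) ⁻¹' S)) = (Prod.mk a.1 ⁻¹' S) ×ˢ Set.univ := by
      ext b; simp
    rw [this, Measure.prod_prod]; simp
  have m2 : Θ.map (fun w => (w.1.2, w.2.2)) = ν.map (fun b => (P b, b)) := by
    have e : (ν.map P) ⊗ₘ η = ν.map (fun b => (P b, b)) := compProd_map_condDistrib aemeasurable_id
    rw [← e, ← h2]
    ext S hS
    rw [Measure.map_apply (by fun_prop) hS, Measure.compProd_apply (by measurability), Measure.compProd_apply hS,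
      lintegral_map (Kernel.measurable_kernel_prodMk_left hS) measurable_snd]
    apply lintegral_congr
    intro a
    rw [Kernel.parallelComp_apply]
    have : (Prod.mk a ⁻¹' ((fun w : (A × A) × (B × B) => (w.1.2, w.2.2)) ⁻¹' S)) = Set.univ ×ˢ (Prod.mk a.2 ⁻¹' S) := by
      ext b; simp
    rw [this, Measure.prod_prod]; simp
  have hD : MeasurableSet {w : A × B | P w.2 ≠ w.1} :=
    (measurableSet_eq_fun (hP.comp measurable_snd) measurable_fst).compl
  have a1 : ∀ᵐ w ∂Θ, P w.2.1 = w.1.1 := by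
    have : Θ.map (fun w => (w.1.1, w.2.1)) {w : A × B | P w.2 ≠ w.1} = 0 := by
      rw [m1, Measure.map_apply (by fun_prop) hD]; simp
    rw [Measure.map_apply (by fun_prop) hD] at this
    rw [ae_iff]; exact this
  have a2 : ∀ᵐ w ∂Θ, P w.2.2 = w.1.2 := by
    have : Θ.map (fun w => (w.1.2, w.2.2)) {w : A × B | P w.2 ≠ w.1} = 0 := by
      rw [m2, Measure.map_apply (by fun_prop) hD]; simp
    rw [Measure.map_apply (by fun_prop) hD] at this
    rw [ae_iff]; exact this
  refine ⟨Θ.map Prod.snd, ?_, ?_, ?_⟩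
  · rw [Measure.map_map measurable_fst measurable_snd]
    have : Θ.map (Prod.fst ∘ Prod.snd) = (Θ.map (fun w => (w.1.1, w.2.1))).map Prod.snd := by
      rw [Measure.map_map measurable_snd (by fun_prop)]; rfl
    rw [this, m1, Measure.map_map measurable_snd (by fun_prop)]
    exact Measure.map_id
  · rw [Measure.map_map measurable_snd measurable_snd]
    have : Θ.map (Prod.snd ∘ Prod.snd) = (Θ.map (fun w => (w.1.2, w.2.2))).map Prod.snd := by
      rw [Measure.map_map measurable_snd (by fun_prop)]; rfl
    rw [this, m2, Measure.map_map measurable_snd (by fun_prop)]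
    exact Measure.map_id
  · rw [Measure.map_map (by fun_prop) measurable_snd]
    have : Θ.map ((fun z : B × B => (P z.1, P z.2)) ∘ Prod.snd) = Θ.map Prod.fst := by
      apply Measure.map_congr
      filter_upwards [a1, a2] with w h1 h2
      exact Prod.ext h1 h2
    rw [this]
    exact Measure.fst_compProd _ _

open MeasureTheory ProbabilityTheory

noncomputable def Dn (K : ℝ) (p : ℝ × ℝ) : ℝ := Real.exp (-K * p.2 ^ 2)
noncomputable def lam (K : ℝ) : Measure (ℝ × ℝ) :=
  (volume.restrict RR).withDensity (fun p => ENNReal.ofReal (Dn K p))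

lemma Dn_pos (K : ℝ) (p : ℝ × ℝ) : 0 < Dn K p := Real.exp_pos _
lemma Dn_cont (K : ℝ) : Continuous (Dn K) := by unfold Dn; fun_prop
lemma RR_compact : IsCompact RR := isCompact_Icc.prod isCompact_Icc
lemma RR_meas : MeasurableSet RR := RR_compact.measurableSet

lemma lam_apply (K : ℝ) {E : Set (ℝ × ℝ)} (hE : MeasurableSet E) :
    lam K E = ∫⁻ p in E ∩ RR, ENNReal.ofReal (Dn K p) := by
  rw [lam, withDensity_apply _ hE, Measure.restrict_restrict hE]

lemma lam_RRc (K : ℝ) : lam K RRᶜ = 0 := by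
  rw [lam_apply K RR_meas.compl]; simp

instance lam_fin (K : ℝ) : IsFiniteMeasure (lam K) := by
  constructor
  rw [lam_apply K MeasurableSet.univ, Set.univ_inter]
  have : IsCompact RR := RR_compact
  have h := ((Dn_cont K).continuousOn.integrableOn_compact (μ := volume) this)
  exact h.lintegral_lt_top

/-- a change of variables chart -/
structure IsChart (Φ : ℝ × ℝ → ℝ × ℝ) (J : ℝ × ℝ → ℝ) : Prop where
  cont : Continuous Φ
  contJ : Continuous J
  cov : ∀ E : Set (ℝ × ℝ), MeasurableSet E → (∀ p ∈ E, 0 < J p) →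
    volume (Φ '' E) = ∫⁻ p in E, ENNReal.ofReal (J p)

lemma chart_id : IsChart id (fun _ => 1) := by
  refine ⟨continuous_id, continuous_const, ?_⟩
  intro E hE _
  simp

lemma chart1 {Φ J} (h : IsChart Φ J) (K : ℝ) {E W : Set (ℝ × ℝ)} (hE : MeasurableSet E) (hW : MeasurableSet W)
    (hJ : ∀ p ∈ E, 0 < J p) (d : ℝ) (hd0 : 0 ≤ d) (hd : ∀ p ∈ E, Dn K p ≤ d * J p) :
    lam K (E ∩ Φ ⁻¹' W) ≤ ENNReal.ofReal d * volume W := by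
  have hm : MeasurableSet (E ∩ Φ ⁻¹' W) := hE.inter (h.cont.measurable hW)
  rw [lam_apply K hm]
  calc ∫⁻ p in E ∩ Φ ⁻¹' W ∩ RR, ENNReal.ofReal (Dn K p)
      ≤ ∫⁻ p in E ∩ Φ ⁻¹' W, ENNReal.ofReal (Dn K p) := lintegral_mono_set Set.inter_subset_left
    _ ≤ ∫⁻ p in E ∩ Φ ⁻¹' W, ENNReal.ofReal d * ENNReal.ofReal (J p) := by
        apply setLIntegral_mono' hm
        intro p hp
        rw [← ENNReal.ofReal_mul hd0]
        exact ENNReal.ofReal_le_ofReal (hd p hp.1)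
    _ = ENNReal.ofReal d * ∫⁻ p in E ∩ Φ ⁻¹' W, ENNReal.ofReal (J p) :=
        lintegral_const_mul _ (h.contJ.measurable.ennreal_ofReal)
    _ = ENNReal.ofReal d * volume (Φ '' (E ∩ Φ ⁻¹' W)) := by rw [h.cov _ hm (fun p hp => hJ p hp.1)]
    _ ≤ _ := by
        gcongr
        rintro _ ⟨p, hp, rfl⟩; exact hp.2

lemma chart2 {Φ J} (h : IsChart Φ J) (K : ℝ) {E : Set (ℝ × ℝ)} (hE : MeasurableSet E) (hER : E ⊆ RR)
    (hJ : ∀ p ∈ E, 0 < J p) (d : ℝ) (hd0 : 0 ≤ d) (hd : ∀ p ∈ E, J p ≤ d * Dn K p) :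
    volume (Φ '' E) ≤ ENNReal.ofReal d * lam K E := by
  rw [lam_apply K hE, Set.inter_eq_left.2 hER, h.cov E hE hJ, ← lintegral_const_mul _ ((Dn_cont K).measurable.ennreal_ofReal)]
  apply setLIntegral_mono' hE
  intro p hp
  rw [← ENNReal.ofReal_mul hd0]
  exact ENNReal.ofReal_le_ofReal (hd p hp)

namespace FH

/-- the linear charts composed with PP -/
def Ch (f : ℝ → ℝ) (a b c e : ℝ) (p : ℝ × ℝ) : ℝ × ℝ :=
  (a * p.1 + b * (f p.1 * p.2), c * p.1 + e * (f p.1 * p.2))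

noncomputable def ChD (f f' : ℝ → ℝ) (a b c e : ℝ) (p : ℝ × ℝ) : ℝ × ℝ →L[ℝ] ℝ × ℝ :=
  (Matrix.toLin (.finTwoProd ℝ) (.finTwoProd ℝ)
    !![a + b * (f' p.1 * p.2), b * f p.1; c + e * (f' p.1 * p.2), e * f p.1]).toContinuousLinearMap

lemma ChD_det (a b c e : ℝ) (p : ℝ × ℝ) : (ChD f f' a b c e p).det = (a * e - b * c) * f p.1 := by
  unfold ChD
  simp only [LinearMap.det_toContinuousLinearMap, LinearMap.det_toLin, Matrix.det_fin_two_of]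
  ring


lemma Ch_deriv {k : ℝ} {f f' φ : ℝ → ℝ} (H : FH k f f' φ) (a b c e : ℝ) (p : ℝ × ℝ) : HasFDerivAt (Ch f a b c e) (ChD f f' a b c e p) p := by
  unfold ChD
  rw [Matrix.toLin_finTwoProd_toContinuousLinearMap]
  have hf1 : HasFDerivAt (Prod.fst : ℝ × ℝ → ℝ) (ContinuousLinearMap.fst ℝ ℝ ℝ) p := hasFDerivAt_fst
  have hf2 : HasFDerivAt (Prod.snd : ℝ × ℝ → ℝ) (ContinuousLinearMap.snd ℝ ℝ ℝ) p := hasFDerivAt_snd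
  have h1 : HasFDerivAt (fun p : ℝ × ℝ => f p.1 * p.2) _ p :=
    ((H.df p.1).comp_hasFDerivAt p hf1).mul hf2
  have h2 : HasFDerivAt (Ch f a b c e) _ p :=
    ((hf1.const_mul a).add (h1.const_mul b)).prodMk ((hf1.const_mul c).add (h1.const_mul e))
  convert! h2 using 2
  · ext <;> simp [mul_comm]
  · ext <;> simp [mul_comm]

lemma Ch_inj {k : ℝ} {f f' φ : ℝ → ℝ} (H : FH k f f' φ) (a b c e : ℝ) (hdet : a * e - b * c ≠ 0) : Set.InjOn (Ch f a b c e) {p | 0 < f p.1} := by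
  rintro ⟨x, h⟩ hp ⟨x', h'⟩ hp' heq
  simp only [Ch, Prod.mk.injEq] at heq
  simp only [Set.mem_setOf_eq] at hp hp'
  obtain ⟨e1, e2⟩ := heq
  have hx : x = x' := by
    have : (a * e - b * c) * (x - x') = 0 := by linear_combination e * e1 - b * e2
    rcases mul_eq_zero.1 this with h | h
    · exact absurd h hdet
    · linarith
  subst hx
  have : (a * e - b * c) * (f x * (h - h')) = 0 := by linear_combination a * e2 - c * e1
  rcases mul_eq_zero.1 this with h | h
  · exact absurd h hdet
  · rcases mul_eq_zero.1 h with h | h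
    · exact absurd h hp.ne'
    · rw [sub_eq_zero.1 h]

lemma Ch_lint {k : ℝ} {f f' φ : ℝ → ℝ} (H : FH k f f' φ) (a b c e : ℝ) (hdet : |a * e - b * c| = 1) {E : Set (ℝ × ℝ)} (hE : MeasurableSet E)
    (hJ : ∀ p ∈ E, 0 < f p.1) (g : ℝ × ℝ → ENNReal) :
    ∫⁻ z in Ch f a b c e '' E, g z = ∫⁻ p in E, ENNReal.ofReal (f p.1) * g (Ch f a b c e p) := by
  have hd0 : a * e - b * c ≠ 0 := by intro h; rw [h] at hdet; simp at hdet
  rw [lintegral_image_eq_lintegral_abs_det_fderiv_mul volume hE (fun p _ => (H.Ch_deriv a b c e p).hasFDerivWithinAt)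
    ((H.Ch_inj a b c e hd0).mono hJ)]
  congr 1
  ext p
  rw [ChD_det, abs_mul, hdet, one_mul, abs_of_nonneg (H.f0 _)]

lemma chart_Ch {k : ℝ} {f f' φ : ℝ → ℝ} (H : FH k f f' φ) (a b c e : ℝ) (hdet : |a * e - b * c| = 1) : IsChart (Ch f a b c e) (fun p => f p.1) := by
  have := H.cont
  refine ⟨by unfold Ch; fun_prop, by fun_prop, ?_⟩
  intro E hE hJ
  have := H.Ch_lint a b c e hdet hE hJ 1
  simpa using this

end FH

open MeasureTheory ProbabilityTheory

lemma PP_eq_Ch (f : ℝ → ℝ) : PP f = FH.Ch f 1 0 0 1 := by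
  ext p <;> simp [PP, FH.Ch]

namespace FH

lemma PP_cont {k : ℝ} {f f' φ : ℝ → ℝ} (H : FH k f f' φ) : Continuous (PP f) := by
  have := H.cont
  unfold PP; fun_prop

lemma m0_eq {k : ℝ} {f f' φ : ℝ → ℝ} (H : FH k f f' φ) (K : ℝ) (X₀ : Set (ℝ × ℝ)) (hX : X₀ = {p : ℝ × ℝ | p.1 ∈ Set.Icc (-1 : ℝ) 1 ∧ 0 ≤ p.2 ∧ p.2 ≤ f p.1}) :
    (ENNReal.ofReal (∫ y in (0 : ℝ)..1, Real.exp (-K * y ^ 2))) •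
            ((Measure.hausdorffMeasure 1 : Measure (ℝ × ℝ)).restrict
              {p : ℝ × ℝ | p.2 = 0 ∧ p.1 ∈ Set.Icc (-1 : ℝ) 1 ∧ f p.1 = 0}) +
          volume.withDensity
            (Set.indicator {p : ℝ × ℝ | p ∈ X₀ ∧ 0 < f p.1}
              fun z => ENNReal.ofReal ((1 / f z.1) * Real.exp (-K * (z.2 / f z.1) ^ 2)))
      = (lam K).map (PP f) := by
  have hc := H.cont
  have hP := H.PP_cont
  have hXm : MeasurableSet {p : ℝ × ℝ | p ∈ X₀ ∧ 0 < f p.1} := by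
    rw [hX]
    apply MeasurableSet.inter
    · apply IsClosed.measurableSet
      apply (isClosed_Icc.preimage continuous_fst).inter
      exact (isClosed_le continuous_const continuous_snd).inter (isClosed_le continuous_snd (hc.comp continuous_fst))
    · exact (isOpen_lt continuous_const (hc.comp continuous_fst)).measurableSet
  have hZm : MeasurableSet {p : ℝ × ℝ | f p.1 = 0} := (isClosed_eq (hc.comp continuous_fst) continuous_const).measurableSet
  ext S hS
  have hPS : MeasurableSet (PP f ⁻¹' S) := hP.measurable hS
  rw [Measure.map_apply hP.measurable hS, lam_apply K hPS,
    ← lintegral_inter_add_diff (μ := volume) (B := {p : ℝ × ℝ | f p.1 = 0}) _ (PP f ⁻¹' S ∩ RR) hZm,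
    Measure.add_apply, Measure.smul_apply, Measure.restrict_apply hS, withDensity_apply _ hS,
    lintegral_indicator hXm, Measure.restrict_restrict hXm]
  congr 1
  · let T : Set ℝ := {x | x ∈ Set.Icc (-1 : ℝ) 1 ∧ f x = 0 ∧ (x, (0:ℝ)) ∈ S}
    have hT : MeasurableSet T := by
      apply measurableSet_Icc.inter
      apply (isClosed_eq hc continuous_const).measurableSet.inter
      exact (by fun_prop : Measurable fun x : ℝ => (x, (0:ℝ))) hS
    have e1 : PP f ⁻¹' S ∩ RR ∩ {p | f p.1 = 0} = T ×ˢ Set.Icc 0 1 := by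
      ext ⟨x, h⟩
      simp only [PP, RR, T, Set.mem_inter_iff, Set.mem_preimage, Set.mem_prod, Set.mem_setOf_eq]
      constructor
      · rintro ⟨⟨h1, h2, h3⟩, h4⟩
        rw [h4, zero_mul] at h1
        exact ⟨⟨h2, h4, h1⟩, h3⟩
      · rintro ⟨⟨h2, h4, h1⟩, h3⟩
        refine ⟨⟨?_, h2, h3⟩, h4⟩
        rw [h4, zero_mul]; exact h1
    have e2 : S ∩ {p : ℝ × ℝ | p.2 = 0 ∧ p.1 ∈ Set.Icc (-1 : ℝ) 1 ∧ f p.1 = 0} = (fun x : ℝ => (x, (0:ℝ))) '' T := by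
      ext ⟨x, h⟩
      simp only [T, Set.mem_inter_iff, Set.mem_image, Set.mem_setOf_eq, Prod.mk.injEq]
      constructor
      · rintro ⟨h1, h2, h3, h4⟩
        subst h2
        exact ⟨x, ⟨h3, h4, h1⟩, rfl, rfl⟩
      · rintro ⟨_, ⟨h3, h4, h1⟩, rfl, rfl⟩
        exact ⟨h1, rfl, h3, h4⟩
    have hiso : Isometry (fun x : ℝ => (x, (0:ℝ))) := by
      apply Isometry.of_dist_eq
      intro x y
      simp [Prod.dist_eq]
    rw [e1, e2, hiso.hausdorffMeasure_image (Or.inl zero_le_one), hausdorffMeasure_real, Measure.volume_eq_prod,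
      ← Measure.prod_restrict, lintegral_prod _ ((Dn_cont K).measurable.ennreal_ofReal.aemeasurable)]
    simp only [Dn, lintegral_const, Measure.restrict_apply MeasurableSet.univ, Set.univ_inter]
    rw [intervalIntegral.integral_of_le zero_le_one, ← integral_Icc_eq_integral_Ioc, smul_eq_mul]
    congr 1
    apply ofReal_integral_eq_lintegral_ofReal
    · exact ContinuousOn.integrableOn_compact isCompact_Icc (by fun_prop)
    · exact Filter.Eventually.of_forall fun x => (Real.exp_pos _).le
  · have hEm : MeasurableSet ((PP f ⁻¹' S ∩ RR) \ {p | f p.1 = 0}) := (hPS.inter RR_meas).diff hZm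
    have hpos : ∀ p ∈ (PP f ⁻¹' S ∩ RR) \ {p | f p.1 = 0}, 0 < f p.1 := fun p hp =>
      lt_of_le_of_ne (H.f0 _) (Ne.symm hp.2)
    have e : {p : ℝ × ℝ | p ∈ X₀ ∧ 0 < f p.1} ∩ S = Ch f 1 0 0 1 '' ((PP f ⁻¹' S ∩ RR) \ {p | f p.1 = 0}) := by
      rw [← PP_eq_Ch, hX]
      ext ⟨x, y⟩
      constructor
      · rintro ⟨⟨⟨h1, h2, h3⟩, h4⟩, h5⟩
        have h6 : PP f (x, y / f x) = (x, y) := by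
          have : f x ≠ 0 := ne_of_gt h4
          simp only [PP]; congr 1; field_simp
        refine ⟨(x, y / f x), ⟨⟨?_, h1, ?_⟩, ne_of_gt h4⟩, h6⟩
        · rw [Set.mem_preimage, h6]; exact h5
        · exact ⟨div_nonneg h2 (H.f0 _), (div_le_one h4).2 h3⟩
      · rintro ⟨⟨x', h⟩, hp, he⟩
        have h0 : 0 < f x' := hpos _ hp
        have hp2 : (x', h) ∈ RR := hp.1.2
        have h5 := hp.1.1
        rw [Set.mem_preimage, he] at h5
        simp only [PP, Prod.mk.injEq] at he
        obtain ⟨rfl, rfl⟩ := he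
        refine ⟨⟨⟨hp2.1, mul_nonneg h0.le hp2.2.1, ?_⟩, h0⟩, h5⟩
        have := hp2.2.2
        simp only at this ⊢
        nlinarith
    rw [e, H.Ch_lint 1 0 0 1 (by norm_num) hEm hpos]
    apply setLIntegral_congr_fun hEm
    intro p hp
    have h0 := hpos p hp
    have : f p.1 ≠ 0 := h0.ne'
    simp only
    rw [← PP_eq_Ch, ← ENNReal.ofReal_mul h0.le]
    congr 1
    simp only [PP, Dn]
    rw [← mul_assoc, mul_one_div_cancel this, one_mul, mul_div_cancel_left₀ _ this]

end FH

open MeasureTheory ProbabilityTheory Topology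

lemma marg_bound {Z : Type*} [MeasurableSpace Z] {X : Type*} [MeasurableSpace X] (π : Measure Z) (g : Z → X) (hg : Measurable g)
    (l : Measure X) (r : X → ENNReal) (hr : Measurable r)
    (hm : π.map g = l.withDensity r) (A : Set Z) (β : ENNReal)
    (hA : ∀ γ ∈ A, r (g γ) ≤ β) (E : Set X) (hE : MeasurableSet E) :
    π (A ∩ g ⁻¹' E) ≤ β * l E := by
  have hm2 : MeasurableSet {p | r p ≤ β} := measurableSet_le hr measurable_const
  calc π (A ∩ g ⁻¹' E) ≤ π (g ⁻¹' (E ∩ {p | r p ≤ β})) := by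
        apply measure_mono
        rintro γ ⟨h1, h2⟩
        exact ⟨h2, hA γ h1⟩
    _ = ∫⁻ p in E ∩ {p | r p ≤ β}, r p ∂l := by
        rw [← Measure.map_apply hg (hE.inter hm2), hm, withDensity_apply _ (hE.inter hm2)]
    _ ≤ ∫⁻ p in E ∩ {p | r p ≤ β}, β ∂l := setLIntegral_mono' (hE.inter hm2) (fun p hp => hp.2)
    _ = β * l (E ∩ {p | r p ≤ β}) := by rw [setLIntegral_const]
    _ ≤ _ := by gcongr; exact Set.inter_subset_left

lemma local_lemma {Φ : ℝ × ℝ → ℝ × ℝ} {J : ℝ × ℝ → ℝ} (hch : IsChart Φ J) (K : ℝ) (π : Measure ZZ) [IsFiniteMeasure π]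
    (r0 r1 : ℝ × ℝ → ENNReal) (hr0 : Measurable r0) (hr1 : Measurable r1)
    (hm0 : π.map Prod.fst = (lam K).withDensity r0) (hm1 : π.map Prod.snd = (lam K).withDensity r1)
    (G : ZZ → ℝ × ℝ) (hG : Measurable G) (t : ℝ) (ht0 : 0 < t) (ht1 : t < 1) (S : Set ZZ) (γ₀ : ZZ)
    (hγ₀ : γ₀ ∈ S) (hGc : ContinuousOn G S) (hGR : ∀ γ ∈ S, G γ ∈ RR)
    (J0 : 0 < J γ₀.1) (J1 : 0 < J γ₀.2) (Jz : 0 < J (G γ₀))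
    (P0 P1 : ℝ) (hP0 : 0 < P0) (hP1 : 0 < P1)
    (hineq : ((1 - t) / P0) ^ (1 - t) * (t / P1) ^ t * ((Dn K γ₀.1 / J γ₀.1) ^ (1 - t) * (Dn K γ₀.2 / J γ₀.2) ^ t)
      ≤ Dn K (G γ₀) / J (G γ₀))
    (U₀ : Set ZZ) (hU₀ : U₀ ∈ 𝓝 γ₀)
    (hz : ∀ γ ∈ U₀ ∩ S, (Φ (G γ)).1 = (1 - t) * (Φ γ.1).1 + t * (Φ γ.2).1)
    (hmono : ∀ γ ∈ U₀ ∩ S, ∀ γ' ∈ U₀ ∩ S, 0 ≤ ((Φ γ.1).1 - (Φ γ'.1).1) * ((Φ γ.2).1 - (Φ γ'.2).1))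
    (hin : ∀ γ ∈ U₀ ∩ S, ∀ γ' ∈ U₀ ∩ S, (Φ γ.1).1 = (Φ γ'.1).1 → (Φ γ.2).1 = (Φ γ'.2).1 →
      (Φ (G γ)).2 ≤ (Φ (G γ')).2 →
      (Φ γ.1).2 ≤ (Φ γ'.1).2 ∧ (Φ γ.2).2 ≤ (Φ γ'.2).2 ∧
        P0 * ((Φ γ'.1).2 - (Φ γ.1).2) + P1 * ((Φ γ'.2).2 - (Φ γ.2).2) ≤ (Φ (G γ')).2 - (Φ (G γ)).2)
    (E : ℝ) (hE : 1 < E) :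
    ∃ U ∈ 𝓝 γ₀, ∀ β0 β1 : NNReal, ∀ A : Set ZZ, IsCompact A → A ⊆ U ∩ S →
      (∀ γ ∈ A, r0 γ.1 ≤ β0 ∧ r1 γ.2 ≤ β1) →
      π A ≤ ENNReal.ofReal E * ((β0 : ENNReal) ^ (1 - t) * (β1 : ENNReal) ^ t) * lam K (G '' A) := by
  obtain ⟨e, he1, hee⟩ : ∃ e : ℝ, 1 < e ∧ e * e = E :=
    ⟨Real.sqrt E, by rw [Real.lt_sqrt zero_le_one]; simpa using hE, Real.mul_self_sqrt (by linarith)⟩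
  have he0 : 0 < e := by linarith
  have ht1' : 0 < 1 - t := by linarith
  set d0 := Dn K γ₀.1 / J γ₀.1 with hd0
  set d1 := Dn K γ₀.2 / J γ₀.2 with hd1
  set dz := Dn K (G γ₀) / J (G γ₀) with hdz
  have d0p : 0 < d0 := div_pos (Dn_pos _ _) J0
  have d1p : 0 < d1 := div_pos (Dn_pos _ _) J1
  have dzp : 0 < dz := div_pos (Dn_pos _ _) Jz
  have hcD := Dn_cont K
  have hcJ := hch.contJ
  -- neighbourhoods
  have n0 : ∀ᶠ γ : ZZ in 𝓝 γ₀, 0 < J γ.1 ∧ Dn K γ.1 < e * d0 * J γ.1 := by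
    apply ContinuousAt.eventually_lt (f := fun _ => (0:ℝ)) (g := fun γ : ZZ => J γ.1) (by fun_prop) (by fun_prop) J0 |>.and
    apply ContinuousAt.eventually_lt (f := fun γ : ZZ => Dn K γ.1) (g := fun γ : ZZ => e * d0 * J γ.1) (by fun_prop) (by fun_prop)
    have : e * d0 * J γ₀.1 = e * Dn K γ₀.1 := by rw [hd0]; field_simp
    rw [this]; nlinarith [Dn_pos K γ₀.1]
  have n1 : ∀ᶠ γ : ZZ in 𝓝 γ₀, 0 < J γ.2 ∧ Dn K γ.2 < e * d1 * J γ.2 := by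
    apply ContinuousAt.eventually_lt (f := fun _ => (0:ℝ)) (g := fun γ : ZZ => J γ.2) (by fun_prop) (by fun_prop) J1 |>.and
    apply ContinuousAt.eventually_lt (f := fun γ : ZZ => Dn K γ.2) (g := fun γ : ZZ => e * d1 * J γ.2) (by fun_prop) (by fun_prop)
    have : e * d1 * J γ₀.2 = e * Dn K γ₀.2 := by rw [hd1]; field_simp
    rw [this]; nlinarith [Dn_pos K γ₀.2]
  have nz : ∀ᶠ z in 𝓝 (G γ₀), 0 < J z ∧ J z < e / dz * Dn K z := by
    apply ContinuousAt.eventually_lt (f := fun _ => (0:ℝ)) (g := fun γ => J γ) (by fun_prop) (by fun_prop) Jz |>.and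
    apply ContinuousAt.eventually_lt (f := fun γ => J γ) (g := fun γ => e / dz * Dn K γ) (by fun_prop) (by fun_prop)
    have : e / dz * Dn K (G γ₀) = e * J (G γ₀) := by
      have := Dn_pos K (G γ₀)
      rw [hdz]; field_simp
    rw [this]; nlinarith
  have nz' := (hGc γ₀ hγ₀).eventually nz
  rw [eventually_nhdsWithin_iff] at nz'
  refine ⟨U₀ ∩ ({γ | 0 < J γ.1 ∧ Dn K γ.1 < e * d0 * J γ.1} ∩ ({γ | 0 < J γ.2 ∧ Dn K γ.2 < e * d1 * J γ.2} ∩ _)),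
    Filter.inter_mem hU₀ (Filter.inter_mem n0 (Filter.inter_mem n1 nz')), ?_⟩
  intro β0 β1 A hA hAU hβ
  have hAm := hA.measurableSet
  have hAS : A ⊆ S := fun γ h => (hAU h).2
  have hAU0 : A ⊆ U₀ ∩ S := fun γ h => ⟨(hAU h).1.1, (hAU h).2⟩
  have hΦ := hch.cont
  have e0c : IsCompact (Prod.fst '' A) := hA.image continuous_fst
  have e1c : IsCompact (Prod.snd '' A) := hA.image continuous_snd
  have ezc : IsCompact (G '' A) := hA.image_of_continuousOn (hGc.mono hAS)
  have key := Kprime π A hA hAm (fun γ => (Φ γ.1).1) (fun γ => (Φ γ.1).2) (fun γ => (Φ γ.2).1) (fun γ => (Φ γ.2).2)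
    (fun γ => (Φ (G γ)).1) (fun γ => (Φ (G γ)).2) (by fun_prop) (by fun_prop) (by fun_prop) (by fun_prop)
    ((continuous_fst.comp hΦ).comp_continuousOn (hGc.mono hAS)) ((continuous_snd.comp hΦ).comp_continuousOn (hGc.mono hAS))
    ((continuous_fst.comp hΦ).measurable.comp hG) t ht0 ht1 P0 P1 hP0 hP1 (fun γ h => hz γ (hAU0 h))
    (fun γ h γ' h' => hmono γ (hAU0 h) γ' (hAU0 h')) (fun γ h γ' h' => hin γ (hAU0 h) γ' (hAU0 h'))
    (β0 * (e * d0).toNNReal) (β1 * (e * d1).toNNReal)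
    (by
      intro W hW
      have b1 := marg_bound π Prod.fst measurable_fst (lam K) r0 hr0 hm0 A β0 (fun γ h => (hβ γ h).1)
        (Prod.fst '' A ∩ Φ ⁻¹' W) (e0c.measurableSet.inter (hΦ.measurable hW))
      have b2 := chart1 hch K e0c.measurableSet hW (by rintro _ ⟨γ, h, rfl⟩; exact (hAU h).1.2.1.1)
        (e * d0) (by positivity) (by rintro _ ⟨γ, h, rfl⟩; exact (hAU h).1.2.1.2.le)
      calc _ ≤ π (A ∩ Prod.fst ⁻¹' (Prod.fst '' A ∩ Φ ⁻¹' W)) := by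
            apply measure_mono
            rintro γ ⟨h1, h2⟩
            exact ⟨h1, ⟨γ, h1, rfl⟩, h2⟩
        _ ≤ β0 * (ENNReal.ofReal (e * d0) * volume W) := b1.trans (by gcongr)
        _ = _ := by rw [ENNReal.coe_mul, mul_assoc]; rfl)
    (by
      intro W hW
      have b1 := marg_bound π Prod.snd measurable_snd (lam K) r1 hr1 hm1 A β1 (fun γ h => (hβ γ h).2)
        (Prod.snd '' A ∩ Φ ⁻¹' W) (e1c.measurableSet.inter (hΦ.measurable hW))
      have b2 := chart1 hch K e1c.measurableSet hW (by rintro _ ⟨γ, h, rfl⟩; exact (hAU h).1.2.2.1.1)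
        (e * d1) (by positivity) (by rintro _ ⟨γ, h, rfl⟩; exact (hAU h).1.2.2.1.2.le)
      calc _ ≤ π (A ∩ Prod.snd ⁻¹' (Prod.snd '' A ∩ Φ ⁻¹' W)) := by
            apply measure_mono
            rintro γ ⟨h1, h2⟩
            exact ⟨h1, ⟨γ, h1, rfl⟩, h2⟩
        _ ≤ β1 * (ENNReal.ofReal (e * d1) * volume W) := b1.trans (by gcongr)
        _ = _ := by rw [ENNReal.coe_mul, mul_assoc]; rfl)
  have hvol := chart2 hch K ezc.measurableSet (by rintro _ ⟨γ, h, rfl⟩; exact hGR γ (hAS h))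
    (by rintro _ ⟨γ, h, rfl⟩; exact ((hAU h).1.2.2.2 (hAS h)).1) (e / dz) (by positivity)
    (by rintro _ ⟨γ, h, rfl⟩; exact ((hAU h).1.2.2.2 (hAS h)).2.le)
  have himg : (fun γ => ((Φ (G γ)).1, (Φ (G γ)).2)) '' A = Φ '' (G '' A) := by
    rw [Set.image_image]
  rw [himg] at key
  have hreal : ((1 - t) / P0) ^ (1 - t) * (t / P1) ^ t * ((e * d0) ^ (1 - t) * (e * d1) ^ t) * (e / dz) ≤ E := by
    rw [Real.mul_rpow he0.le d0p.le, Real.mul_rpow he0.le d1p.le]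
    have : e ^ (1 - t) * e ^ t = e := by rw [← Real.rpow_add he0]; simp
    calc _ = (((1 - t) / P0) ^ (1 - t) * (t / P1) ^ t * (d0 ^ (1 - t) * d1 ^ t)) * (e ^ (1 - t) * e ^ t) * (e / dz) := by ring
      _ ≤ dz * (e ^ (1 - t) * e ^ t) * (e / dz) := by gcongr
      _ = E := by rw [this, ← hee]; field_simp
  have hen : ENNReal.ofReal ((1 - t) / P0) ^ (1 - t) * ENNReal.ofReal (t / P1) ^ t *
      (ENNReal.ofReal (e * d0) ^ (1 - t) * ENNReal.ofReal (e * d1) ^ t) * ENNReal.ofReal (e / dz) ≤ ENNReal.ofReal E := by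
    rw [ENNReal.ofReal_rpow_of_pos (by positivity), ENNReal.ofReal_rpow_of_pos (by positivity),
      ENNReal.ofReal_rpow_of_pos (by positivity), ENNReal.ofReal_rpow_of_pos (by positivity),
      ← ENNReal.ofReal_mul (by positivity), ← ENNReal.ofReal_mul (by positivity), ← ENNReal.ofReal_mul (by positivity),
      ← ENNReal.ofReal_mul (by positivity)]
    exact ENNReal.ofReal_le_ofReal hreal
  refine key.trans ?_
  rw [ENNReal.coe_mul, ENNReal.coe_mul, ENNReal.mul_rpow_of_nonneg _ _ ht1'.le, ENNReal.mul_rpow_of_nonneg _ _ ht0.le]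
  calc _ ≤ ENNReal.ofReal ((1 - t) / P0) ^ (1 - t) * ENNReal.ofReal (t / P1) ^ t *
        ((β0 : ENNReal) ^ (1 - t) * ENNReal.ofReal (e * d0) ^ (1 - t) * ((β1 : ENNReal) ^ t * ENNReal.ofReal (e * d1) ^ t)) *
          (ENNReal.ofReal (e / dz) * lam K (G '' A)) := by gcongr <;> exact le_rfl
    _ = (ENNReal.ofReal ((1 - t) / P0) ^ (1 - t) * ENNReal.ofReal (t / P1) ^ t *
      (ENNReal.ofReal (e * d0) ^ (1 - t) * ENNReal.ofReal (e * d1) ^ t) * ENNReal.ofReal (e / dz)) *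
        ((β0 : ENNReal) ^ (1 - t) * (β1 : ENNReal) ^ t) * lam K (G '' A) := by ring
    _ ≤ _ := by gcongr

open MeasureTheory ProbabilityTheory Topology

lemma null_of_local {Z : Type*} [TopologicalSpace Z] [PolishSpace Z] [MeasurableSpace Z] [BorelSpace Z] (π : Measure Z) [IsFiniteMeasure π] (B : Set Z) (hB : MeasurableSet B)
    (h : ∀ γ ∈ B, ∃ U ∈ 𝓝 γ, ∀ A, IsCompact A → A ⊆ U ∩ B → π A = 0) : π B = 0 := by
  apply measure_null_of_locally_null
  intro γ hγ
  obtain ⟨U, hU, h⟩ := h γ hγ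
  refine ⟨interior U ∩ B, Filter.inter_mem (mem_nhdsWithin_of_mem_nhds (interior_mem_nhds.2 hU)) self_mem_nhdsWithin, ?_⟩
  by_contra hne
  obtain ⟨A, hA, hc, hp⟩ := (isOpen_interior.measurableSet.inter hB).exists_lt_isCompact (pos_iff_ne_zero.2 hne)
  exact hp.ne' (h A hc (hA.trans (Set.inter_subset_inter_left _ interior_subset)))

lemma global_lemma (l : Measure (ℝ × ℝ)) [IsFiniteMeasure l] (π : Measure ZZ) [IsFiniteMeasure π]
    (r0 r1 : ℝ × ℝ → ENNReal) (hr0 : Measurable r0) (hr1 : Measurable r1)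
    (hf0 : ∀ᵐ γ ∂π, r0 γ.1 < ⊤) (hf1 : ∀ᵐ γ ∂π, r1 γ.2 < ⊤)
    (G : ZZ → ℝ × ℝ) (hG : Measurable G) (t : ℝ) (ht0 : 0 < t) (ht1 : t < 1)
    (Γ : Set ZZ) (hΓ : MeasurableSet Γ) (hΓ0 : π Γᶜ = 0) (hinj : Set.InjOn G Γ)
    {ι : Type*} [Countable ι] (S : ι → Set ZZ) (hS : ∀ i, MeasurableSet (S i)) (hcov : ∀ γ ∈ Γ, ∃ i, γ ∈ S i)
    (LL : ∀ i, ∀ γ₀ ∈ S i ∩ Γ, ∀ E : ℝ, 1 < E → ∃ U ∈ 𝓝 γ₀, ∀ β0 β1 : NNReal, ∀ A : Set ZZ, IsCompact A →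
      A ⊆ U ∩ (S i ∩ Γ) → (∀ γ ∈ A, r0 γ.1 ≤ β0 ∧ r1 γ.2 ≤ β1) →
      π A ≤ ENNReal.ofReal E * ((β0 : ENNReal) ^ (1 - t) * (β1 : ENNReal) ^ t) * l (G '' A)) :
    π.map G ≪ l ∧ ∀ᵐ γ ∂π, (π.map G).rnDeriv l (G γ) ≤ r0 γ.1 ^ (1 - t) * r1 γ.2 ^ t := by
  have ht1' : 0 < 1 - t := by linarith
  have hAΓ : ∀ A, IsCompact A → A ⊆ Γ → MeasurableSet (G '' A) := fun A hA h =>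
    hA.measurableSet.image_of_measurable_injOn hG (hinj.mono h)
  have hGA : ∀ A, IsCompact A → A ⊆ Γ → (π.map G) (G '' A) = π A := by
    intro A hA h
    rw [Measure.map_apply hG (hAΓ A hA h)]
    apply measure_congr
    filter_upwards [measure_eq_zero_iff_ae_notMem.1 hΓ0] with γ hγ
    rw [Set.notMem_compl_iff] at hγ
    apply propext
    constructor
    · rintro ⟨γ', h1, h2⟩
      have := hinj (h h1) hγ h2
      subst this; exact h1
    · intro h; exact ⟨γ, h, rfl⟩
  have hbm : ∀ β0 β1 : NNReal, MeasurableSet {γ : ZZ | r0 γ.1 ≤ β0 ∧ r1 γ.2 ≤ β1} := fun β0 β1 =>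
    (measurableSet_le (hr0.comp measurable_fst) measurable_const).inter
      (measurableSet_le (hr1.comp measurable_snd) measurable_const)
  have hcov0 : ∀ B : Set ZZ, (∀ i, π (B ∩ (S i ∩ Γ)) = 0) → π B = 0 := by
    intro B hB
    apply measure_mono_null (t := Γᶜ ∪ ⋃ i, B ∩ (S i ∩ Γ))
    · intro γ h
      by_cases hγ : γ ∈ Γ
      · obtain ⟨i, hi⟩ := hcov γ hγ
        exact Or.inr (Set.mem_iUnion.2 ⟨i, h, hi, hγ⟩)
      · exact Or.inl hγ
    · exact measure_union_null hΓ0 (measure_iUnion_null hB)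
  constructor
  · refine Measure.AbsolutelyContinuous.mk fun N hN hN0 => ?_
    rw [Measure.map_apply hG hN]
    have hn : ∀ n : ℕ, π (G ⁻¹' N ∩ {γ : ZZ | r0 γ.1 ≤ (n : NNReal) ∧ r1 γ.2 ≤ (n : NNReal)}) = 0 := by
      intro n
      apply hcov0
      intro i
      apply null_of_local _ _ (((hG hN).inter (hbm _ _)).inter ((hS i).inter hΓ))
      rintro γ ⟨-, hγ⟩
      obtain ⟨U, hU, h⟩ := LL i γ hγ 2 (by norm_num)
      refine ⟨U, hU, fun A hA hAU => ?_⟩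
      have := h n n A hA (hAU.trans (Set.inter_subset_inter_right _ Set.inter_subset_right)) (fun γ hγ => (hAU hγ).2.1.2)
      have h0 : l (G '' A) = 0 := by
        apply measure_mono_null _ hN0
        rintro _ ⟨γ, hγ, rfl⟩
        exact (hAU hγ).2.1.1
      rw [h0, mul_zero] at this
      exact le_antisymm this zero_le
    have hfin : ∀ᵐ γ ∂π, ∃ n : ℕ, r0 γ.1 ≤ (n : NNReal) ∧ r1 γ.2 ≤ (n : NNReal) := by
      filter_upwards [hf0, hf1] with γ h0 h1
      obtain ⟨n, hn⟩ := ENNReal.exists_nat_gt (max_lt h0 h1).ne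
      refine ⟨n, ?_, ?_⟩
      · exact_mod_cast (le_max_left _ _).trans hn.le
      · exact_mod_cast (le_max_right _ _).trans hn.le
    have hall := ae_all_iff.2 fun n => measure_eq_zero_iff_ae_notMem.1 (hn n)
    rw [measure_eq_zero_iff_ae_notMem]
    filter_upwards [hfin, hall] with γ ⟨n, hn⟩ h hγ
    exact h n ⟨hγ, hn⟩
  · have hu : Measurable fun γ => (π.map G).rnDeriv l (G γ) := (Measure.measurable_rnDeriv _ _).comp hG
    have main : ∀ E : NNReal, 1 < E → ∀ᵐ γ ∂π, (π.map G).rnDeriv l (G γ) ≤ E * (r0 γ.1 ^ (1 - t) * r1 γ.2 ^ t) := by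
      intro E hE
      apply bad_set π t ht0 ht1 _ _ _ E hf0 hf1
      intro r β0 β1 hr
      apply hcov0
      intro i
      have hBm : MeasurableSet {γ : ZZ | (r : ENNReal) ≤ (π.map G).rnDeriv l (G γ) ∧ r0 γ.1 ≤ β0 ∧ r1 γ.2 ≤ β1} :=
        (measurableSet_le measurable_const hu).inter (hbm β0 β1)
      apply null_of_local _ _ (hBm.inter ((hS i).inter hΓ))
      rintro γ ⟨-, hγ⟩
      obtain ⟨U, hU, h⟩ := LL i γ hγ E (by exact_mod_cast hE)
      refine ⟨U, hU, fun A hA hAU => ?_⟩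
      have h1 := h β0 β1 A hA (hAU.trans (Set.inter_subset_inter_right _ Set.inter_subset_right)) (fun γ hγ => (hAU hγ).2.1.2)
      have hAΓ' : A ⊆ Γ := fun γ h => (hAU h).2.2.2
      have h2 : r * l (G '' A) ≤ π A := by
        rw [← hGA A hA hAΓ']
        calc r * l (G '' A) = ∫⁻ z in G '' A, r ∂l := by rw [setLIntegral_const]
          _ ≤ ∫⁻ z in G '' A, (π.map G).rnDeriv l z ∂l := by
              apply setLIntegral_mono' (hAΓ A hA hAΓ')
              rintro _ ⟨γ, hγ, rfl⟩
              exact (hAU hγ).2.1.1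
          _ ≤ _ := Measure.setLIntegral_rnDeriv_le _
      rw [ENNReal.ofReal_coe_nnreal] at h1
      have h3 : l (G '' A) = 0 := by
        by_contra hne
        have := (h2.trans h1)
        rw [ENNReal.mul_le_mul_iff_left hne (measure_ne_top _ _)] at this
        exact absurd hr (not_lt.2 this)
      rw [h3, mul_zero] at h1
      exact le_antisymm h1 zero_le
    have hall : ∀ᵐ γ ∂π, ∀ n : ℕ, (π.map G).rnDeriv l (G γ) ≤ ((1 + 1 / ((n : NNReal) + 1) : NNReal) : ENNReal) * (r0 γ.1 ^ (1 - t) * r1 γ.2 ^ t) := by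
      rw [ae_all_iff]
      intro n
      apply main
      have : (0 : NNReal) < 1 / ((n : NNReal) + 1) := by positivity
      exact lt_add_of_pos_right _ this
    filter_upwards [hall, hf0, hf1] with γ h h0 h1
    have hlim : Filter.Tendsto (fun n : ℕ => ((1 + 1 / ((n : NNReal) + 1) : NNReal) : ENNReal) * (r0 γ.1 ^ (1 - t) * r1 γ.2 ^ t)) Filter.atTop
        (𝓝 (1 * (r0 γ.1 ^ (1 - t) * r1 γ.2 ^ t))) := by
      apply ENNReal.Tendsto.mul_const
      · rw [← ENNReal.coe_one, ENNReal.tendsto_coe]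
        have := (tendsto_one_div_add_atTop_nhds_zero_nat (𝕜 := NNReal)).const_add (1 : NNReal)
        simpa using this
      · left; exact one_ne_zero
    rw [one_mul] at hlim
    exact ge_of_tendsto' hlim h

open MeasureTheory ProbabilityTheory Topology

noncomputable def cst (f : ℝ → ℝ) (γ : ZZ) : NNReal := Real.toNNReal (dist (PP f γ.1) (PP f γ.2) ^ 2)
noncomputable def sst (γ : ZZ) : NNReal := Real.toNNReal ((γ.1.1 - γ.2.1) ^ 2 + (γ.1.2 - γ.2.2) ^ 2)
def cr (γ : ZZ) : ℝ := (γ.1.1 - γ.2.1) ^ 2 + (γ.1.2 - γ.2.2) ^ 2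

lemma cst_lt (f : ℝ → ℝ) (a b c d : ZZ) : (cst f a : ENNReal) + cst f b < cst f c + cst f d ↔
    dist (PP f a.1) (PP f a.2) ^ 2 + dist (PP f b.1) (PP f b.2) ^ 2 <
    dist (PP f c.1) (PP f c.2) ^ 2 + dist (PP f d.1) (PP f d.2) ^ 2 := by
  rw [← ENNReal.coe_add, ← ENNReal.coe_add, ENNReal.coe_lt_coe]
  unfold cst
  rw [← Real.toNNReal_add (by positivity) (by positivity), ← Real.toNNReal_add (by positivity) (by positivity)]
  constructor
  · intro h; exact (Real.toNNReal_lt_toNNReal_iff').1 h |>.1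
  · intro h; exact (Real.toNNReal_lt_toNNReal_iff').2 ⟨h, lt_of_le_of_lt (by positivity) h⟩

lemma cst_eq (f : ℝ → ℝ) (a b c d : ZZ) (h : dist (PP f a.1) (PP f a.2) ^ 2 + dist (PP f b.1) (PP f b.2) ^ 2 =
    dist (PP f c.1) (PP f c.2) ^ 2 + dist (PP f d.1) (PP f d.2) ^ 2) : (cst f a : ENNReal) + cst f b = cst f c + cst f d := by
  rw [← ENNReal.coe_add, ← ENNReal.coe_add]
  unfold cst
  rw [← Real.toNNReal_add (by positivity) (by positivity), ← Real.toNNReal_add (by positivity) (by positivity), h]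

lemma sst_lt (a b c d : ZZ) (h : cr a + cr b < cr c + cr d) : (sst a : ENNReal) + sst b < sst c + sst d := by
  rw [← ENNReal.coe_add, ← ENNReal.coe_add, ENNReal.coe_lt_coe]
  unfold sst
  rw [← Real.toNNReal_add (by positivity) (by positivity), ← Real.toNNReal_add (by positivity) (by positivity)]
  exact (Real.toNNReal_lt_toNNReal_iff').2 ⟨h, lt_of_le_of_lt (by unfold cr; positivity) h⟩

lemma sst_cont : Continuous sst := by
  unfold sst; fun_prop

lemma gdx_cont : Continuous gdx := by
  unfold gdx; fun_prop

structure Good (f : ℝ → ℝ) (Γ : Set ZZ) : Prop where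
  meas : MeasurableSet Γ
  sub : Γ ⊆ R2
  prim : ∀ γ ∈ Γ, ∀ γ' ∈ Γ, dist (PP f γ.1) (PP f γ.2) ^ 2 + dist (PP f γ'.1) (PP f γ'.2) ^ 2 ≤
    dist (PP f γ.1) (PP f γ'.2) ^ 2 + dist (PP f γ'.1) (PP f γ.2) ^ 2
  secv : ∀ γ ∈ Γ, ∀ γ' ∈ Γ, |gdx γ| ≤ |gdy f γ| → gdy f γ ≠ 0 → |gdx γ'| ≤ |gdy f γ'| → gdy f γ' ≠ 0 →
    f γ.1.1 * γ.1.2 = f γ'.1.1 * γ'.1.2 → f γ.2.1 * γ.2.2 = f γ'.2.1 * γ'.2.2 → ¬ (γ.1.1 < γ'.1.1 ∧ γ'.2.1 < γ.2.1)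
  sech : ∀ γ ∈ Γ, ∀ γ' ∈ Γ, |gdy f γ| ≤ |gdx γ| → |gdy f γ'| ≤ |gdx γ'| →
    γ.1.1 = γ'.1.1 → γ.2.1 = γ'.2.1 → ¬ (γ.1.2 < γ'.1.2 ∧ γ'.2.2 < γ.2.2)

namespace FH

lemma f_pos_end {k : ℝ} {f f' φ : ℝ → ℝ} (H : FH k f f' φ) {γ : ZZ} (hγ : γ ∈ R2) (h1 : |gdx γ| ≤ |gdy f γ|) (h2 : gdy f γ ≠ 0) : 0 < f γ.1.1 ∧ 0 < f γ.2.1 := by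
  have hk := H.kpos
  have hk' := H.kle
  have p : 0 < |gdy f γ| := abs_pos.2 h2
  have l := H.lip γ.2.1 γ.1.1
  have f0 := H.f0 γ.1.1
  have f1 := H.f0 γ.2.1
  obtain ⟨⟨-, a0, a1⟩, ⟨-, b0, b1⟩⟩ := hγ
  change |f γ.2.1 - f γ.1.1| ≤ k * |gdx γ| at l
  have l2 : |f γ.2.1 - f γ.1.1| < |gdy f γ| := by
    refine l.trans_lt ?_
    nlinarith
  constructor
  · by_contra hc
    have e : f γ.1.1 = 0 := le_antisymm (not_lt.1 hc) f0
    have : |gdy f γ| ≤ |f γ.2.1 - f γ.1.1| := by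
      unfold gdy
      rw [e, zero_mul, sub_zero, sub_zero, abs_of_nonneg (by positivity), abs_of_nonneg f1]
      nlinarith
    linarith
  · by_contra hc
    have e : f γ.2.1 = 0 := le_antisymm (not_lt.1 hc) f1
    have : |gdy f γ| ≤ |f γ.2.1 - f γ.1.1| := by
      unfold gdy
      rw [e, zero_mul, zero_sub, zero_sub, abs_neg, abs_neg, abs_of_nonneg (by positivity), abs_of_nonneg f0]
      nlinarith
    linarith

lemma cst_cont {k : ℝ} {f f' φ : ℝ → ℝ} (H : FH k f f' φ) : Continuous (cst f) := by
  have := H.PP_cont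
  unfold cst; fun_prop


lemma gdy_cont {k : ℝ} {f f' φ : ℝ → ℝ} (H : FH k f f' φ) : Continuous (gdy f) := by
  have := H.cont
  unfold gdy; fun_prop


lemma good_exists {k : ℝ} {f f' φ : ℝ → ℝ} (H : FH k f f' φ) (π : Measure ZZ) [IsProbabilityMeasure π] (hR : π R2ᶜ = 0)
    (hmin : ∀ π' : Measure ZZ, π'.map Prod.fst = π.map Prod.fst → π'.map Prod.snd = π.map Prod.snd →
      ∫⁻ z, cst f z ∂π ≤ ∫⁻ z, cst f z ∂π')
    (hmin2 : ∀ π' : Measure ZZ, π'.map Prod.fst = π.map Prod.fst → π'.map Prod.snd = π.map Prod.snd →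
      ∫⁻ z, cst f z ∂π' = ∫⁻ z, cst f z ∂π → ∫⁻ z, sst z ∂π ≤ ∫⁻ z, sst z ∂π') :
    ∃ Γ, Good f Γ ∧ π Γᶜ = 0 := by
  have hc := H.cont
  have cc := H.cst_cont
  have sc := sst_cont
  have cy := H.gdy_cont
  have cx := gdx_cont
  have R2c : IsCompact R2 := RR_compact.prod RR_compact
  have R2m : MeasurableSet R2 := R2c.measurableSet
  have bdd : ∀ u : ZZ → NNReal, Continuous u → ∫⁻ z, u z ∂π ≠ ⊤ := by
    intro u hu
    obtain ⟨M, hM⟩ := R2c.bddAbove_image hu.continuousOn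
    have : ∫⁻ z, u z ∂π ≤ ∫⁻ z, M ∂π := by
      apply lintegral_mono_ae
      filter_upwards [measure_eq_zero_iff_ae_notMem.1 hR] with z hz
      rw [Set.notMem_compl_iff] at hz
      exact_mod_cast hM ⟨z, hz, rfl⟩
    refine ne_top_of_le_ne_top ?_ this
    simp
  have cm : Measurable fun z => (cst f z : ENNReal) := cc.measurable.coe_nnreal_ennreal
  have sm : Measurable fun z => (sst z : ENNReal) := sc.measurable.coe_nnreal_ennreal
  -- primary
  obtain ⟨Γ1, m1, n1, g1⟩ := fiber_lemma π (fun _ => ()) measurable_const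
    {w : ZZ × ZZ | dist (PP f w.1.1) (PP f w.2.2) ^ 2 + dist (PP f w.2.1) (PP f w.1.2) ^ 2 <
      dist (PP f w.1.1) (PP f w.1.2) ^ 2 + dist (PP f w.2.1) (PP f w.2.2) ^ 2}
    (by
      have := H.PP_cont
      exact isOpen_lt (by fun_prop) (by fun_prop))
    (by
      intro σ h1 h2
      refine measure_mono_null ?_ (swap_prim π (fun z => (cst f z : ENNReal)) cm (bdd _ cc) hmin σ h1 h2)
      rintro w ⟨hw, -⟩
      exact (cst_lt f (w.1.1, w.2.2) (w.2.1, w.1.2) w.1 w.2).2 hw)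
  -- generic restricted marginals
  have resn : ∀ (U : Set ZZ), MeasurableSet U → ∀ σ : Measure (ZZ × ZZ), σ.map Prod.fst ≤ π.restrict U →
      σ.map Prod.snd ≤ π.restrict U → σ {w | ¬ (w.1 ∈ U ∧ w.1 ∈ R2 ∧ w.2 ∈ U ∧ w.2 ∈ R2)} = 0 := by
    intro U hU σ h1 h2
    have z : π.restrict U (U ∩ R2)ᶜ = 0 := by
      rw [Measure.restrict_apply (hU.inter R2m).compl]
      refine measure_mono_null ?_ hR
      rintro z ⟨h, h'⟩ h''
      exact h ⟨h', h''⟩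
    have z1 : σ (Prod.fst ⁻¹' (U ∩ R2)ᶜ) = 0 := by
      rw [← Measure.map_apply measurable_fst (hU.inter R2m).compl]
      exact le_antisymm ((h1 _).trans z.le) zero_le
    have z2 : σ (Prod.snd ⁻¹' (U ∩ R2)ᶜ) = 0 := by
      rw [← Measure.map_apply measurable_snd (hU.inter R2m).compl]
      exact le_antisymm ((h2 _).trans z.le) zero_le
    refine measure_mono_null ?_ (measure_union_null z1 z2)
    intro w hw
    by_contra hcon
    simp only [Set.mem_union, Set.mem_preimage, Set.mem_compl_iff, not_or, not_not] at hcon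
    exact hw ⟨hcon.1.1, hcon.1.2, hcon.2.1, hcon.2.2⟩
  have UVm : MeasurableSet {γ : ZZ | |gdx γ| ≤ |gdy f γ| ∧ gdy f γ ≠ 0} :=
    MeasurableSet.inter (s₁ := {γ : ZZ | |gdx γ| ≤ |gdy f γ|}) (s₂ := {γ : ZZ | gdy f γ ≠ 0})
      (measurableSet_le (by fun_prop) (by fun_prop)) (isOpen_ne_fun cy continuous_const).measurableSet
  have UHm : MeasurableSet {γ : ZZ | |gdy f γ| ≤ |gdx γ|} := measurableSet_le (by fun_prop) (by fun_prop)
  obtain ⟨Γ2, m2, n2, g2⟩ := fiber_lemma (π.restrict {γ : ZZ | |gdx γ| ≤ |gdy f γ| ∧ gdy f γ ≠ 0})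
    (fun γ : ZZ => (f γ.1.1 * γ.1.2, f γ.2.1 * γ.2.2)) (by fun_prop)
    {w : ZZ × ZZ | w.1.1.1 < w.2.1.1 ∧ w.2.2.1 < w.1.2.1}
    (IsOpen.inter (s := {w : ZZ × ZZ | w.1.1.1 < w.2.1.1}) (t := {w : ZZ × ZZ | w.2.2.1 < w.1.2.1}) (isOpen_lt (by fun_prop) (by fun_prop)) (isOpen_lt (by fun_prop) (by fun_prop)))
    (by
      intro σ h1 h2
      refine measure_mono_null ?_ (measure_union_null (resn _ UVm σ h1 h2) (swap_sec π (fun z => (cst f z : ENNReal)) (fun z => (sst z : ENNReal)) cm (bdd _ cc) sm (bdd _ sc) hmin2 σ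
        (h1.trans Measure.restrict_le_self) (h2.trans Measure.restrict_le_self)))
      rintro ⟨γ, γ'⟩ ⟨⟨hx0, hx1⟩, heq⟩
      rw [Set.mem_union]
      by_contra hcon
      rw [not_or] at hcon
      obtain ⟨hcon1, hcon2⟩ := hcon
      simp only [Set.mem_setOf_eq, not_not] at hcon1
      obtain ⟨⟨u1, u2⟩, hr, ⟨u1', u2'⟩, hr'⟩ := hcon1
      simp only [Set.mem_setOf_eq, Prod.mk.injEq] at heq hx0 hx1
      obtain ⟨e0, e1⟩ := heq
      apply hcon2
      have dy : gdy f γ' = gdy f γ := by unfold gdy; rw [e0, e1]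
      have dy1 : gdy f (γ.1, γ'.2) = gdy f γ := by unfold gdy; rw [e1]
      have dy2 : gdy f (γ'.1, γ.2) = gdy f γ := by unfold gdy; rw [e0]
      rw [dy] at u1'
      have ax := abs_le.1 u1
      have ax' := abs_le.1 u1'
      simp only [gdx] at ax ax'
      have b1 : |gdx (γ.1, γ'.2)| ≤ |gdy f γ| := by
        rw [abs_le]; simp only [gdx]; constructor <;> linarith
      have b2 : |gdx (γ'.1, γ.2)| ≤ |gdy f γ| := by
        rw [abs_le]; simp only [gdx]; constructor <;> linarith
      refine ⟨cst_eq f (γ.1, γ'.2) (γ'.1, γ.2) γ γ' ?_, sst_lt (γ.1, γ'.2) (γ'.1, γ.2) γ γ' ?_⟩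
      · rw [PP_dist f (γ.1, γ'.2), PP_dist f (γ'.1, γ.2), PP_dist f γ, PP_dist f γ', dy1, dy2, dy, max_eq_right b1,
          max_eq_right b2, max_eq_right u1, max_eq_right u1']
      · obtain ⟨fp0, fp1⟩ := H.f_pos_end hr u1 u2
        obtain ⟨fp0', fp1'⟩ := H.f_pos_end hr' (by rw [dy]; exact u1') u2'
        have c0 : γ'.1.2 ≤ γ.1.2 := by
          by_contra hcc
          push Not at hcc
          have := H.mono hx0.le
          have := hr.1.2.1
          nlinarith
        have c1 : γ.2.2 ≤ γ'.2.2 := by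
          by_contra hcc
          push Not at hcc
          have := H.mono hx1.le
          have := hr'.2.2.1
          nlinarith
        simp only [cr]
        have q1 : 0 ≤ (γ.1.2 - γ'.1.2) * (γ'.2.2 - γ.2.2) := mul_nonneg (by linarith) (by linarith)
        have q2 : 0 < (γ'.1.1 - γ.1.1) * (γ.2.1 - γ'.2.1) := mul_pos (by linarith) (by linarith)
        linarith)
  obtain ⟨Γ3, m3, n3, g3⟩ := fiber_lemma (π.restrict {γ : ZZ | |gdy f γ| ≤ |gdx γ|})
    (fun γ : ZZ => (γ.1.1, γ.2.1)) (by fun_prop)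
    {w : ZZ × ZZ | w.1.1.2 < w.2.1.2 ∧ w.2.2.2 < w.1.2.2}
    (IsOpen.inter (s := {w : ZZ × ZZ | w.1.1.2 < w.2.1.2}) (t := {w : ZZ × ZZ | w.2.2.2 < w.1.2.2}) (isOpen_lt (by fun_prop) (by fun_prop)) (isOpen_lt (by fun_prop) (by fun_prop)))
    (by
      intro σ h1 h2
      refine measure_mono_null ?_ (measure_union_null (resn _ UHm σ h1 h2) (swap_sec π (fun z => (cst f z : ENNReal)) (fun z => (sst z : ENNReal)) cm (bdd _ cc) sm (bdd _ sc) hmin2 σ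
        (h1.trans Measure.restrict_le_self) (h2.trans Measure.restrict_le_self)))
      rintro ⟨γ, γ'⟩ ⟨⟨hx0, hx1⟩, heq⟩
      rw [Set.mem_union]
      by_contra hcon
      rw [not_or] at hcon
      obtain ⟨hcon1, hcon2⟩ := hcon
      simp only [Set.mem_setOf_eq, not_not] at hcon1
      obtain ⟨u1, hr, u1', hr'⟩ := hcon1
      simp only [Set.mem_setOf_eq, Prod.mk.injEq] at heq hx0 hx1
      obtain ⟨e0, e1⟩ := heq
      apply hcon2
      have dy : gdx γ' = gdx γ := by unfold gdx; rw [e0, e1]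
      have dy1 : gdx (γ.1, γ'.2) = gdx γ := by unfold gdx; rw [e1]
      have dy2 : gdx (γ'.1, γ.2) = gdx γ := by unfold gdx; rw [e0]
      rw [dy] at u1'
      have ax := abs_le.1 u1
      have ax' := abs_le.1 u1'
      simp only [gdy] at ax ax'
      rw [← e0, ← e1] at ax'
      have i0 : f γ.1.1 * γ.1.2 ≤ f γ.1.1 * γ'.1.2 := mul_le_mul_of_nonneg_left hx0.le (H.f0 _)
      have i1 : f γ.2.1 * γ'.2.2 ≤ f γ.2.1 * γ.2.2 := mul_le_mul_of_nonneg_left hx1.le (H.f0 _)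
      have b1 : |gdy f (γ.1, γ'.2)| ≤ |gdx γ| := by
        rw [abs_le]; simp only [gdy]; rw [← e1]; constructor <;> linarith
      have b2 : |gdy f (γ'.1, γ.2)| ≤ |gdx γ| := by
        rw [abs_le]; simp only [gdy]; rw [← e0]; constructor <;> linarith
      refine ⟨cst_eq f (γ.1, γ'.2) (γ'.1, γ.2) γ γ' ?_, sst_lt (γ.1, γ'.2) (γ'.1, γ.2) γ γ' ?_⟩
      · rw [PP_dist f (γ.1, γ'.2), PP_dist f (γ'.1, γ.2), PP_dist f γ, PP_dist f γ', dy1, dy2, dy, max_eq_left b1,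
          max_eq_left b2, max_eq_left u1, max_eq_left u1']
      · simp only [cr]
        rw [e0, e1]
        have q2 : 0 < (γ'.1.2 - γ.1.2) * (γ.2.2 - γ'.2.2) := mul_pos (by linarith) (by linarith)
        linarith)
  rw [Measure.restrict_apply m2.compl] at n2
  rw [Measure.restrict_apply m3.compl] at n3
  refine ⟨R2 ∩ Γ1 ∩ (Γ2ᶜ ∩ {γ : ZZ | |gdx γ| ≤ |gdy f γ| ∧ gdy f γ ≠ 0})ᶜ ∩ (Γ3ᶜ ∩ {γ : ZZ | |gdy f γ| ≤ |gdx γ|})ᶜ, ⟨?_, ?_, ?_, ?_, ?_⟩, ?_⟩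
  · exact ((R2m.inter m1).inter (m2.compl.inter UVm).compl).inter (m3.compl.inter UHm).compl
  · exact fun γ h => h.1.1.1
  · intro γ h γ' h'
    exact not_lt.1 (g1 γ h.1.1.2 γ' h'.1.1.2 rfl)
  · intro γ h γ' h' u1 u2 u1' u2' e0 e1
    have a : γ ∈ Γ2 := by by_contra hc; exact h.1.2 ⟨hc, u1, u2⟩
    have a' : γ' ∈ Γ2 := by by_contra hc; exact h'.1.2 ⟨hc, u1', u2'⟩
    exact g2 γ a γ' a' (by simp only [e0, e1])
  · intro γ h γ' h' u1 u1' e0 e1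
    have a : γ ∈ Γ3 := by by_contra hc; exact h.2 ⟨hc, u1⟩
    have a' : γ' ∈ Γ3 := by by_contra hc; exact h'.2 ⟨hc, u1'⟩
    exact g3 γ a γ' a' (by simp only [e0, e1])
  · rw [Set.compl_inter, Set.compl_inter, Set.compl_inter, compl_compl, compl_compl]
    exact measure_union_null (measure_union_null (measure_union_null hR n1) n2) n3

end FH

open MeasureTheory ProbabilityTheory Topology

namespace FH

lemma hfib {k : ℝ} {f f' φ : ℝ → ℝ} (H : FH k f f' φ) {Γ : Set ZZ} (hΓ : Good f Γ) {γ γ' : ZZ} (h : γ ∈ Γ) (h' : γ' ∈ Γ) (hb : |gdy f γ| ≤ |gdx γ|)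
    (hb' : |gdy f γ'| ≤ |gdx γ'|) (e0 : γ.1.1 = γ'.1.1) (e1 : γ.2.1 = γ'.2.1) {t : ℝ} (ht0 : 0 < t) (ht1 : t < 1)
    (hle : (Gh f t γ).2 ≤ (Gh f t γ').2) : γ.1.2 ≤ γ'.1.2 ∧ γ.2.2 ≤ γ'.2.2 := by
  have s1 : 0 < 1 - t := by linarith
  have A := hΓ.sech γ h γ' h' hb hb' e0 e1
  have B := hΓ.sech γ' h' γ h hb' hb e0.symm e1.symm
  have F := fun a b => H.fib_mono (hΓ.sub h') (hΓ.sub h) e0.symm e1.symm hb' hb ht0 ht1 a b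
  push Not at A B
  constructor
  · by_contra hc
    push Not at hc
    have F := F hc.le (B hc)
    have := B hc
    have q1 : 0 < (1 - t) * (γ.1.2 - γ'.1.2) := mul_pos s1 (by linarith)
    have q2 : 0 ≤ t * (γ.2.2 - γ'.2.2) := mul_nonneg ht0.le (by linarith)
    linarith
  · by_contra hc
    push Not at hc
    have hc0 : γ'.1.2 ≤ γ.1.2 := by
      by_contra h2
      push Not at h2
      linarith [A h2]
    have F := F hc0 hc.le
    have q1 : 0 ≤ (1 - t) * (γ.1.2 - γ'.1.2) := mul_nonneg s1.le (by linarith)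
    have q2 : 0 < t * (γ.2.2 - γ'.2.2) := mul_pos ht0 (by linarith)
    linarith

lemma vfib {k : ℝ} {f f' φ : ℝ → ℝ} (H : FH k f f' φ) {Γ : Set ZZ} (hΓ : Good f Γ) {γ γ' : ZZ} (h : γ ∈ Γ) (h' : γ' ∈ Γ) (hb : |gdx γ| ≤ |gdy f γ|)
    (hb' : |gdx γ'| ≤ |gdy f γ'|) (hn : gdy f γ ≠ 0) (hn' : gdy f γ' ≠ 0)
    (e0 : f γ.1.1 * γ.1.2 = f γ'.1.1 * γ'.1.2) (e1 : f γ.2.1 * γ.2.2 = f γ'.2.1 * γ'.2.2) {t : ℝ} (ht0 : 0 < t) (ht1 : t < 1)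
    (hle : gx t γ ≤ gx t γ') : γ.1.1 ≤ γ'.1.1 ∧ γ.2.1 ≤ γ'.2.1 := by
  have s1 : 0 < 1 - t := by linarith
  have A := hΓ.secv γ h γ' h' hb hn hb' hn' e0 e1
  have B := hΓ.secv γ' h' γ h hb' hn' hb hn e0.symm e1.symm
  push Not at A B
  unfold gx at hle
  constructor
  · by_contra hc
    push Not at hc
    have := B hc
    have q1 : 0 < (1 - t) * (γ.1.1 - γ'.1.1) := mul_pos s1 (by linarith)
    have q2 : 0 ≤ t * (γ.2.1 - γ'.2.1) := mul_nonneg ht0.le (by linarith)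
    linarith
  · by_contra hc
    push Not at hc
    have hc0 : γ'.1.1 ≤ γ.1.1 := by
      by_contra h2
      push Not at h2
      linarith [A h2]
    have q1 : 0 ≤ (1 - t) * (γ.1.1 - γ'.1.1) := mul_nonneg s1.le (by linarith)
    have q2 : 0 < t * (γ.2.1 - γ'.2.1) := mul_pos ht0 (by linarith)
    linarith

end FH

lemma abs_conv_eq {a b l t : ℝ} (ht0 : 0 < t) (ht1 : t < 1) (ha : |a| ≤ l) (hb : |b| ≤ l) (h : |(1 - t) * a + t * b| = l) :
    a = b ∧ |a| = l := by
  have s1 : 0 < 1 - t := by linarith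
  rw [abs_le] at ha hb
  rcases abs_cases ((1 - t) * a + t * b) with ⟨e, -⟩ | ⟨e, -⟩
  · have e1 : (1 - t) * (l - a) + t * (l - b) = 0 := by rw [e] at h; linarith
    have q1 : 0 ≤ (1 - t) * (l - a) := mul_nonneg s1.le (by linarith)
    have q2 : 0 ≤ t * (l - b) := mul_nonneg ht0.le (by linarith)
    have r1 : l - a = 0 := by
      have : (1 - t) * (l - a) = 0 := by linarith
      exact (mul_eq_zero.1 this).resolve_left s1.ne'
    have r2 : l - b = 0 := by
      have : t * (l - b) = 0 := by linarith
      exact (mul_eq_zero.1 this).resolve_left ht0.ne'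
    refine ⟨by linarith, ?_⟩
    have : a = l := by linarith
    rw [this, abs_of_nonneg (by linarith)]
  · have e1 : (1 - t) * (l + a) + t * (l + b) = 0 := by rw [e] at h; linarith
    have q1 : 0 ≤ (1 - t) * (l + a) := mul_nonneg s1.le (by linarith)
    have q2 : 0 ≤ t * (l + b) := mul_nonneg ht0.le (by linarith)
    have r1 : l + a = 0 := by
      have : (1 - t) * (l + a) = 0 := by linarith
      exact (mul_eq_zero.1 this).resolve_left s1.ne'
    have r2 : l + b = 0 := by
      have : t * (l + b) = 0 := by linarith
      exact (mul_eq_zero.1 this).resolve_left ht0.ne'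
    refine ⟨by linarith, ?_⟩
    have : a = -l := by linarith
    rw [this, abs_neg, abs_of_nonneg (by linarith)]

lemma abs_conv_eq' {a b A B l t : ℝ} (ht0 : 0 < t) (ht1 : t < 1) (ha : A ≤ l) (hb : B ≤ l) (ha' : |a| ≤ (1 - t) * A) (hb' : |b| ≤ t * B)
    (h : |a + b| = l) : A = l ∧ B = l := by
  have s1 : 0 < 1 - t := by linarith
  have := abs_add_le a b
  have q1 : 0 ≤ (1 - t) * (l - A) := mul_nonneg s1.le (by linarith)
  have q2 : 0 ≤ t * (l - B) := mul_nonneg ht0.le (by linarith)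
  have r1 : l - A = 0 := by
    have : (1 - t) * (l - A) = 0 := by linarith
    exact (mul_eq_zero.1 this).resolve_left s1.ne'
  have r2 : l - B = 0 := by
    have : t * (l - B) = 0 := by linarith
    exact (mul_eq_zero.1 this).resolve_left ht0.ne'
  constructor <;> linarith

lemma two_len {l l' c c' t : ℝ} (ht0 : 0 < t) (ht1 : t < 1) (hc0 : 0 ≤ c) (hc0' : 0 ≤ c') 
    (hc : c ≤ t * l + (1 - t) * l') (hc' : c' ≤ t * l' + (1 - t) * l)
    (h : l ^ 2 + l' ^ 2 ≤ c ^ 2 + c' ^ 2) : l = l' ∧ c = l := by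
  have a1 : c ^ 2 ≤ (t * l + (1 - t) * l') ^ 2 := pow_le_pow_left₀ hc0 hc 2
  have a2 : c' ^ 2 ≤ (t * l' + (1 - t) * l) ^ 2 := pow_le_pow_left₀ hc0' hc' 2
  have s1 : 0 < t * (1 - t) := mul_pos ht0 (by linarith)
  have e : t * (1 - t) * (l - l') ^ 2 ≤ 0 := by nlinarith
  have e2 : (l - l') ^ 2 = 0 := by
    have := sq_nonneg (l - l')
    nlinarith
  have e3 : l = l' := by
    have := pow_eq_zero_iff (two_ne_zero) |>.1 e2
    linarith
  refine ⟨e3, ?_⟩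
  subst e3
  have hcl : c ≤ l := by linarith
  have hcl' : c' ≤ l := by linarith
  nlinarith

namespace FH

lemma Gh_inj {k : ℝ} {f f' φ : ℝ → ℝ} (H : FH k f f' φ) {Γ : Set ZZ} (hΓ : Good f Γ) {t : ℝ} (ht0 : 0 < t) (ht1 : t < 1) : Set.InjOn (Gh f t) Γ := by
  intro γ h γ' h' he
  have s1 : 0 < 1 - t := by linarith
  have hγ := hΓ.sub h
  have hγ' := hΓ.sub h'
  have ex : gx t γ = gx t γ' := congrArg Prod.fst he
  have c1 : dist (PP f γ.1) (PP f γ'.2) ≤ t * dist (PP f γ.1) (PP f γ.2) + (1 - t) * dist (PP f γ'.1) (PP f γ'.2) := by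
    have d1 := H.Gh_dist hγ ht0.le ht1.le le_rfl zero_le_one
    have d2 := H.Gh_dist hγ' zero_le_one le_rfl ht0.le ht1.le
    rw [H.PGh_zero hγ, zero_sub, abs_neg, abs_of_pos ht0] at d1
    rw [H.PGh_one hγ', abs_sub_comm, abs_of_pos s1, ← he] at d2
    exact (dist_triangle _ _ _).trans (add_le_add d1 d2)
  have c2 : dist (PP f γ'.1) (PP f γ.2) ≤ t * dist (PP f γ'.1) (PP f γ'.2) + (1 - t) * dist (PP f γ.1) (PP f γ.2) := by
    have d1 := H.Gh_dist hγ' ht0.le ht1.le le_rfl zero_le_one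
    have d2 := H.Gh_dist hγ zero_le_one le_rfl ht0.le ht1.le
    rw [H.PGh_zero hγ', zero_sub, abs_neg, abs_of_pos ht0, ← he] at d1
    rw [H.PGh_one hγ, abs_sub_comm, abs_of_pos s1] at d2
    exact (dist_triangle _ _ _).trans (add_le_add d1 d2)
  obtain ⟨el, ec⟩ := two_len ht0 ht1 dist_nonneg dist_nonneg c1 c2 (hΓ.prim γ h γ' h')
  set l := dist (PP f γ.1) (PP f γ.2) with hl
  have hm : max |gdx γ| |gdy f γ| = l := (PP_dist f γ).symm
  have hm' : max |gdx γ'| |gdy f γ'| = l := by rw [el]; exact (PP_dist f γ').symm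
  have hmc : max |γ'.2.1 - γ.1.1| |f γ'.2.1 * γ'.2.2 - f γ.1.1 * γ.1.2| = l := by
    rw [← ec]; exact (PP_dist f (γ.1, γ'.2)).symm
  have mx := (le_max_left _ _).trans_eq hm
  have my := (le_max_right _ _).trans_eq hm
  have mx' := (le_max_left _ _).trans_eq hm'
  have my' := (le_max_right _ _).trans_eq hm'
  have exx : γ'.2.1 - γ.1.1 = (1 - t) * gdx γ' + t * gdx γ := by
    have ex := ex
    unfold gx at ex; unfold gdx; linarith
  rcases le_total |f γ'.2.1 * γ'.2.2 - f γ.1.1 * γ.1.2| |γ'.2.1 - γ.1.1| with hh | hh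
  · rw [max_eq_left hh, exx] at hmc
    obtain ⟨e1, e2⟩ := abs_conv_eq ht0 ht1 mx' mx hmc
    have x0 : γ.1.1 = γ'.1.1 := by
      rw [gdx, gdx] at e1; unfold gx at ex
      linear_combination ex - t * (-e1)
    have x1 : γ.2.1 = γ'.2.1 := by
      rw [gdx, gdx] at e1; linarith
    have hb : |gdy f γ| ≤ |gdx γ| := by rw [← e1, e2]; exact my
    have hb' : |gdy f γ'| ≤ |gdx γ'| := by rw [e2]; exact my'
    have A := H.hfib hΓ h h' hb hb' x0 x1 ht0 ht1 (congrArg Prod.snd he).le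
    have B := H.hfib hΓ h' h hb' hb x0.symm x1.symm ht0 ht1 (congrArg Prod.snd he).ge
    exact Prod.ext (Prod.ext x0 (le_antisymm A.1 B.1)) (Prod.ext x1 (le_antisymm A.2 B.2))
  · rw [max_eq_right hh] at hmc
    rcases eq_or_ne l 0 with hl0 | hl0
    · -- zero length: everything is at one point
      rw [hl0] at mx my mx' my'
      have g1 : gdx γ = 0 := abs_nonpos_iff.1 mx
      have g1' : gdx γ' = 0 := abs_nonpos_iff.1 mx'
      have g2 : gdy f γ = 0 := abs_nonpos_iff.1 my
      have g2' : gdy f γ' = 0 := abs_nonpos_iff.1 my'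
      have x0 : γ.1.1 = γ'.1.1 := by
        rw [gdx] at g1 g1'; unfold gx at ex
        linear_combination ex - t * g1 + t * g1'
      have x1 : γ.2.1 = γ'.2.1 := by
        rw [gdx] at g1 g1'; linarith
      have hb : |gdy f γ| ≤ |gdx γ| := by rw [g1, g2]
      have hb' : |gdy f γ'| ≤ |gdx γ'| := by rw [g1', g2']
      have A := H.hfib hΓ h h' hb hb' x0 x1 ht0 ht1 (congrArg Prod.snd he).le
      have B := H.hfib hΓ h' h hb' hb x0.symm x1.symm ht0 ht1 (congrArg Prod.snd he).ge
      exact Prod.ext (Prod.ext x0 (le_antisymm A.1 B.1)) (Prod.ext x1 (le_antisymm A.2 B.2))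
    · have lp : 0 < l := lt_of_le_of_ne dist_nonneg (Ne.symm hl0)
      have D1 := H.Gh_diff hγ' ht0.le ht1.le zero_le_one le_rfl
      have D2 := H.Gh_diff hγ (s := t) (t := 0) le_rfl zero_le_one ht0.le ht1.le
      have z0 : f (gx 0 γ) * (Gh f 0 γ).2 = f γ.1.1 * γ.1.2 := congrArg Prod.snd (H.PGh_zero hγ)
      have z1 : f (gx 1 γ') * (Gh f 1 γ').2 = f γ'.2.1 * γ'.2.2 := congrArg Prod.snd (H.PGh_one hγ')
      rw [z1, abs_of_pos s1, ← ex, ← he] at D1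
      rw [z0, sub_zero, abs_of_pos ht0] at D2
      have ob := om_bound k (gdx γ) (gdy f γ) H.kpos H.kle
      have ob' := om_bound k (gdx γ') (gdy f γ') H.kpos H.kle
      rw [hm] at ob
      rw [hm'] at ob'
      have ss : (f γ'.2.1 * γ'.2.2 - f (gx t γ) * (Gh f t γ).2) + (f (gx t γ) * (Gh f t γ).2 - f γ.1.1 * γ.1.2) =
        f γ'.2.1 * γ'.2.2 - f γ.1.1 * γ.1.2 := by ring
      rw [← ss] at hmc
      obtain ⟨q1, q2⟩ := abs_conv_eq' ht0 ht1 ob' ob D1 D2 hmc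
      have key : ∀ g : ZZ, max |gdx g| |gdy f g| = l → |gdy f g| + (1 - om (gdx g) (gdy f g)) * (2 * k * |gdx g|) = l →
          |gdx g| ≤ |gdy f g| ∧ |gdy f g| = l := by
        intro g hg1 hg2
        have : |gdx g| ≤ |gdy f g| := by
          by_contra hc
          push Not at hc
          have := om_bound_strict k _ _ H.kpos H.kle hc
          rw [max_eq_left hc.le] at hg1
          linarith
        exact ⟨this, by rwa [max_eq_right this] at hg1⟩
      obtain ⟨b1, b2⟩ := key γ hm q2
      obtain ⟨b1', b2'⟩ := key γ' hm' q1
      have n : gdy f γ ≠ 0 := by rw [← abs_pos, b2]; exact lp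
      have n' : gdy f γ' ≠ 0 := by rw [← abs_pos, b2']; exact lp
      have w : gw f γ = 1 := om_one _ _ b1 n
      have w' : gw f γ' = 1 := om_one _ _ b1' n'
      have Y := H.Gh_Y hγ ht0.le ht1.le
      have Y' := H.Gh_Y hγ' ht0.le ht1.le
      rw [w] at Y
      rw [w', ← he, ← ex] at Y'
      have ey : gy f t γ = gy f t γ' := by linarith
      have eyy : f γ'.2.1 * γ'.2.2 - f γ.1.1 * γ.1.2 = (1 - t) * gdy f γ' + t * gdy f γ := by
        have ey := ey
        unfold gy at ey; unfold gdy; linarith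
      rw [ss, eyy] at hmc
      obtain ⟨e1, -⟩ := abs_conv_eq ht0 ht1 b2'.le b2.le hmc
      have y0 : f γ.1.1 * γ.1.2 = f γ'.1.1 * γ'.1.2 := by
        rw [gdy, gdy] at e1; unfold gy at ey
        linear_combination ey + t * e1
      have y1 : f γ.2.1 * γ.2.2 = f γ'.2.1 * γ'.2.2 := by
        rw [gdy, gdy] at e1; linarith
      have A := H.vfib hΓ h h' b1 b1' n n' y0 y1 ht0 ht1 ex.le
      have B := H.vfib hΓ h' h b1' b1 n' n y0.symm y1.symm ht0 ht1 ex.ge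
      have x0 := le_antisymm A.1 B.1
      have x1 := le_antisymm A.2 B.2
      obtain ⟨p0, p1⟩ := H.f_pos_end hγ b1 n
      rw [← x0] at y0
      rw [← x1] at y1
      exact Prod.ext (Prod.ext x0 (mul_left_cancel₀ p0.ne' y0)) (Prod.ext x1 (mul_left_cancel₀ p1.ne' y1))

end FH

open MeasureTheory ProbabilityTheory Topology

lemma om_meas : Measurable fun p : ℝ × ℝ => om p.1 p.2 := by
  unfold om
  apply Measurable.ite
  · apply MeasurableSet.inter (s₁ := {p : ℝ × ℝ | |p.1| ≤ |p.2|}) (s₂ := {p : ℝ × ℝ | p.2 ≠ 0})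
    · exact measurableSet_le (by fun_prop) (by fun_prop)
    · exact (measurableSet_eq_fun measurable_snd measurable_const).compl
  · exact measurable_const
  · have h1 : Measurable fun a : ℝ × ℝ => 2 * |a.2| / |a.1| - 1 :=
      Measurable.sub (Measurable.div (by fun_prop) (by fun_prop)) measurable_const
    exact measurable_const.max h1

lemma om_zero (a b : ℝ) (h : |b| ≤ |a| / 2) : om a b = 0 := by
  unfold om
  rw [if_neg]
  · apply max_eq_left
    rcases eq_or_ne a 0 with e | e
    · simp [e]
    · have : 0 < |a| := abs_pos.2 e
      rw [sub_nonpos, div_le_one this]; linarith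
  · rintro ⟨h1, h2⟩
    have : 0 < |b| := abs_pos.2 h2
    linarith

lemma near_pair {P : ZZ → ZZ → Prop} (γ₀ : ZZ) (h : ∀ᶠ w : ZZ × ZZ in 𝓝 (γ₀, γ₀), P w.1 w.2) :
    ∃ U ∈ 𝓝 γ₀, ∀ γ ∈ U, ∀ γ' ∈ U, P γ γ' := by
  rw [nhds_prod_eq, Filter.Eventually, Filter.mem_prod_same_iff] at h
  obtain ⟨U, hU, h⟩ := h
  exact ⟨U, hU, fun γ a γ' b => h (Set.mk_mem_prod a b)⟩

lemma ineq_of_log {a0 a1 az t : ℝ} (h0 : 0 < a0) (h1 : 0 < a1) (hz : 0 < az)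
    (h : (1 - t) * Real.log a0 + t * Real.log a1 ≤ Real.log az) : a0 ^ (1 - t) * a1 ^ t ≤ az := by
  rw [Real.rpow_def_of_pos h0, Real.rpow_def_of_pos h1, ← Real.exp_add, ← Real.le_log_iff_exp_le hz]
  linarith

lemma log_Dn (K : ℝ) (p : ℝ × ℝ) : Real.log (Dn K p) = -K * p.2 ^ 2 := by
  unfold Dn; rw [Real.log_exp]

namespace FH

lemma Gh_meas {k : ℝ} {f f' φ : ℝ → ℝ} (H : FH k f f' φ) (t : ℝ) : Measurable (Gh f t) := by
  have hf := H.cont.measurable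
  have w : Measurable (gw f) := om_meas.comp (gdx_cont.measurable.prodMk H.gdy_cont.measurable)
  have a : Measurable (gx t) := by unfold gx; fun_prop
  have b : Measurable (gh t) := by unfold gh; fun_prop
  have c : Measurable (gy f t) := by unfold gy; fun_prop
  exact a.prodMk (((measurable_const.sub w).mul b).add (w.mul (c.div (hf.comp a))))

lemma Gh_V {k : ℝ} {f f' φ : ℝ → ℝ} (H : FH k f f' φ) {γ : ZZ} (t : ℝ) (h1 : |gdx γ| ≤ |gdy f γ|) (h2 : gdy f γ ≠ 0) : Gh f t γ = (gx t γ, gy f t γ / f (gx t γ)) := by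
  have w : gw f γ = 1 := om_one _ _ h1 h2
  simp [Gh, w]

lemma Gh_R1 {k : ℝ} {f f' φ : ℝ → ℝ} (H : FH k f f' φ) {γ : ZZ} (t : ℝ) (h1 : |gdy f γ| ≤ |gdx γ| / 2) : Gh f t γ = (gx t γ, gh t γ) := by
  have w : gw f γ = 0 := om_zero _ _ h1
  simp [Gh, w]

lemma gf_V {k : ℝ} {f f' φ : ℝ → ℝ} (H : FH k f f' φ) {γ : ZZ} {t : ℝ} (hγ : γ ∈ R2) (ht0 : 0 < t) (ht1 : t < 1) (h1 : |gdx γ| ≤ |gdy f γ|) (h2 : gdy f γ ≠ 0) : 0 < f (gx t γ) :=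
  H.gf_pos hγ ht0 ht1 (by rw [gw, om_one _ _ h1 h2]; exact one_pos)

lemma Gh_contV {k : ℝ} {f f' φ : ℝ → ℝ} (H : FH k f f' φ) (t : ℝ) (ht0 : 0 < t) (ht1 : t < 1) : ContinuousOn (Gh f t) {γ | γ ∈ R2 ∧ |gdx γ| ≤ |gdy f γ| ∧ gdy f γ ≠ 0} := by
  have hf := H.cont
  have a : Continuous (gx t) := by unfold gx; fun_prop
  have c : Continuous (gy f t) := by unfold gy; fun_prop
  refine ContinuousOn.congr (f := fun γ => (gx t γ, gy f t γ / f (gx t γ))) ?_ (fun γ h => H.Gh_V t h.2.1 h.2.2)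
  refine a.continuousOn.prodMk (c.continuousOn.div (hf.comp a).continuousOn ?_)
  intro γ h
  exact (H.gf_V h.1 ht0 ht1 h.2.1 h.2.2).ne'

lemma Gh_contR1 {k : ℝ} {f f' φ : ℝ → ℝ} (H : FH k f f' φ) (t : ℝ) : ContinuousOn (Gh f t) {γ | |gdy f γ| ≤ |gdx γ| / 2} := by
  have a : Continuous (gx t) := by unfold gx; fun_prop
  have b : Continuous (gh t) := by unfold gh; fun_prop
  exact ContinuousOn.congr (f := fun γ => (gx t γ, gh t γ)) (a.prodMk b).continuousOn (fun γ h => H.Gh_R1 t h)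

lemma gw_R2 {k : ℝ} {f f' φ : ℝ → ℝ} (H : FH k f f' φ) {γ : ZZ} (σ : ℝ) (hσ : σ = 1 ∨ σ = -1) (h : |gdx γ| / 2 < σ * gdy f γ ∧ σ * gdy f γ < |gdx γ|) : 0 < |gdx γ| ∧ 
    gw f γ = 2 * (σ * gdy f γ) / |gdx γ| - 1 ∧ 0 < gw f γ := by
  have e := (H.om_R2 _ _ σ hσ h.1 h.2).1
  have p : 0 < |gdx γ| := by linarith
  refine ⟨p, e, ?_⟩
  rw [gw, e, sub_pos, lt_div_iff₀ p]; linarith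

lemma Gh_contR2 {k : ℝ} {f f' φ : ℝ → ℝ} (H : FH k f f' φ) (t : ℝ) (ht0 : 0 < t) (ht1 : t < 1) (σ : ℝ) (hσ : σ = 1 ∨ σ = -1) :
    ContinuousOn (Gh f t) {γ | γ ∈ R2 ∧ |gdx γ| / 2 < σ * gdy f γ ∧ σ * gdy f γ < |gdx γ|} := by
  have hf := H.cont
  have a : Continuous (gx t) := by unfold gx; fun_prop
  have b : Continuous (gh t) := by unfold gh; fun_prop
  have c : Continuous (gy f t) := by unfold gy; fun_prop
  have d := gdx_cont
  have e := H.gdy_cont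
  have w : ContinuousOn (gw f) {γ | γ ∈ R2 ∧ |gdx γ| / 2 < σ * gdy f γ ∧ σ * gdy f γ < |gdx γ|} := by
    refine ContinuousOn.congr (f := fun γ => 2 * (σ * gdy f γ) / |gdx γ| - 1) ?_ (fun γ h => (H.gw_R2 σ hσ h.2).2.1)
    refine ContinuousOn.sub (ContinuousOn.div (by fun_prop) (by fun_prop) ?_) continuousOn_const
    intro γ h
    exact (H.gw_R2 σ hσ h.2).1.ne'
  refine a.continuousOn.prodMk (((continuousOn_const.sub w).mul b.continuousOn).add (w.mul (c.continuousOn.div (hf.comp a).continuousOn ?_)))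
  intro γ h
  exact (H.gf_pos h.1 ht0 ht1 (H.gw_R2 σ hσ h.2).2.2).ne'

lemma centerV {k : ℝ} {f f' φ : ℝ → ℝ} (H : FH k f f' φ) {γ : ZZ} {t K : ℝ} (hK : 1 ≤ K) (hγ : γ ∈ R2) (ht0 : 0 < t) (ht1 : t < 1) (h1 : |gdx γ| ≤ |gdy f γ|) (h2 : gdy f γ ≠ 0) :
    ((1 - t) / (1 - t)) ^ (1 - t) * (t / t) ^ t * ((Dn K γ.1 / f γ.1.1) ^ (1 - t) * (Dn K γ.2 / f γ.2.1) ^ t)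
      ≤ Dn K (Gh f t γ) / f (gx t γ) := by
  have s1 : 0 < 1 - t := by linarith
  obtain ⟨p0, p1⟩ := H.f_pos_end hγ h1 h2
  have w : 0 < gw f γ := by rw [gw, om_one _ _ h1 h2]; exact one_pos
  have ex : ∀ s, γ.1.1 + s * (γ.2.1 - γ.1.1) = gx s γ := fun s => by unfold gx; ring
  have ey : ∀ s, f γ.1.1 * γ.1.2 + s * (f γ.2.1 * γ.2.2 - f γ.1.1 * γ.1.2) = gy f s γ := fun s => by unfold gy; ring
  have V := H.vconv K γ.1.1 γ.2.1 (f γ.1.1 * γ.1.2) (f γ.2.1 * γ.2.2) hK hγ.1.1 hγ.2.1 h1 (by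
    intro s hs
    rw [ex]
    rcases hs.1.eq_or_lt with e | e
    · rw [← e]; simpa [gx] using p0
    rcases hs.2.eq_or_lt with e' | e'
    · rw [e']; simpa [gx] using p1
    exact H.gf_pos hγ e e' w) (by
    intro s hs
    rw [ey]
    exact H.gy_nonneg hγ hs.1 hs.2) (by
    intro s hs
    rw [ey, ex]
    exact H.gy_le hγ hs.1 hs.2 w)
  have pt := H.gf_V hγ ht0 ht1 h1 h2
  have V := V.2 (x := 0) (y := 1) ⟨le_rfl, zero_le_one⟩ ⟨zero_le_one, le_rfl⟩ s1.le ht0.le (by ring)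
  simp only [smul_eq_mul, mul_zero, mul_one, zero_add, ex, ey] at V
  have g0 : gx 0 γ = γ.1.1 := by simp [gx]
  have g1 : gx 1 γ = γ.2.1 := by simp [gx]
  have k0 : gy f 0 γ = f γ.1.1 * γ.1.2 := by simp [gy]
  have k1 : gy f 1 γ = f γ.2.1 * γ.2.2 := by simp [gy]
  rw [g0, g1, k0, k1, mul_div_cancel_left₀ _ p0.ne', mul_div_cancel_left₀ _ p1.ne'] at V
  rw [div_self s1.ne', div_self ht0.ne', Real.one_rpow, Real.one_rpow, one_mul, one_mul]
  apply ineq_of_log (div_pos (Dn_pos _ _) p0) (div_pos (Dn_pos _ _) p1) (div_pos (Dn_pos _ _) pt)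
  rw [Real.log_div (Dn_pos _ _).ne' p0.ne', Real.log_div (Dn_pos _ _).ne' p1.ne', Real.log_div (Dn_pos _ _).ne' pt.ne',
    log_Dn, log_Dn, log_Dn, H.Gh_V t h1 h2]
  simp only at V ⊢
  linarith

end FH

open MeasureTheory ProbabilityTheory Topology

def LLp (f : ℝ → ℝ) (K t : ℝ) (π : Measure ZZ) (r0 r1 : ℝ × ℝ → ENNReal) (S : Set ZZ) : Prop :=
  ∀ γ₀ ∈ S, ∀ E : ℝ, 1 < E → ∃ U ∈ 𝓝 γ₀, ∀ β0 β1 : NNReal, ∀ A : Set ZZ, IsCompact A →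
      A ⊆ U ∩ S → (∀ γ ∈ A, r0 γ.1 ≤ β0 ∧ r1 γ.2 ≤ β1) →
      π A ≤ ENNReal.ofReal E * ((β0 : ENNReal) ^ (1 - t) * (β1 : ENNReal) ^ t) * lam K (Gh f t '' A)

def pV (f : ℝ → ℝ) : Set ZZ := {γ | |gdx γ| < |gdy f γ|}
def pD (f : ℝ → ℝ) (σ : ℝ) : Set ZZ := {γ | gdx γ = σ * gdy f γ ∧ gdy f γ ≠ 0}
def pR (f : ℝ → ℝ) : Set ZZ := {γ | |gdy f γ| ≤ |gdx γ| / 2 ∧ gdx γ ≠ 0}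
def pS (f : ℝ → ℝ) : Set ZZ := {γ | |gdy f γ| ≤ |gdx γ| / 2 ∧ gdx γ = 0}
def pQ (f : ℝ → ℝ) (σ : ℝ) : Set ZZ := {γ | |gdx γ| / 2 < σ * gdy f γ ∧ σ * gdy f γ < |gdx γ|}

lemma sgn_le {a b t : ℝ} (ht0 : 0 < t) (ht1 : t < 1) (h : 0 ≤ a * b) (hs : (1 - t) * a + t * b ≤ 0) : a ≤ 0 ∧ b ≤ 0 := by
  have s1 : 0 < 1 - t := by linarith
  constructor
  · by_contra hc
    push Not at hc
    have hb : 0 ≤ b := by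
      by_contra h2
      push Not at h2
      nlinarith [mul_neg_of_pos_of_neg hc h2]
    have := mul_pos s1 hc
    have := mul_nonneg ht0.le hb
    linarith
  · by_contra hc
    push Not at hc
    have hb : 0 ≤ a := by
      by_contra h2
      push Not at h2
      nlinarith [mul_neg_of_pos_of_neg hc h2]
    have := mul_pos ht0 hc
    have := mul_nonneg s1.le hb
    linarith

namespace FH

lemma ll_V {k : ℝ} {f f' φ : ℝ → ℝ} (H : FH k f f' φ) {Γ : Set ZZ} (hΓ : Good f Γ) (K t : ℝ) (hK : 1 ≤ K) (ht0 : 0 < t) (ht1 : t < 1) (π : Measure ZZ) [IsFiniteMeasure π]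
    (r0 r1 : ℝ × ℝ → ENNReal) (hr0 : Measurable r0) (hr1 : Measurable r1)
    (hm0 : π.map Prod.fst = (lam K).withDensity r0) (hm1 : π.map Prod.snd = (lam K).withDensity r1) :
    LLp f K t π r0 r1 (pV f ∩ Γ) := by
  intro γ₀ h₀ E hE
  have s1 : 0 < 1 - t := by linarith
  have hf := H.cont
  have hle : ∀ γ ∈ pV f, |gdx γ| ≤ |gdy f γ| ∧ gdy f γ ≠ 0 := fun γ h =>
    ⟨le_of_lt h, abs_pos.1 ((abs_nonneg _).trans_lt h)⟩
  obtain ⟨U, hU, hUU⟩ := near_pair (P := fun γ γ' => |γ'.2.1 - γ.1.1| < |f γ'.2.1 * γ'.2.2 - f γ.1.1 * γ.1.2|) γ₀ (by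
    apply ContinuousAt.eventually_lt (by fun_prop) (by fun_prop)
    exact h₀.1)
  have hd : ∀ γ ∈ U, ∀ γ' ∈ U, dist (PP f γ.1) (PP f γ'.2) ^ 2 = (f γ'.2.1 * γ'.2.2 - f γ.1.1 * γ.1.2) ^ 2 := by
    intro γ a γ' b
    have e := PP_dist f (γ.1, γ'.2)
    rw [show |gdx (γ.1, γ'.2)| = |γ'.2.1 - γ.1.1| from rfl,
      show |gdy f (γ.1, γ'.2)| = |f γ'.2.1 * γ'.2.2 - f γ.1.1 * γ.1.2| from rfl, max_eq_right (hUU γ a γ' b).le] at e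
    change dist (PP f γ.1) (PP f γ'.2) = _ at e
    rw [e, sq_abs]
  obtain ⟨h1, h2⟩ := hle _ h₀.1
  have hR := hΓ.sub h₀.2
  obtain ⟨q0, q1⟩ := H.f_pos_end hR h1 h2
  refine local_lemma (H.chart_Ch 0 1 1 0 (by norm_num)) K π r0 r1 hr0 hr1 hm0 hm1 (Gh f t) (H.Gh_meas t) t ht0 ht1 (pV f ∩ Γ) γ₀ h₀
    ((H.Gh_contV t ht0 ht1).mono (fun γ h => ⟨hΓ.sub h.2, hle γ h.1⟩)) (fun γ h => H.Gh_mem (hΓ.sub h.2) ht0.le ht1.le)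
    q0 q1 (H.gf_V hR ht0 ht1 h1 h2) (1 - t) t s1 ht0 (H.centerV hK hR ht0 ht1 h1 h2) U hU ?_ ?_ ?_ E hE
  · rintro γ ⟨-, h, hg⟩
    obtain ⟨h1, h2⟩ := hle γ h
    have Y := H.Gh_Y (hΓ.sub hg) ht0.le ht1.le
    rw [gw, om_one _ _ h1 h2] at Y
    change 0 * gx t γ + 1 * (f (gx t γ) * (Gh f t γ).2) = (1 - t) * (0 * γ.1.1 + 1 * (f γ.1.1 * γ.1.2)) + t * (0 * γ.2.1 + 1 * (f γ.2.1 * γ.2.2))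
    rw [Y, gy]; ring
  · rintro γ ⟨u, -, hg⟩ γ' ⟨u', -, hg'⟩
    have P := hΓ.prim γ hg γ' hg'
    rw [hd γ u γ u, hd γ' u' γ' u', hd γ u γ' u', hd γ' u' γ u] at P
    simp only [Ch]
    linarith
  · rintro γ ⟨u, h, hg⟩ γ' ⟨u', h', hg'⟩ e0 e1 hx
    simp only [Ch, zero_mul, one_mul, zero_add, add_zero] at e0 e1 hx ⊢
    change gx t γ ≤ gx t γ' at hx
    obtain ⟨h1, h2⟩ := hle γ h
    obtain ⟨h1', h2'⟩ := hle γ' h'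
    obtain ⟨A, B⟩ := H.vfib hΓ hg hg' h1 h1' h2 h2' e0 e1 ht0 ht1 hx
    refine ⟨A, B, ?_⟩
    change _ ≤ gx t γ' - gx t γ
    unfold gx; linarith

lemma ll_D {k : ℝ} {f f' φ : ℝ → ℝ} (H : FH k f f' φ) {Γ : Set ZZ} (hΓ : Good f Γ) (K t : ℝ) (hK : 1 ≤ K) (ht0 : 0 < t) (ht1 : t < 1) (π : Measure ZZ) [IsFiniteMeasure π]
    (r0 r1 : ℝ × ℝ → ENNReal) (hr0 : Measurable r0) (hr1 : Measurable r1)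
    (hm0 : π.map Prod.fst = (lam K).withDensity r0) (hm1 : π.map Prod.snd = (lam K).withDensity r1) (σ : ℝ) (hσ : σ = 1 ∨ σ = -1) :
    LLp f K t π r0 r1 (pD f σ ∩ Γ) := by
  intro γ₀ h₀ E hE
  have s1 : 0 < 1 - t := by linarith
  have hf := H.cont
  have aσ : |σ| = 1 := by rcases hσ with h | h <;> rw [h] <;> norm_num
  have sσ : σ * σ = 1 := by rcases hσ with h | h <;> rw [h] <;> norm_num
  have hle : ∀ γ ∈ pD f σ, |gdx γ| ≤ |gdy f γ| ∧ gdy f γ ≠ 0 := fun γ h =>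
    ⟨by rw [h.1, abs_mul, aσ, one_mul], h.2⟩
  obtain ⟨h1, h2⟩ := hle _ h₀.1
  have hR := hΓ.sub h₀.2
  obtain ⟨q0, q1⟩ := H.f_pos_end hR h1 h2
  have hu : ∀ γ ∈ pD f σ, γ.2.1 - σ * (f γ.2.1 * γ.2.2) = γ.1.1 - σ * (f γ.1.1 * γ.1.2) := by
    intro γ h
    have := h.1
    unfold gdx gdy at this
    linarith
  refine local_lemma (H.chart_Ch 1 (-σ) 1 0 (by simpa using aσ)) K π r0 r1 hr0 hr1 hm0 hm1 (Gh f t) (H.Gh_meas t) t ht0 ht1 (pD f σ ∩ Γ) γ₀ h₀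
    ((H.Gh_contV t ht0 ht1).mono (fun γ h => ⟨hΓ.sub h.2, hle γ h.1⟩)) (fun γ h => H.Gh_mem (hΓ.sub h.2) ht0.le ht1.le)
    q0 q1 (H.gf_V hR ht0 ht1 h1 h2) (1 - t) t s1 ht0 (H.centerV hK hR ht0 ht1 h1 h2) Set.univ Filter.univ_mem ?_ ?_ ?_ E hE
  · rintro γ ⟨-, h, hg⟩
    obtain ⟨h1, h2⟩ := hle γ h
    have Y := H.Gh_Y (hΓ.sub hg) ht0.le ht1.le
    rw [gw, om_one _ _ h1 h2] at Y
    change 1 * gx t γ + -σ * (f (gx t γ) * (Gh f t γ).2) = (1 - t) * (1 * γ.1.1 + -σ * (f γ.1.1 * γ.1.2)) + t * (1 * γ.2.1 + -σ * (f γ.2.1 * γ.2.2))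
    rw [Y, gy, gx]; ring
  · rintro γ ⟨-, h, -⟩ γ' ⟨-, h', -⟩
    have a := hu γ h
    have a' := hu γ' h'
    have e : (Ch f 1 (-σ) 1 0 γ.2).1 = (Ch f 1 (-σ) 1 0 γ.1).1 := by simp only [Ch]; linarith
    have e' : (Ch f 1 (-σ) 1 0 γ'.2).1 = (Ch f 1 (-σ) 1 0 γ'.1).1 := by simp only [Ch]; linarith
    rw [e, e']
    exact mul_self_nonneg _
  · rintro γ ⟨-, h, hg⟩ γ' ⟨-, h', hg'⟩ e0 e1 hx
    simp only [Ch, zero_mul, one_mul, add_zero] at e0 e1 hx ⊢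
    change gx t γ ≤ gx t γ' at hx
    have a := hu γ h
    have a' := hu γ' h'
    have hd : ∀ p q : ℝ × ℝ, q.1 - σ * (f q.1 * q.2) = p.1 - σ * (f p.1 * p.2) → dist (PP f p) (PP f q) ^ 2 = (q.1 - p.1) ^ 2 := by
      intro p q hpq
      have e := PP_dist f (p, q)
      have e2 : gdx (p, q) = σ * gdy f (p, q) := by simp only [gdx, gdy]; linarith
      have e3 : |gdy f (p, q)| = |gdx (p, q)| := by rw [e2, abs_mul, aσ, one_mul]
      rw [e3, max_self] at e
      change dist (PP f p) (PP f q) = _ at e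
      rw [e, sq_abs]; rfl
    have P := hΓ.prim γ hg γ' hg'
    rw [hd _ _ a, hd _ _ a', hd _ _ (by linarith), hd _ _ (by linarith)] at P
    have P2 : 0 ≤ (γ.1.1 - γ'.1.1) * (γ.2.1 - γ'.2.1) := by linarith
    unfold gx at hx
    obtain ⟨A, B⟩ := sgn_le ht0 ht1 P2 (by linarith)
    refine ⟨by linarith, by linarith, ?_⟩
    change _ ≤ gx t γ' - gx t γ
    unfold gx; linarith

lemma ll_R' {k : ℝ} {f f' φ : ℝ → ℝ} (H : FH k f f' φ) {Γ : Set ZZ} (hΓ : Good f Γ) (K t : ℝ) (hK : 1 ≤ K) (ht0 : 0 < t) (ht1 : t < 1) (π : Measure ZZ) [IsFiniteMeasure π]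
    (r0 r1 : ℝ × ℝ → ENNReal) (hr0 : Measurable r0) (hr1 : Measurable r1)
    (hm0 : π.map Prod.fst = (lam K).withDensity r0) (hm1 : π.map Prod.snd = (lam K).withDensity r1) 
    (S : Set ZZ) (hS : ∀ γ ∈ S, |gdy f γ| ≤ |gdx γ| / 2) 
    (hmono : ∀ γ₀ ∈ S ∩ Γ, ∃ U ∈ 𝓝 γ₀, ∀ γ ∈ U ∩ (S ∩ Γ), ∀ γ' ∈ U ∩ (S ∩ Γ), 0 ≤ (γ.1.1 - γ'.1.1) * (γ.2.1 - γ'.2.1)) :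
    LLp f K t π r0 r1 (S ∩ Γ) := by
  intro γ₀ h₀ E hE
  have s1 : 0 < 1 - t := by linarith
  have hS' : ∀ γ ∈ S, |gdy f γ| ≤ |gdx γ| := fun γ h => (hS γ h).trans (by linarith [abs_nonneg (gdx γ)])
  obtain ⟨U, hU, hUU⟩ := hmono γ₀ h₀
  refine local_lemma chart_id K π r0 r1 hr0 hr1 hm0 hm1 (Gh f t) (H.Gh_meas t) t ht0 ht1 (S ∩ Γ) γ₀ h₀
    ((H.Gh_contR1 t).mono (fun γ h => hS γ h.1)) (fun γ h => H.Gh_mem (hΓ.sub h.2) ht0.le ht1.le)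
    one_pos one_pos one_pos (1 - t) t s1 ht0 ?_ U hU ?_ hUU ?_ E hE
  · rw [div_self s1.ne', div_self ht0.ne', Real.one_rpow, Real.one_rpow, one_mul, one_mul, div_one, div_one, div_one]
    apply ineq_of_log (Dn_pos _ _) (Dn_pos _ _) (Dn_pos _ _)
    rw [log_Dn, log_Dn, log_Dn, H.Gh_R1 t (hS γ₀ h₀.1)]
    simp only [gh]
    have : 0 ≤ K * (t * (1 - t) * (γ₀.1.2 - γ₀.2.2) ^ 2) := by positivity
    linarith
  · rintro γ ⟨-, h, hg⟩
    rfl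
  · rintro γ ⟨u, h, hg⟩ γ' ⟨u', h', hg'⟩ e0 e1 hx
    simp only [id] at e0 e1 hx ⊢
    obtain ⟨A, B⟩ := H.hfib hΓ hg hg' (hS' γ h) (hS' γ' h') e0 e1 ht0 ht1 hx
    refine ⟨A, B, ?_⟩
    rw [H.Gh_R1 t (hS γ h), H.Gh_R1 t (hS γ' h')]
    simp only [gh]; linarith

lemma hmono_x {k : ℝ} {f f' φ : ℝ → ℝ} (H : FH k f f' φ) {Γ : Set ZZ} (hΓ : Good f Γ) (γ₀ : ZZ) (h₀ : |gdy f γ₀| < |gdx γ₀|) :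
    ∃ U ∈ 𝓝 γ₀, ∀ γ ∈ U ∩ Γ, ∀ γ' ∈ U ∩ Γ, 0 ≤ (γ.1.1 - γ'.1.1) * (γ.2.1 - γ'.2.1) := by
  have hf := H.cont
  obtain ⟨U, hU, hUU⟩ := near_pair (P := fun γ γ' => |f γ'.2.1 * γ'.2.2 - f γ.1.1 * γ.1.2| < |γ'.2.1 - γ.1.1|) γ₀ (by
    apply ContinuousAt.eventually_lt (by fun_prop) (by fun_prop)
    exact h₀)
  have hd : ∀ γ ∈ U, ∀ γ' ∈ U, dist (PP f γ.1) (PP f γ'.2) ^ 2 = (γ'.2.1 - γ.1.1) ^ 2 := by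
    intro γ a γ' b
    have e := PP_dist f (γ.1, γ'.2)
    rw [show |gdx (γ.1, γ'.2)| = |γ'.2.1 - γ.1.1| from rfl,
      show |gdy f (γ.1, γ'.2)| = |f γ'.2.1 * γ'.2.2 - f γ.1.1 * γ.1.2| from rfl, max_eq_left (hUU γ a γ' b).le] at e
    change dist (PP f γ.1) (PP f γ'.2) = _ at e
    rw [e, sq_abs]
  refine ⟨U, hU, ?_⟩
  rintro γ ⟨u, hg⟩ γ' ⟨u', hg'⟩
  have P := hΓ.prim γ hg γ' hg'
  rw [hd γ u γ u, hd γ' u' γ' u', hd γ u γ' u', hd γ' u' γ u] at P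
  linarith

lemma ll_R {k : ℝ} {f f' φ : ℝ → ℝ} (H : FH k f f' φ) {Γ : Set ZZ} (hΓ : Good f Γ) (K t : ℝ) (hK : 1 ≤ K) (ht0 : 0 < t) (ht1 : t < 1) (π : Measure ZZ) [IsFiniteMeasure π]
    (r0 r1 : ℝ × ℝ → ENNReal) (hr0 : Measurable r0) (hr1 : Measurable r1)
    (hm0 : π.map Prod.fst = (lam K).withDensity r0) (hm1 : π.map Prod.snd = (lam K).withDensity r1) :
    LLp f K t π r0 r1 (pR f ∩ Γ) := by
  refine H.ll_R' hΓ K t hK ht0 ht1 π r0 r1 hr0 hr1 hm0 hm1 _ (fun γ h => h.1) ?_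
  intro γ₀ h₀
  obtain ⟨U, hU, h⟩ := H.hmono_x hΓ γ₀ (lt_of_le_of_lt h₀.1.1 (by linarith [abs_pos.2 h₀.1.2]))
  exact ⟨U, hU, fun γ a γ' b => h γ ⟨a.1, a.2.2⟩ γ' ⟨b.1, b.2.2⟩⟩

lemma ll_S {k : ℝ} {f f' φ : ℝ → ℝ} (H : FH k f f' φ) {Γ : Set ZZ} (hΓ : Good f Γ) (K t : ℝ) (hK : 1 ≤ K) (ht0 : 0 < t) (ht1 : t < 1) (π : Measure ZZ) [IsFiniteMeasure π]
    (r0 r1 : ℝ × ℝ → ENNReal) (hr0 : Measurable r0) (hr1 : Measurable r1)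
    (hm0 : π.map Prod.fst = (lam K).withDensity r0) (hm1 : π.map Prod.snd = (lam K).withDensity r1) :
    LLp f K t π r0 r1 (pS f ∩ Γ) := by
  refine H.ll_R' hΓ K t hK ht0 ht1 π r0 r1 hr0 hr1 hm0 hm1 _ (fun γ h => h.1) ?_
  intro γ₀ h₀
  refine ⟨Set.univ, Filter.univ_mem, ?_⟩
  rintro γ ⟨-, h, -⟩ γ' ⟨-, h', -⟩
  have e : γ.2.1 = γ.1.1 := sub_eq_zero.1 h.2
  have e' : γ'.2.1 = γ'.1.1 := sub_eq_zero.1 h'.2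
  rw [e, e']
  exact mul_self_nonneg _

lemma ll_Q {k : ℝ} {f f' φ : ℝ → ℝ} (H : FH k f f' φ) {Γ : Set ZZ} (hΓ : Good f Γ) (K t : ℝ) (hK : 1 ≤ K) (ht0 : 0 < t) (ht1 : t < 1) (π : Measure ZZ) [IsFiniteMeasure π]
    (r0 r1 : ℝ × ℝ → ENNReal) (hr0 : Measurable r0) (hr1 : Measurable r1)
    (hm0 : π.map Prod.fst = (lam K).withDensity r0) (hm1 : π.map Prod.snd = (lam K).withDensity r1) (σ : ℝ) (hσ : σ = 1 ∨ σ = -1) :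
    LLp f K t π r0 r1 (pQ f σ ∩ Γ) := by
  intro γ₀ h₀ E hE
  have s1 : 0 < 1 - t := by linarith
  have hf := H.cont
  have hS' : ∀ γ ∈ pQ f σ, |gdy f γ| < |gdx γ| := fun γ h => by
    rw [(H.om_R2 _ _ σ hσ h.1 h.2).2]; exact h.2
  have hR := hΓ.sub h₀.2
  obtain ⟨a0, w0, wp⟩ := H.gw_R2 σ hσ h₀.1
  have ft := H.gf_pos hR ht0 ht1 wp
  obtain ⟨c0, hc0⟩ : ∃ c0, c0 = (1 - t) + gw f γ₀ * ((1 - t) * (f γ₀.1.1 / f (gx t γ₀) - 1)) -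
        2 * σ * (gy f t γ₀ / f (gx t γ₀) - gh t γ₀) / |gdx γ₀| * f γ₀.1.1 := ⟨_, rfl⟩
  obtain ⟨c1, hc1⟩ : ∃ c1, c1 = t + gw f γ₀ * (t * (f γ₀.2.1 / f (gx t γ₀) - 1)) +
        2 * σ * (gy f t γ₀ / f (gx t γ₀) - gh t γ₀) / |gdx γ₀| * f γ₀.2.1 := ⟨_, rfl⟩
  obtain ⟨c0p, c1p, hs⟩ := H.R2_slack hR σ t K hσ ht0 ht1 hK h₀.1.1 h₀.1.2 c0 c1 hc0 hc1
  obtain ⟨δ, hδ⟩ : ∃ δ, δ = -((1 - t) * Real.log ((1 - t) / c0) + t * Real.log (t / c1) +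
      K * (((Gh f t γ₀).2) ^ 2 - (1 - t) * γ₀.1.2 ^ 2 - t * γ₀.2.2 ^ 2)) := ⟨_, rfl⟩
  have δp : 0 < δ := by rw [hδ]; linarith
  have eδ : Real.exp (-δ) < 1 := by rw [Real.exp_lt_one_iff]; linarith
  have eδ0 := Real.exp_pos (-δ)
  have P0p : 0 < c0 * Real.exp (-δ) := by positivity
  have P1p : 0 < c1 * Real.exp (-δ) := by positivity
  obtain ⟨U1, hU1, hm⟩ := H.hmono_x hΓ γ₀ (hS' γ₀ h₀.1)
  have ca : Continuous (gx t) := by unfold gx; fun_prop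
  have cb : Continuous (gh t) := by unfold gh; fun_prop
  have cc : Continuous (gy f t) := by unfold gy; fun_prop
  have cd := gdx_cont
  have ce := H.gdy_cont
  obtain ⟨U2, hU2, hP0⟩ := near_pair (P := fun γ γ' => c0 * Real.exp (-δ) < (1 - t) + (2 * (σ * gdy f γ') / |gdx γ'| - 1) * ((1 - t) * (f γ.1.1 / f (gx t γ) - 1)) -
        2 * σ * (gy f t γ / f (gx t γ) - gh t γ) / |gdx γ| * f γ.1.1) γ₀ (by
    apply ContinuousAt.eventually_lt (by fun_prop)
    · fun_prop (disch := first | exact ft.ne' | exact a0.ne')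
    · rw [← w0, ← hc0]; exact mul_lt_of_lt_one_right c0p eδ)
  obtain ⟨U3, hU3, hP1⟩ := near_pair (P := fun γ γ' => c1 * Real.exp (-δ) < t + (2 * (σ * gdy f γ') / |gdx γ'| - 1) * (t * (f γ.2.1 / f (gx t γ) - 1)) +
        2 * σ * (gy f t γ / f (gx t γ) - gh t γ) / |gdx γ| * f γ.2.1) γ₀ (by
    apply ContinuousAt.eventually_lt (by fun_prop)
    · fun_prop (disch := first | exact ft.ne' | exact a0.ne')
    · rw [← w0, ← hc1]; exact mul_lt_of_lt_one_right c1p eδ)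
  refine local_lemma chart_id K π r0 r1 hr0 hr1 hm0 hm1 (Gh f t) (H.Gh_meas t) t ht0 ht1 (pQ f σ ∩ Γ) γ₀ h₀
    ((H.Gh_contR2 t ht0 ht1 σ hσ).mono (fun γ h => ⟨hΓ.sub h.2, h.1⟩)) (fun γ h => H.Gh_mem (hΓ.sub h.2) ht0.le ht1.le)
    one_pos one_pos one_pos (c0 * Real.exp (-δ)) (c1 * Real.exp (-δ)) P0p P1p ?_ (U1 ∩ U2 ∩ U3) 
    (Filter.inter_mem (Filter.inter_mem hU1 hU2) hU3) ?_ ?_ ?_ E hE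
  · rw [div_one, div_one, div_one]
    have d0 := Dn_pos K γ₀.1
    have d1 := Dn_pos K γ₀.2
    have r0 : 0 < (1 - t) / (c0 * Real.exp (-δ)) := by positivity
    have r1 : 0 < t / (c1 * Real.exp (-δ)) := by positivity
    have e : ((1 - t) / (c0 * Real.exp (-δ))) ^ (1 - t) * (t / (c1 * Real.exp (-δ))) ^ t * (Dn K γ₀.1 ^ (1 - t) * Dn K γ₀.2 ^ t)
      = ((1 - t) / (c0 * Real.exp (-δ)) * Dn K γ₀.1) ^ (1 - t) * (t / (c1 * Real.exp (-δ)) * Dn K γ₀.2) ^ t := by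
      rw [Real.mul_rpow r0.le d0.le, Real.mul_rpow r1.le d1.le]; ring
    rw [e]
    apply ineq_of_log (by positivity) (by positivity) (Dn_pos _ _)
    rw [Real.log_mul r0.ne' d0.ne', Real.log_mul r1.ne' d1.ne', log_Dn, log_Dn, log_Dn, ← div_div, ← div_div,
      Real.log_div (div_pos s1 c0p).ne' eδ0.ne', Real.log_div (div_pos ht0 c1p).ne' eδ0.ne', Real.log_exp]
    linarith
  · rintro γ ⟨-, h, hg⟩
    rfl
  · rintro γ ⟨⟨⟨u, -⟩, -⟩, -, hg⟩ γ' ⟨⟨⟨u', -⟩, -⟩, -, hg'⟩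
    exact hm γ ⟨u, hg⟩ γ' ⟨u', hg'⟩
  · rintro γ ⟨⟨⟨-, u2⟩, u3⟩, h, hg⟩ γ' ⟨⟨⟨-, u2'⟩, u3'⟩, h', hg'⟩ e0 e1 hx
    simp only [id] at e0 e1 hx ⊢
    obtain ⟨A, B⟩ := H.hfib hΓ hg hg' (hS' γ h).le (hS' γ' h').le e0 e1 ht0 ht1 hx
    refine ⟨A, B, ?_⟩
    rw [H.R2_incr e0 e1 σ t hσ h.1 h.2 h'.1 h'.2, (H.gw_R2 σ hσ h').2.1]
    exact add_le_add (mul_le_mul_of_nonneg_right (hP0 γ u2 γ' u2').le (sub_nonneg.2 A))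
      (mul_le_mul_of_nonneg_right (hP1 γ u3 γ' u3').le (sub_nonneg.2 B))

end FH

open MeasureTheory ProbabilityTheory Topology

lemma pieces_cov (f : ℝ → ℝ) (γ : ZZ) : γ ∈ pV f ∨ γ ∈ pD f 1 ∨ γ ∈ pD f (-1) ∨ γ ∈ pR f ∨ γ ∈ pS f ∨ γ ∈ pQ f 1 ∨ γ ∈ pQ f (-1) := by
  rcases lt_trichotomy |gdx γ| |gdy f γ| with h | h | h
  · exact Or.inl h
  · rcases eq_or_ne (gdy f γ) 0 with e | e
    · rw [e, abs_zero, abs_eq_zero] at h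
      refine Or.inr (Or.inr (Or.inr (Or.inr (Or.inl ⟨?_, h⟩))))
      rw [e, h]; simp
    · rcases abs_eq_abs.1 h with h | h
      · exact Or.inr (Or.inl ⟨by rw [h, one_mul], e⟩)
      · exact Or.inr (Or.inr (Or.inl ⟨by rw [h]; ring, e⟩))
  · rcases le_or_gt |gdy f γ| (|gdx γ| / 2) with h2 | h2
    · have : gdx γ ≠ 0 := abs_pos.1 ((abs_nonneg _).trans_lt h)
      exact Or.inr (Or.inr (Or.inr (Or.inl ⟨h2, this⟩)))
    · rcases abs_cases (gdy f γ) with ⟨e, -⟩ | ⟨e, -⟩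
      · refine Or.inr (Or.inr (Or.inr (Or.inr (Or.inr (Or.inl ⟨?_, ?_⟩)))))
        · rw [e] at h2; simpa using h2
        · rw [e] at h; simpa using h
      · refine Or.inr (Or.inr (Or.inr (Or.inr (Or.inr (Or.inr ⟨?_, ?_⟩)))))
        · rw [e] at h2; simpa using h2
        · rw [e] at h; simpa using h

namespace FH

lemma interp {k : ℝ} {f f' φ : ℝ → ℝ} (H : FH k f f' φ) {Γ : Set ZZ} (hΓ : Good f Γ) (K t : ℝ) (hK : 1 ≤ K) (ht0 : 0 < t) (ht1 : t < 1) (π : Measure ZZ) [IsFiniteMeasure π]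
    (r0 r1 : ℝ × ℝ → ENNReal) (hr0 : Measurable r0) (hr1 : Measurable r1)
    (hm0 : π.map Prod.fst = (lam K).withDensity r0) (hm1 : π.map Prod.snd = (lam K).withDensity r1) 
    (hf0 : ∀ᵐ γ ∂π, r0 γ.1 < ⊤) (hf1 : ∀ᵐ γ ∂π, r1 γ.2 < ⊤) (hΓ0 : π Γᶜ = 0) :
    π.map (Gh f t) ≪ lam K ∧ ∀ᵐ γ ∂π, (π.map (Gh f t)).rnDeriv (lam K) (Gh f t γ) ≤ r0 γ.1 ^ (1 - t) * r1 γ.2 ^ t := by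
  have cd := gdx_cont.measurable
  have ce := H.gdy_cont.measurable
  refine global_lemma (lam K) π r0 r1 hr0 hr1 hf0 hf1 (Gh f t) (H.Gh_meas t) t ht0 ht1 Γ hΓ.meas hΓ0 (H.Gh_inj hΓ ht0 ht1)
    (S := ![pV f, pD f 1, pD f (-1), pR f, pS f, pQ f 1, pQ f (-1)]) ?_ ?_ ?_
  · have mD : ∀ σ, MeasurableSet (pD f σ) := fun σ => by
      apply MeasurableSet.inter (s₁ := {γ : ZZ | gdx γ = σ * gdy f γ}) (s₂ := {γ : ZZ | gdy f γ ≠ 0})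
      · exact measurableSet_eq_fun cd (by fun_prop)
      · exact (measurableSet_eq_fun ce measurable_const).compl
    have mQ : ∀ σ, MeasurableSet (pQ f σ) := fun σ => by
      apply MeasurableSet.inter (s₁ := {γ : ZZ | |gdx γ| / 2 < σ * gdy f γ}) (s₂ := {γ : ZZ | σ * gdy f γ < |gdx γ|})
      · exact measurableSet_lt (by fun_prop) (by fun_prop)
      · exact measurableSet_lt (by fun_prop) (by fun_prop)
    have mA : MeasurableSet {γ : ZZ | |gdy f γ| ≤ |gdx γ| / 2} := measurableSet_le (by fun_prop) (by fun_prop)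
    have mB : MeasurableSet {γ : ZZ | gdx γ = 0} := measurableSet_eq_fun cd measurable_const
    intro i
    fin_cases i
    · exact measurableSet_lt (by fun_prop) (by fun_prop)
    · exact mD 1
    · exact mD (-1)
    · exact mA.inter mB.compl
    · exact mA.inter mB
    · exact mQ 1
    · exact mQ (-1)
  · intro γ _
    rcases pieces_cov f γ with h | h | h | h | h | h | h
    exacts [⟨0, h⟩, ⟨1, h⟩, ⟨2, h⟩, ⟨3, h⟩, ⟨4, h⟩, ⟨5, h⟩, ⟨6, h⟩]
  · intro i
    fin_cases i
    · exact H.ll_V hΓ K t hK ht0 ht1 π r0 r1 hr0 hr1 hm0 hm1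
    · exact H.ll_D hΓ K t hK ht0 ht1 π r0 r1 hr0 hr1 hm0 hm1 1 (Or.inl rfl)
    · exact H.ll_D hΓ K t hK ht0 ht1 π r0 r1 hr0 hr1 hm0 hm1 (-1) (Or.inr rfl)
    · exact H.ll_R hΓ K t hK ht0 ht1 π r0 r1 hr0 hr1 hm0 hm1
    · exact H.ll_S hΓ K t hK ht0 ht1 π r0 r1 hr0 hr1 hm0 hm1
    · exact H.ll_Q hΓ K t hK ht0 ht1 π r0 r1 hr0 hr1 hm0 hm1 1 (Or.inl rfl)
    · exact H.ll_Q hΓ K t hK ht0 ht1 π r0 r1 hr0 hr1 hm0 hm1 (-1) (Or.inr rfl)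

end FH

lemma ent_interp (l : Measure (ℝ × ℝ)) [IsFiniteMeasure l] (P : ℝ × ℝ → ℝ × ℝ) (hP : Measurable P) (m : Measure (ℝ × ℝ))
    (hm : m = l.map P) (μ0 μ1 : Measure (ℝ × ℝ)) [IsProbabilityMeasure μ0] [IsProbabilityMeasure μ1] (ac0 : μ0 ≪ m) (ac1 : μ1 ≪ m)
    (i0 : Integrable (llr μ0 m) μ0) (i1 : Integrable (llr μ1 m) μ1) (π : Measure ZZ) [IsProbabilityMeasure π]
    (p0 : π.map (fun γ => P γ.1) = μ0) (p1 : π.map (fun γ => P γ.2) = μ1) (G : ZZ → ℝ × ℝ) (hG : Measurable G) (t : ℝ)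
    (ac : π.map G ≪ l)
    (hb : ∀ᵐ γ ∂π, (π.map G).rnDeriv l (G γ) ≤ μ0.rnDeriv m (P γ.1) ^ (1 - t) * μ1.rnDeriv m (P γ.2) ^ t) :
    (π.map G).map P ≪ m ∧ Integrable (llr ((π.map G).map P) m) ((π.map G).map P) ∧
    ∫ z, llr ((π.map G).map P) m z ∂((π.map G).map P) ≤ (1 - t) * ∫ z, llr μ0 m z ∂μ0 + t * ∫ z, llr μ1 m z ∂μ1 := by
  have q0 : Measurable fun γ : ZZ => P γ.1 := hP.comp measurable_fst
  have q1 : Measurable fun γ : ZZ => P γ.2 := hP.comp measurable_snd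
  have fm : IsFiniteMeasure m := by rw [hm]; infer_instance
  have pn : IsProbabilityMeasure (π.map G) := Measure.isProbabilityMeasure_map hG.aemeasurable
  have pn' : IsProbabilityMeasure ((π.map G).map P) := Measure.isProbabilityMeasure_map hP.aemeasurable
  have j0 : Integrable (fun γ : ZZ => llr μ0 m (P γ.1)) π := by
    rw [← p0] at i0
    have := (integrable_map_measure i0.1 q0.aemeasurable).1 i0
    rw [p0] at this; exact this
  have j1 : Integrable (fun γ : ZZ => llr μ1 m (P γ.2)) π := by
    rw [← p1] at i1
    have := (integrable_map_measure i1.1 q1.aemeasurable).1 i1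
    rw [p1] at this; exact this
  have k0 : ∫ γ, llr μ0 m (P γ.1) ∂π = ∫ z, llr μ0 m z ∂μ0 := by
    conv_rhs => rw [← p0]
    rw [integral_map q0.aemeasurable, p0]
    rw [p0]; exact i0.1
  have k1 : ∫ γ, llr μ1 m (P γ.2) ∂π = ∫ z, llr μ1 m z ∂μ1 := by
    conv_rhs => rw [← p1]
    rw [integral_map q1.aemeasurable, p1]
    rw [p1]; exact i1.1
  have a0 : ∀ᵐ γ ∂π, 0 < μ0.rnDeriv m (P γ.1) ∧ μ0.rnDeriv m (P γ.1) < ⊤ := by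
    have : ∀ᵐ z ∂μ0, 0 < μ0.rnDeriv m z ∧ μ0.rnDeriv m z < ⊤ := (Measure.rnDeriv_pos ac0).and (ac0.ae_le (Measure.rnDeriv_lt_top μ0 m))
    have h2 : ∀ᵐ z ∂(π.map (fun γ => P γ.1)), 0 < μ0.rnDeriv m z ∧ μ0.rnDeriv m z < ⊤ := by rw [p0]; exact this
    exact ae_of_ae_map q0.aemeasurable h2
  have a1 : ∀ᵐ γ ∂π, 0 < μ1.rnDeriv m (P γ.2) ∧ μ1.rnDeriv m (P γ.2) < ⊤ := by
    have : ∀ᵐ z ∂μ1, 0 < μ1.rnDeriv m z ∧ μ1.rnDeriv m z < ⊤ := (Measure.rnDeriv_pos ac1).and (ac1.ae_le (Measure.rnDeriv_lt_top μ1 m))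
    have h2 : ∀ᵐ z ∂(π.map (fun γ => P γ.2)), 0 < μ1.rnDeriv m z ∧ μ1.rnDeriv m z < ⊤ := by rw [p1]; exact this
    exact ae_of_ae_map q1.aemeasurable h2
  have az : ∀ᵐ γ ∂π, 0 < (π.map G).rnDeriv l (G γ) := ae_of_ae_map hG.aemeasurable (Measure.rnDeriv_pos ac)
  have key : ∀ᵐ γ ∂π, llr (π.map G) l (G γ) ≤ (1 - t) * llr μ0 m (P γ.1) + t * llr μ1 m (P γ.2) := by
    filter_upwards [hb, a0, a1, az] with γ hb a0 a1 az
    have s0 := ENNReal.toReal_pos a0.1.ne' a0.2.ne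
    have s1 := ENNReal.toReal_pos a1.1.ne' a1.2.ne
    have fin : μ0.rnDeriv m (P γ.1) ^ (1 - t) * μ1.rnDeriv m (P γ.2) ^ t ≠ ⊤ :=
      ENNReal.mul_ne_top (ENNReal.rpow_ne_top_of_ne_zero a0.1.ne' a0.2.ne) (ENNReal.rpow_ne_top_of_ne_zero a1.1.ne' a1.2.ne)
    have h2 := ENNReal.toReal_mono fin hb
    rw [ENNReal.toReal_mul, ← ENNReal.toReal_rpow, ← ENNReal.toReal_rpow] at h2
    have h3 := Real.log_le_log (ENNReal.toReal_pos az.ne' (ne_top_of_le_ne_top fin hb)) h2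
    rw [Real.log_mul (Real.rpow_pos_of_pos s0 _).ne' (Real.rpow_pos_of_pos s1 _).ne', Real.log_rpow s0, Real.log_rpow s1] at h3
    exact h3
  have jF : Integrable (fun γ : ZZ => (1 - t) * llr μ0 m (P γ.1) + t * llr μ1 m (P γ.2)) π := (j0.const_mul _).add (j1.const_mul _)
  have lm : Measurable (llr (π.map G) l) := measurable_llr _ _
  have kl : InformationTheory.klDiv (π.map G) l ≠ ⊤ := by
    rw [InformationTheory.klDiv_eq_lintegral_klFun_of_ac ac]
    have : ∫⁻ x, ENNReal.ofReal (InformationTheory.klFun ((π.map G).rnDeriv l x).toReal) ∂l ≤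
        ∫⁻ x, ((π.map G).rnDeriv l x * ENNReal.ofReal (llr (π.map G) l x) + 1) ∂l := by
      apply lintegral_mono_ae
      filter_upwards [Measure.rnDeriv_lt_top (π.map G) l] with x hx
      unfold llr InformationTheory.klFun
      generalize (π.map G).rnDeriv l x = u at *
      conv_rhs => rw [← ENNReal.ofReal_toReal hx.ne]
      rw [← ENNReal.ofReal_mul ENNReal.toReal_nonneg, ← ENNReal.ofReal_one]
      refine (ENNReal.ofReal_le_ofReal ?_).trans ENNReal.ofReal_add_le
      rw [ENNReal.toReal_ofReal ENNReal.toReal_nonneg]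
      linarith [ENNReal.toReal_nonneg (a := u)]
    refine ne_top_of_le_ne_top ?_ this
    rw [lintegral_add_right _ measurable_const]
    refine ENNReal.add_ne_top.2 ⟨?_, by simp⟩
    have e : ∫⁻ x, (π.map G).rnDeriv l x * ENNReal.ofReal (llr (π.map G) l x) ∂l = ∫⁻ x, ENNReal.ofReal (llr (π.map G) l x) ∂(π.map G) := by
      conv_rhs => rw [← Measure.withDensity_rnDeriv_eq _ _ ac]
      rw [lintegral_withDensity_eq_lintegral_mul _ (Measure.measurable_rnDeriv _ _)]
      · rw [Measure.withDensity_rnDeriv_eq _ _ ac]; rfl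
      · rw [Measure.withDensity_rnDeriv_eq _ _ ac]; exact lm.ennreal_ofReal
    rw [e, lintegral_map lm.ennreal_ofReal hG]
    have e2 : ∫⁻ γ, ENNReal.ofReal (llr (π.map G) l (G γ)) ∂π ≤ ∫⁻ γ, ENNReal.ofReal ((1 - t) * llr μ0 m (P γ.1) + t * llr μ1 m (P γ.2)) ∂π := by
      apply lintegral_mono_ae
      filter_upwards [key] with γ h
      exact ENNReal.ofReal_le_ofReal h
    refine ne_top_of_le_ne_top ?_ e2
    exact ((lintegral_ofReal_le_lintegral_enorm _).trans_lt jF.2).ne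
  obtain ⟨-, iz⟩ := InformationTheory.klDiv_ne_top_iff.1 kl
  have dp := InformationTheory.klDiv_map_le (π.map G) l hP
  rw [← hm] at dp
  obtain ⟨ac', iz'⟩ := InformationTheory.klDiv_ne_top_iff.1 (ne_top_of_le_ne_top kl dp)
  refine ⟨ac', iz', ?_⟩
  have dp2 := ENNReal.toReal_mono kl dp
  rw [InformationTheory.toReal_klDiv ac' iz', InformationTheory.toReal_klDiv ac iz] at dp2
  have mm : m.real Set.univ = l.real Set.univ := by
    rw [hm, measureReal_def, measureReal_def, Measure.map_apply hP MeasurableSet.univ, Set.preimage_univ]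
  rw [mm, probReal_univ (μ := π.map G), probReal_univ (μ := (π.map G).map P)] at dp2
  have iz2 : Integrable (fun γ => llr (π.map G) l (G γ)) π := (integrable_map_measure lm.aestronglyMeasurable hG.aemeasurable).1 iz
  have fin := integral_mono_ae iz2 jF key
  rw [integral_add (j0.const_mul _) (j1.const_mul _), integral_const_mul, integral_const_mul, k0, k1] at fin
  rw [integral_map hG.aemeasurable lm.aestronglyMeasurable] at dp2
  linarith

open MeasureTheory ProbabilityTheory Topology

lemma withDensity_comp_map (l : Measure (ℝ × ℝ)) (P : ℝ × ℝ → ℝ × ℝ) (hP : Measurable P) (ρ : ℝ × ℝ → ENNReal) (hρ : Measurable ρ) :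
    (l.withDensity (fun z => ρ (P z))).map P = (l.map P).withDensity ρ := by
  ext s hs
  rw [Measure.map_apply hP hs, withDensity_apply _ (hP hs), withDensity_apply _ hs, setLIntegral_map hs hρ hP]

lemma Ent_cases {α : Type*} [MeasurableSpace α] (m μ : Measure α) (h : μ ≪ m) :
    (Integrable (llr μ m) μ ∧ Ent m μ = ((∫ z, llr μ m z ∂μ : ℝ) : EReal)) ∨ Ent m μ = ⊤ := by
  by_cases hi : Integrable (llr μ m) μ
  · left; exact ⟨hi, by unfold Ent; rw [if_pos ⟨h, hi⟩]⟩
  · right; unfold Ent; rw [if_neg (fun h => hi h.2)]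

lemma Ent_mul_ne_bot {α : Type*} [MeasurableSpace α] (m μ : Measure α) (h : μ ≪ m) (t : ℝ) (ht : 0 < t) :
    ((t : ℝ) : EReal) * Ent m μ ≠ ⊥ := by
  rcases Ent_cases m μ h with ⟨-, e⟩ | e
  · rw [e, ← EReal.coe_mul]; exact EReal.coe_ne_bot _
  · rw [e, EReal.coe_mul_top_of_pos ht]; simp

namespace FH

lemma main {k : ℝ} {f f' φ : ℝ → ℝ} (H : FH k f f' φ) (K : ℝ) (hK : 1 ≤ K) (X₀ : Set (ℝ × ℝ)) (hX : X₀ = {p : ℝ × ℝ | p.1 ∈ Set.Icc (-1 : ℝ) 1 ∧ 0 ≤ p.2 ∧ p.2 ≤ f p.1})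
    (m₀ : Measure (ℝ × ℝ)) (hm : m₀ = (lam K).map (PP f)) (μ₀ μ₁ : Measure (ℝ × ℝ)) [IsProbabilityMeasure μ₀] [IsProbabilityMeasure μ₁]
    (ac0 : μ₀ ≪ m₀) (ac1 : μ₁ ≪ m₀) :
    ∃ μ : ℝ → Measure (ℝ × ℝ),
      μ 0 = μ₀ ∧ μ 1 = μ₁ ∧
      (∀ t ∈ Set.Icc (0 : ℝ) 1, IsProbabilityMeasure (μ t) ∧ (μ t) X₀ᶜ = 0) ∧
      (∀ s ∈ Set.Icc (0 : ℝ) 1, ∀ t ∈ Set.Icc (0 : ℝ) 1,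
        W2sq dist (μ s) (μ t) = ENNReal.ofReal ((t - s) ^ 2) * W2sq dist μ₀ μ₁) ∧
      (∀ t ∈ Set.Icc (0 : ℝ) 1,
        Ent m₀ (μ t) ≤ ((1 - t : ℝ) : EReal) * Ent m₀ μ₀ + ((t : ℝ) : EReal) * Ent m₀ μ₁) := by
  have hPc := H.PP_cont
  have hP := hPc.measurable
  have fm : IsFiniteMeasure m₀ := by rw [hm]; infer_instance
  have hf := H.cont
  -- lifted measures
  have lift : ∀ μ : Measure (ℝ × ℝ), [IsProbabilityMeasure μ] → μ ≪ m₀ →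
      ((lam K).withDensity (fun z => μ.rnDeriv m₀ (PP f z))).map (PP f) = μ ∧
      IsProbabilityMeasure ((lam K).withDensity (fun z => μ.rnDeriv m₀ (PP f z))) ∧
      ((lam K).withDensity (fun z => μ.rnDeriv m₀ (PP f z))) RRᶜ = 0 := by
    intro μ _ ac
    have e : ((lam K).withDensity (fun z => μ.rnDeriv m₀ (PP f z))).map (PP f) = μ := by
      rw [withDensity_comp_map _ _ hP _ (Measure.measurable_rnDeriv _ _), ← hm, Measure.withDensity_rnDeriv_eq _ _ ac]
    refine ⟨e, ⟨?_⟩, withDensity_absolutelyContinuous _ _ (lam_RRc K)⟩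
    rw [← Set.preimage_univ (f := PP f), ← Measure.map_apply hP MeasurableSet.univ, e, measure_univ]
  obtain ⟨e0, pr0, n0⟩ := lift μ₀ ac0
  obtain ⟨e1, pr1, n1⟩ := lift μ₁ ac1
  have hr0 : Measurable fun z => μ₀.rnDeriv m₀ (PP f z) := (Measure.measurable_rnDeriv _ _).comp hP
  have hr1 : Measurable fun z => μ₁.rnDeriv m₀ (PP f z) := (Measure.measurable_rnDeriv _ _).comp hP
  obtain ⟨π, m0, m1, hmin, hmin2⟩ := lex_min _ _ RR RR_compact n0 n1 (cst f) sst H.cst_cont sst_cont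
  have prπ : IsProbabilityMeasure π := by
    constructor
    rw [← Set.preimage_univ (f := Prod.fst), ← Measure.map_apply measurable_fst MeasurableSet.univ, m0, measure_univ]
  have hR : π R2ᶜ = 0 := by
    have a : π (Prod.fst ⁻¹' RRᶜ) = 0 := by rw [← Measure.map_apply measurable_fst RR_meas.compl, m0]; exact n0
    have b : π (Prod.snd ⁻¹' RRᶜ) = 0 := by rw [← Measure.map_apply measurable_snd RR_meas.compl, m1]; exact n1
    refine measure_mono_null ?_ (measure_union_null a b)
    intro γ h
    by_contra hc
    simp only [Set.mem_union, Set.mem_preimage, Set.mem_compl_iff, not_or, not_not] at hc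
    exact h ⟨hc.1, hc.2⟩
  have aeR : ∀ᵐ γ ∂π, γ ∈ R2 := by
    filter_upwards [measure_eq_zero_iff_ae_notMem.1 hR] with γ hγ
    exact Set.notMem_compl_iff.1 hγ
  obtain ⟨Γ, hΓ, hΓ0⟩ := H.good_exists π hR (by rw [m0, m1]; exact hmin) (by rw [m0, m1]; exact hmin2)
  have q0 : Measurable fun γ : ZZ => PP f γ.1 := hP.comp measurable_fst
  have q1 : Measurable fun γ : ZZ => PP f γ.2 := hP.comp measurable_snd
  have p0 : π.map (fun γ : ZZ => PP f γ.1) = μ₀ := by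
    rw [← e0, ← m0, Measure.map_map hP measurable_fst]; rfl
  have p1 : π.map (fun γ : ZZ => PP f γ.2) = μ₁ := by
    rw [← e1, ← m1, Measure.map_map hP measurable_snd]; rfl
  have gm : ∀ t, Measurable fun γ => PP f (Gh f t γ) := fun t => hP.comp (H.Gh_meas t)
  have mt : ∀ t, (π.map (Gh f t)).map (PP f) = π.map (fun γ => PP f (Gh f t γ)) := fun t => Measure.map_map hP (H.Gh_meas t)
  have mu0 : (π.map (Gh f 0)).map (PP f) = μ₀ := by
    rw [mt, ← p0]
    apply Measure.map_congr
    filter_upwards [aeR] with γ h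
    exact H.PGh_zero h
  have mu1 : (π.map (Gh f 1)).map (PP f) = μ₁ := by
    rw [mt, ← p1]
    apply Measure.map_congr
    filter_upwards [aeR] with γ h
    exact H.PGh_one h
  have prt : ∀ t, IsProbabilityMeasure ((π.map (Gh f t)).map (PP f)) := fun t => by
    rw [mt]; exact Measure.isProbabilityMeasure_map (gm t).aemeasurable
  have dm : Measurable fun p : (ℝ × ℝ) × (ℝ × ℝ) => ENNReal.ofReal (dist p.1 p.2 ^ 2) := by fun_prop
  have opt : ∫⁻ γ, cst f γ ∂π ≤ W2sq dist μ₀ μ₁ := by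
    unfold W2sq
    refine le_iInf fun π₂ => le_iInf fun h => ?_
    obtain ⟨π', a, b, c⟩ := lift_coupling (PP f) hP _ _ π₂ (h.1.trans e0.symm) (h.2.trans e1.symm)
    refine (hmin π' a b).trans ?_
    rw [← c, lintegral_map dm (q0.prodMk q1)]
    exact le_rfl
  have up : ∀ s ∈ Set.Icc (0 : ℝ) 1, ∀ t ∈ Set.Icc (0 : ℝ) 1, W2sq dist ((π.map (Gh f s)).map (PP f)) ((π.map (Gh f t)).map (PP f)) ≤
      ENNReal.ofReal ((t - s) ^ 2) * ∫⁻ γ, cst f γ ∂π := by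
    intro s hs t ht
    unfold W2sq
    refine (iInf₂_le (π.map (fun γ => (PP f (Gh f s γ), PP f (Gh f t γ)))) ⟨?_, ?_⟩).trans ?_
    rotate_left
    · rw [Measure.map_map measurable_fst ((gm s).prodMk (gm t)), mt]; rfl
    · rw [Measure.map_map measurable_snd ((gm s).prodMk (gm t)), mt]; rfl
    · rw [lintegral_map dm ((gm s).prodMk (gm t)), ← lintegral_const_mul _ H.cst_cont.measurable.coe_nnreal_ennreal]
      apply lintegral_mono_ae
      filter_upwards [aeR] with γ h
      change _ ≤ ENNReal.ofReal ((t - s) ^ 2) * ENNReal.ofReal (dist (PP f γ.1) (PP f γ.2) ^ 2)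
      rw [← ENNReal.ofReal_mul (sq_nonneg _)]
      apply ENNReal.ofReal_le_ofReal
      have := H.Gh_dist h ht.1 ht.2 hs.1 hs.2
      have h2 := pow_le_pow_left₀ dist_nonneg this 2
      rw [mul_pow, sq_abs, ← neg_sub t s, neg_sq] at h2
      exact h2
  have fin : ∫⁻ γ, cst f γ ∂π ≠ ⊤ := by
    obtain ⟨M, hM⟩ := (RR_compact.prod RR_compact).bddAbove_image H.cst_cont.continuousOn
    have : ∫⁻ z, cst f z ∂π ≤ ∫⁻ z, M ∂π := by
      apply lintegral_mono_ae
      filter_upwards [aeR] with z hz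
      exact_mod_cast hM ⟨z, hz, rfl⟩
    refine ne_top_of_le_ne_top ?_ this
    simp
  have geo := W2_geod (by fun_prop) (fun t => (π.map (Gh f t)).map (PP f)) (fun t _ => prt t) (by
      refine ne_top_of_le_ne_top ?_ (up 0 ⟨le_rfl, zero_le_one⟩ 1 ⟨zero_le_one, le_rfl⟩)
      exact ENNReal.mul_ne_top ENNReal.ofReal_ne_top fin) (by
      intro s hs t ht
      refine (up s hs t ht).trans ?_
      rw [mu0, mu1]
      gcongr)
  refine ⟨fun t => (π.map (Gh f t)).map (PP f), mu0, mu1, ?_, ?_, ?_⟩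
  · intro t ht
    refine ⟨prt t, ?_⟩
    have mX : MeasurableSet X₀ := by
      rw [hX]
      apply MeasurableSet.inter
      · exact (isClosed_Icc.preimage continuous_fst).measurableSet
      · apply MeasurableSet.inter (s₁ := {p : ℝ × ℝ | 0 ≤ p.2}) (s₂ := {p : ℝ × ℝ | p.2 ≤ f p.1})
        · exact measurableSet_le (by fun_prop) (by fun_prop)
        · exact measurableSet_le (by fun_prop) (by fun_prop)
    change ((π.map (Gh f t)).map (PP f)) X₀ᶜ = 0
    rw [mt, Measure.map_apply (gm t) mX.compl, measure_eq_zero_iff_ae_notMem]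
    filter_upwards [aeR] with γ h
    rw [Set.mem_preimage, Set.notMem_compl_iff, hX]
    obtain ⟨a, b⟩ := H.Gh_mem h ht.1 ht.2
    have f0 := H.f0 (Gh f t γ).1
    exact ⟨a, mul_nonneg f0 b.1, mul_le_of_le_one_right f0 b.2⟩
  · intro s hs t ht
    have := geo s hs t ht
    rw [mu0, mu1] at this
    exact this
  · intro t ht
    change Ent m₀ ((π.map (Gh f t)).map (PP f)) ≤ _
    rcases ht.1.eq_or_lt with h0 | h0
    · rw [← h0, mu0]; simp
    rcases ht.2.eq_or_lt with h1 | h1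
    · rw [h1, mu1]; simp
    have s1 : 0 < 1 - t := by linarith
    rcases Ent_cases m₀ μ₀ ac0 with ⟨i0, E0⟩ | E0
    swap
    · rw [E0, EReal.coe_mul_top_of_pos s1, EReal.top_add_of_ne_bot (Ent_mul_ne_bot m₀ μ₁ ac1 t h0)]
      exact le_top
    rcases Ent_cases m₀ μ₁ ac1 with ⟨i1, E1⟩ | E1
    swap
    · rw [E1, EReal.coe_mul_top_of_pos h0, EReal.add_top_of_ne_bot (Ent_mul_ne_bot m₀ μ₀ ac0 _ s1)]
      exact le_top
    have t0 : ∀ᵐ γ ∂π, μ₀.rnDeriv m₀ (PP f γ.1) < ⊤ := by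
      have h2 : ∀ᵐ z ∂(π.map (fun γ : ZZ => PP f γ.1)), μ₀.rnDeriv m₀ z < ⊤ := by rw [p0]; exact ac0.ae_le (Measure.rnDeriv_lt_top μ₀ m₀)
      exact ae_of_ae_map q0.aemeasurable h2
    have t1 : ∀ᵐ γ ∂π, μ₁.rnDeriv m₀ (PP f γ.2) < ⊤ := by
      have h2 : ∀ᵐ z ∂(π.map (fun γ : ZZ => PP f γ.2)), μ₁.rnDeriv m₀ z < ⊤ := by rw [p1]; exact ac1.ae_le (Measure.rnDeriv_lt_top μ₁ m₀)
      exact ae_of_ae_map q1.aemeasurable h2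
    obtain ⟨ac, hb⟩ := H.interp hΓ K t hK h0 h1 π _ _ hr0 hr1 m0 m1 t0 t1 hΓ0
    obtain ⟨a, b, c⟩ := ent_interp (lam K) (PP f) hP m₀ hm μ₀ μ₁ ac0 ac1 i0 i1 π p0 p1 (Gh f t) (H.Gh_meas t) t ac hb
    rw [E0, E1, Ent, if_pos ⟨a, b⟩, ← EReal.coe_mul, ← EReal.coe_mul, ← EReal.coe_add]
    exact EReal.coe_le_coe_iff.2 c

end FH

theorem stmt_14 :
    ∃ k₀ > (0 : ℝ), ∃ K₀ : ℝ, 1 ≤ K₀ ∧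
    ∀ k K : ℝ, 0 < k → k < k₀ → K₀ ≤ K →
    ∀ φ : ℝ → ℝ, Continuous φ → (∀ x, 0 ≤ φ x) → (∀ x, φ x ≤ 1) →
      (∀ x, x ∉ Set.Icc (-k) k → φ x = 0) → (∫ x, φ x) = k →
    ∀ f₀ f₀' : ℝ → ℝ, (∀ x, HasDerivAt f₀ (f₀' x) x) → (∀ x, HasDerivAt f₀' (φ x) x) →
      f₀' (-1) = 0 → f₀ (-1) = 0 →
    ∀ X₀ : Set (ℝ × ℝ),
      X₀ = {p : ℝ × ℝ | p.1 ∈ Set.Icc (-1 : ℝ) 1 ∧ 0 ≤ p.2 ∧ p.2 ≤ f₀ p.1} →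
    ∀ m₀ : Measure (ℝ × ℝ),
      m₀ = (ENNReal.ofReal (∫ y in (0 : ℝ)..1, Real.exp (-K * y ^ 2))) •
            ((Measure.hausdorffMeasure 1 : Measure (ℝ × ℝ)).restrict
              {p : ℝ × ℝ | p.2 = 0 ∧ p.1 ∈ Set.Icc (-1 : ℝ) 1 ∧ f₀ p.1 = 0}) +
          volume.withDensity
            (Set.indicator {p : ℝ × ℝ | p ∈ X₀ ∧ 0 < f₀ p.1}
              fun z => ENNReal.ofReal ((1 / f₀ z.1) * Real.exp (-K * (z.2 / f₀ z.1) ^ 2))) →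
    ∀ μ₀ μ₁ : Measure (ℝ × ℝ), IsProbabilityMeasure μ₀ → IsProbabilityMeasure μ₁ →
      μ₀ ≪ m₀ → μ₁ ≪ m₀ →
    ∃ μ : ℝ → Measure (ℝ × ℝ),
      μ 0 = μ₀ ∧ μ 1 = μ₁ ∧
      (∀ t ∈ Set.Icc (0 : ℝ) 1, IsProbabilityMeasure (μ t) ∧ (μ t) X₀ᶜ = 0) ∧
      (∀ s ∈ Set.Icc (0 : ℝ) 1, ∀ t ∈ Set.Icc (0 : ℝ) 1,
        W2sq dist (μ s) (μ t) = ENNReal.ofReal ((t - s) ^ 2) * W2sq dist μ₀ μ₁) ∧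
      (∀ t ∈ Set.Icc (0 : ℝ) 1,
        Ent m₀ (μ t) ≤ ((1 - t : ℝ) : EReal) * Ent m₀ μ₀ + ((t : ℝ) : EReal) * Ent m₀ μ₁) := by
  refine ⟨1 / 1000, by norm_num, 1, le_rfl, ?_⟩
  intro k K hk hk' hK φ hc h0 h1 hs hi f f' hf hf' e' e X₀ hX m₀ hm μ₀ μ₁ p0 p1 ac0 ac1
  have H := FH_of k hk hk'.le φ f f' hc h0 h1 hs hi hf hf' e' e
  exact H.main K hK X₀ hX m₀ (hm.trans (H.m0_eq K X₀ hX)) μ₀ μ₁ ac0 ac1
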